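/- arXiv:1604.06973 — 2 statements merged into one kernel-verified Lean document; each statement's English description precedes it below -/
import Mathlib

section
/- Let X be an infinite set. The map Γ from the permutation group of X to the automorphism group of Fact(X), defined by Γ(σ)(θ,θ') = (σ(θ),σ(θ')), is a group isomorphism: it is an injective group homomorphism and every automorphism of Fact(X) is of the form Γ(σ) for some permutation σ of X. -/
/-- A factor pair is a pair of equivalence relations with `θ ∩ θ' = Δ` and `θ ∘ θ' = ∇`. -/
def IsFactorPair {X : Type*} (θ θ' : Setoid X) : Prop :=
  (∀ x y : X, θ x y ∧ θ' x y ↔ x = y) ∧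
  ∀ x y : X, Relation.Comp (⇑θ) (⇑θ') x y

/-- `Fact X`, the set of factor pairs of `X`. -/
def FactPair (X : Type*) : Type _ :=
  {p : Setoid X × Setoid X // IsFactorPair p.1 p.2}

/-- The order on `Fact X`: `(θ,θ') ≤ (φ,φ')` iff `φ ⊆ θ`, `θ' ⊆ φ'` and `φ∘θ' = θ'∘φ`. -/
def FactLE {X : Type*} (p q : FactPair X) : Prop :=
  q.1.1 ≤ p.1.1 ∧ p.1.2 ≤ q.1.2 ∧
    Relation.Comp (⇑q.1.1) (⇑p.1.2) = Relation.Comp (⇑p.1.2) (⇑q.1.1)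

def FactLT {X : Type*} (p q : FactPair X) : Prop :=
  FactLE p q ∧ p ≠ q

/-- The orthocomplementation `(θ,θ')^⊥ = (θ',θ)` on `Fact X`. -/
def FactPerp {X : Type*} (p : FactPair X) : FactPair X :=
  ⟨(p.1.2, p.1.1), by
    obtain ⟨h1, h2⟩ := p.2
    refine ⟨fun x y => ⟨fun h => (h1 x y).1 ⟨h.2, h.1⟩, ?_⟩, fun x y => ?_⟩
    · rintro rfl
      exact ⟨p.1.2.refl' x, p.1.1.refl' x⟩
    · obtain ⟨z, hz1, hz2⟩ := h2 y x
      exact ⟨z, p.1.2.symm' hz2, p.1.1.symm' hz1⟩⟩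

/-- `0 = (∇,Δ)` in `Fact X`. -/
def FactZero (X : Type*) : FactPair X :=
  ⟨(⊤, ⊥), by
    refine ⟨fun x y => ⟨fun h => ?_, ?_⟩, fun x y => ⟨y, ?_, ?_⟩⟩
    · simpa [Setoid.bot_def] using h.2
    · rintro rfl
      exact ⟨(⊤ : Setoid X).refl' x, (⊥ : Setoid X).refl' x⟩
    · simp [Setoid.top_def]
    · simp [Setoid.bot_def]⟩

/-- `1 = (Δ,∇)` in `Fact X`. -/
def FactOne (X : Type*) : FactPair X :=
  ⟨(⊥, ⊤), by
    refine ⟨fun x y => ⟨fun h => ?_, ?_⟩, fun x y => ⟨x, ?_, ?_⟩⟩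
    · simpa [Setoid.bot_def] using h.1
    · rintro rfl
      exact ⟨(⊥ : Setoid X).refl' x, (⊤ : Setoid X).refl' x⟩
    · simp [Setoid.bot_def]
    · simp [Setoid.top_def]⟩

/-- An atom of `Fact X`. -/
def IsFactAtom {X : Type*} (a : FactPair X) : Prop :=
  FactLT (FactZero X) a ∧ ∀ x : FactPair X, FactLT (FactZero X) x → ¬ FactLT x a

/-- An `n`-relation: every equivalence class has exactly `n` elements. -/
def IsNRel {X : Type*} (n : ℕ) (θ : Setoid X) : Prop :=
  ∀ x : X, Nat.card {y // θ x y} = n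

/-- A `p`-atom: an atom `(φ,φ')` such that `φ'` is a `p`-relation. -/
def IsPAtom {X : Type*} (p : ℕ) (a : FactPair X) : Prop :=
  IsFactAtom a ∧ IsNRel p a.1.2

/-- The image `σ(θ) = {(σ x, σ y) : (x,y) ∈ θ}` of an equivalence relation under a
permutation. -/
def permSetoid {X : Type*} (σ : Equiv.Perm X) (θ : Setoid X) : Setoid X :=
  ⟨fun a b => θ (σ.symm a) (σ.symm b),
    ⟨fun a => θ.refl' _, fun h => θ.symm' h, fun h1 h2 => θ.trans' h1 h2⟩⟩

/-- The action `Γ(σ)(θ,θ') = (σ(θ),σ(θ'))` of a permutation on factor pairs. -/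
def permFactPair {X : Type*} (σ : Equiv.Perm X) (t : FactPair X) : FactPair X :=
  ⟨(permSetoid σ t.1.1, permSetoid σ t.1.2), by
    obtain ⟨h1, h2⟩ := t.2
    refine ⟨fun x y => ⟨fun h => ?_, ?_⟩, fun x y => ?_⟩
    · exact σ.symm.injective ((h1 (σ.symm x) (σ.symm y)).1 ⟨h.1, h.2⟩)
    · rintro rfl
      exact ⟨t.1.1.refl' _, t.1.2.refl' _⟩
    · obtain ⟨w, hw1, hw2⟩ := h2 (σ.symm x) (σ.symm y)
      refine ⟨σ w, ?_, ?_⟩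
      · show t.1.1 (σ.symm x) (σ.symm (σ w))
        simpa using hw1
      · show t.1.2 (σ.symm (σ w)) (σ.symm y)
        simpa using hw2⟩

/-- An automorphism of `Fact X`: a bijection preserving `≤` in both directions and
commuting with `⊥`. -/
def IsFactAut {X : Type*} (α : FactPair X → FactPair X) : Prop :=
  Function.Bijective α ∧
  (∀ p q : FactPair X, FactLE p q ↔ FactLE (α p) (α q)) ∧
  ∀ p : FactPair X, α (FactPerp p) = FactPerp (α p)

/-- `Eq*(X)`: the equivalence relations on `X` that are `n`-relations for some `n ≥ 1`. -/
def EqStar (X : Type*) : Type _ :=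
  {θ : Setoid X // ∃ n : ℕ, 0 < n ∧ IsNRel n θ}

/-- A regular equivalence relation: any two classes are equinumerous. -/
def IsRegularRel {X : Type*} (θ : Setoid X) : Prop :=
  ∀ x y : X, Nonempty ({z // θ x z} ≃ {z // θ y z})

/-- The action of a permutation on `Eq*(X)`. -/
def permEqStar {X : Type*} (σ : Equiv.Perm X) (θ : EqStar X) : EqStar X :=
  ⟨permSetoid σ θ.1, by
    obtain ⟨n, hn, hrel⟩ := θ.2
    refine ⟨n, hn, fun x => ?_⟩
    have e : {y // (permSetoid σ θ.1) x y} ≃ {y // θ.1 (σ.symm x) y} :=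
      σ.symm.subtypeEquiv fun y => Iff.rfl
    rw [Nat.card_congr e]
    exact hrel (σ.symm x)⟩


namespace WF

universe u

section Basics
variable {X : Type u}

/-- First relation of a factor pair. -/
def R (c : FactPair X) (x y : X) : Prop := c.1.1 x y
/-- Second relation of a factor pair. -/
def S (c : FactPair X) (x y : X) : Prop := c.1.2 x y

theorem R_refl (c : FactPair X) (x : X) : R c x x := c.1.1.refl' x
theorem S_refl (c : FactPair X) (x : X) : S c x x := c.1.2.refl' x
theorem R_symm {c : FactPair X} {x y : X} (h : R c x y) : R c y x := c.1.1.symm' h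
theorem S_symm {c : FactPair X} {x y : X} (h : S c x y) : S c y x := c.1.2.symm' h
theorem R_trans {c : FactPair X} {x y z : X} (h : R c x y) (k : R c y z) : R c x z :=
  c.1.1.trans' h k
theorem S_trans {c : FactPair X} {x y z : X} (h : S c x y) (k : S c y z) : S c x z :=
  c.1.2.trans' h k
theorem sep {c : FactPair X} {x y : X} (h : R c x y) (k : S c x y) : x = y :=
  (c.2.1 x y).1 ⟨h, k⟩
theorem ex (c : FactPair X) (x y : X) : ∃ z, R c x z ∧ S c z y := c.2.2 x y

theorem ext' {a b : FactPair X} (h1 : ∀ x y, R a x y ↔ R b x y)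
    (h2 : ∀ x y, S a x y ↔ S b x y) : a = b := by
  apply Subtype.ext
  apply Prod.ext
  · exact Setoid.ext h1
  · exact Setoid.ext h2

theorem le_iff0 (a c : FactPair X) : FactLE a c ↔
    (∀ x y, R c x y → R a x y) ∧ (∀ x y, S a x y → S c x y) ∧
    (∀ x y z, S a x y → R c x z → ∃ w, S a z w ∧ R c y w) := by
  constructor
  · rintro ⟨h1, h2, h3⟩
    refine ⟨fun x y h => h1 h, fun x y h => h2 h, fun x y z h k => ?_⟩
    have : Relation.Comp (⇑c.1.1) (⇑a.1.2) z y := ⟨x, R_symm k, h⟩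
    rw [h3] at this
    obtain ⟨w, hw1, hw2⟩ := this
    exact ⟨w, hw1, R_symm hw2⟩
  · rintro ⟨h1, h2, h3⟩
    refine ⟨fun x y h => h1 x y h, fun x y h => h2 x y h, ?_⟩
    funext x y
    apply propext
    constructor
    · rintro ⟨z, h, k⟩
      obtain ⟨w, hw1, hw2⟩ := h3 z y x k (R_symm h)
      exact ⟨w, hw1, R_symm hw2⟩
    · rintro ⟨z, h, k⟩
      obtain ⟨w, hw1, hw2⟩ := h3 z x y (S_symm h) k
      exact ⟨w, hw2, S_symm hw1⟩

theorem le_refl' (a : FactPair X) : FactLE a a := by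
  rw [le_iff0]
  exact ⟨fun _ _ h => h, fun _ _ h => h, fun x y z h k => by
    obtain ⟨w, h1, h2⟩ := ex a y z
    exact ⟨w, S_symm h2, h1⟩⟩

theorem le_antisymm' {a b : FactPair X} (h : FactLE a b) (k : FactLE b a) : a = b := by
  rw [le_iff0] at h k
  exact ext' (fun x y => ⟨k.1 x y, h.1 x y⟩) (fun x y => ⟨h.2.1 x y, k.2.1 x y⟩)

theorem R_zero (x y : X) : R (FactZero X) x y ↔ True := by
  show (⊤ : Setoid X) x y ↔ True
  simp [Setoid.top_def]
theorem S_zero (x y : X) : S (FactZero X) x y ↔ x = y := by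
  show (⊥ : Setoid X) x y ↔ x = y
  simp [Setoid.bot_def]
theorem R_one (x y : X) : R (FactOne X) x y ↔ x = y := by
  show (⊥ : Setoid X) x y ↔ x = y
  simp [Setoid.bot_def]
theorem S_one (x y : X) : S (FactOne X) x y ↔ True := by
  show (⊤ : Setoid X) x y ↔ True
  simp [Setoid.top_def]

theorem zero_le' (a : FactPair X) : FactLE (FactZero X) a := by
  rw [le_iff0]
  refine ⟨fun x y h => by rw [R_zero]; trivial, fun x y h => ?_, fun x y z h k => ?_⟩
  · rw [S_zero] at h; subst h; exact S_refl _ _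
  · rw [S_zero] at h; subst h
    exact ⟨z, by rw [S_zero], k⟩

theorem le_one' (a : FactPair X) : FactLE a (FactOne X) := by
  rw [le_iff0]
  refine ⟨fun x y h => ?_, fun x y h => by rw [S_one]; trivial, fun x y z h k => ?_⟩
  · rw [R_one] at h; subst h; exact R_refl _ _
  · rw [R_one] at k; subst k
    exact ⟨y, h, by rw [R_one]⟩

theorem mkF (r s : X → X → Prop) (hr : Equivalence r) (hs : Equivalence s)
    (hsep : ∀ x y, r x y → s x y → x = y) (hex : ∀ x y, ∃ z, r x z ∧ s z y) :
    ∃ c : FactPair X, (∀ x y, R c x y ↔ r x y) ∧ (∀ x y, S c x y ↔ s x y) := by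
  refine ⟨⟨(⟨r, hr⟩, ⟨s, hs⟩), ⟨fun x y => ⟨fun h => hsep x y h.1 h.2, ?_⟩, hex⟩⟩,
    fun _ _ => Iff.rfl, fun _ _ => Iff.rfl⟩
  rintro rfl
  exact ⟨hr.refl x, hs.refl x⟩

theorem mkFun {A B : Type*} (F : X → A) (G : X → B)
    (hsep : ∀ x y, F x = F y → G x = G y → x = y) (hex : ∀ x y, ∃ z, F x = F z ∧ G z = G y) :
    ∃ c : FactPair X, (∀ x y, R c x y ↔ F x = F y) ∧ (∀ x y, S c x y ↔ G x = G y) :=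
  mkF _ _ ⟨fun _ => rfl, fun h => h.symm, fun h k => h.trans k⟩
    ⟨fun _ => rfl, fun h => h.symm, fun h k => h.trans k⟩ hsep hex

theorem R_perm (σ : Equiv.Perm X) (c : FactPair X) (x y : X) :
    R (permFactPair σ c) x y ↔ R c (σ.symm x) (σ.symm y) := Iff.rfl
theorem S_perm (σ : Equiv.Perm X) (c : FactPair X) (x y : X) :
    S (permFactPair σ c) x y ↔ S c (σ.symm x) (σ.symm y) := Iff.rfl

theorem R_perp (c : FactPair X) (x y : X) : R (FactPerp c) x y ↔ S c x y := Iff.rfl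
theorem S_perp (c : FactPair X) (x y : X) : S (FactPerp c) x y ↔ R c x y := Iff.rfl

theorem perm_mul (σ δ : Equiv.Perm X) (c : FactPair X) :
    permFactPair (σ * δ) c = permFactPair σ (permFactPair δ c) := by
  apply ext' <;> intro x y <;> simp only [R_perm, S_perm] <;> rfl

theorem perm_one (c : FactPair X) : permFactPair 1 c = c := by
  apply ext' <;> intro x y <;> simp only [R_perm, S_perm] <;> rfl

theorem perm_le (σ : Equiv.Perm X) {a b : FactPair X} (h : FactLE a b) :
    FactLE (permFactPair σ a) (permFactPair σ b) := by
  rw [le_iff0] at h ⊢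
  obtain ⟨h1, h2, h3⟩ := h
  refine ⟨fun x y => h1 _ _, fun x y => h2 _ _, fun x y z h k => ?_⟩
  obtain ⟨w, hw1, hw2⟩ := h3 _ _ _ h k
  refine ⟨σ w, ?_, ?_⟩
  · rw [S_perm]; simpa using hw1
  · rw [R_perm]; simpa using hw2

theorem perm_perp (σ : Equiv.Perm X) (a : FactPair X) :
    permFactPair σ (FactPerp a) = FactPerp (permFactPair σ a) := rfl

theorem perm_inv_cancel (σ : Equiv.Perm X) (a : FactPair X) :
    permFactPair σ⁻¹ (permFactPair σ a) = a := by
  rw [← perm_mul, inv_mul_cancel, perm_one]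

theorem perm_cancel_inv (σ : Equiv.Perm X) (a : FactPair X) :
    permFactPair σ (permFactPair σ⁻¹ a) = a := by
  rw [← perm_mul, mul_inv_cancel, perm_one]

theorem perm_aut (σ : Equiv.Perm X) : IsFactAut (permFactPair σ) := by
  refine ⟨⟨fun a b h => ?_, fun b => ⟨_, perm_cancel_inv σ b⟩⟩, fun a b => ⟨perm_le σ, fun h => ?_⟩,
    perm_perp σ⟩
  · have := congrArg (permFactPair σ⁻¹) h
    simpa [perm_inv_cancel] using this
  · have := perm_le σ⁻¹ h
    simpa [perm_inv_cancel] using this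

end Basics

theorem bne {a b : Bool} (h : ¬ a = b) : a = !b := by
  cases a <;> cases b <;> simp_all

theorem bor (a b : Bool) : a = b ∨ a = !b := by
  cases a <;> cases b <;> simp_all

section Atoms
variable {X : Type u}

/-- `m` is an involution that flips the two-colouring `f`. -/
def Ok (f : X → Bool) (m : X → X) : Prop := (∀ x, m (m x) = x) ∧ ∀ x, f (m x) = !f x

/-- `a` is the two-atom given by the colouring `f` and the matching `m`. -/
def IsAt (a : FactPair X) (f : X → Bool) (m : X → X) : Prop :=
  Ok f m ∧ (∀ x y, R a x y ↔ f x = f y) ∧ (∀ x y, S a x y ↔ y = x ∨ y = m x)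

theorem Ok.ne {f : X → Bool} {m : X → X} (h : Ok f m) (x : X) : m x ≠ x := by
  intro e
  have := h.2 x
  rw [e] at this
  simp at this

theorem exists_at {f : X → Bool} {m : X → X} (h : Ok f m) : ∃ a, IsAt a f m := by
  obtain ⟨h1, h2⟩ := h
  obtain ⟨c, hc1, hc2⟩ := mkF (fun x y => f x = f y) (fun x y => y = x ∨ y = m x)
    ⟨fun _ => rfl, fun h => h.symm, fun h k => h.trans k⟩
    ⟨fun _ => Or.inl rfl, by grind, by grind⟩ (by grind)
    (fun x y => if h : f x = f y then ⟨y, by grind⟩ else ⟨m y, by have := bne h; grind⟩)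
  exact ⟨c, ⟨h1, h2⟩, hc1, hc2⟩

theorem IsAt.uniq {a b : FactPair X} {f m} (h : IsAt a f m) (k : IsAt b f m) : a = b :=
  ext' (fun x y => by rw [h.2.1, k.2.1]) (fun x y => by rw [h.2.2, k.2.2])

theorem IsAt.le_iff {a c : FactPair X} {f m} (h : IsAt a f m) : FactLE a c ↔
    (∀ x y, R c x y → f x = f y) ∧ (∀ x, S c x (m x)) ∧ ∀ x y, R c x y → R c (m x) (m y) := by
  rw [le_iff0]
  obtain ⟨⟨h0, h0'⟩, h1, h2⟩ := h
  constructor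
  · rintro ⟨k1, k2, k3⟩
    refine ⟨fun x y hh => (h1 x y).1 (k1 x y hh), fun x => k2 _ _ ((h2 _ _).2 (Or.inr rfl)), ?_⟩
    intro x y hxy
    obtain ⟨w, hw1, hw2⟩ := k3 x (m x) y ((h2 _ _).2 (Or.inr rfl)) hxy
    rcases (h2 _ _).1 hw1 with rfl | rfl
    · have e1 := (h1 _ _).1 (k1 _ _ hw2)
      have e2 := (h1 _ _).1 (k1 _ _ hxy)
      rw [h0' x, e2] at e1
      simp at e1
    · exact hw2
  · rintro ⟨k1, k2, k3⟩
    refine ⟨fun x y hh => (h1 x y).2 (k1 x y hh), fun x y hxy => ?_, fun x y z hxy hxz => ?_⟩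
    · rcases (h2 _ _).1 hxy with rfl | rfl
      · exact S_refl _ _
      · exact k2 x
    · rcases (h2 _ _).1 hxy with rfl | rfl
      · exact ⟨z, S_refl _ _, hxz⟩
      · exact ⟨m z, (h2 _ _).2 (Or.inr rfl), k3 _ _ hxz⟩

theorem IsAt.m_uniq {a b : FactPair X} {f m g n} (h : IsAt a f m) (k : IsAt b g n)
    (e : ∀ x y, S a x y ↔ S b x y) : m = n := by
  funext x
  have h1 := (e x (m x)).1 ((h.2.2 _ _).2 (Or.inr rfl))
  rcases (k.2.2 _ _).1 h1 with h2 | h2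
  · exact absurd h2 (h.1.ne x)
  · exact h2

theorem IsAt.ne_zero {a : FactPair X} {f m} [Nonempty X] (h : IsAt a f m) : a ≠ FactZero X := by
  rintro rfl
  obtain ⟨x⟩ := ‹Nonempty X›
  have := (h.2.2 x (m x)).2 (Or.inr rfl)
  rw [S_zero] at this
  exact h.1.ne x this.symm

/-- Data for an element of size four. -/
def QD (f g : X → Bool) (m n : X → X) : Prop :=
  Ok f m ∧ Ok g n ∧ (∀ x, g (m x) = g x) ∧ (∀ x, f (n x) = f x) ∧ ∀ x, m (n x) = n (m x)

/-- `c` is the element of size four with the given data. -/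
def IsQ (c : FactPair X) (f g : X → Bool) (m n : X → X) : Prop :=
  QD f g m n ∧ (∀ x y, R c x y ↔ f x = f y ∧ g x = g y) ∧
    (∀ x y, S c x y ↔ y = x ∨ y = m x ∨ y = n x ∨ y = m (n x))

theorem exists_Q {f g : X → Bool} {m n : X → X} (h : QD f g m n) : ∃ c, IsQ c f g m n := by
  have hh := h
  obtain ⟨⟨h1, h2⟩, ⟨h3, h4⟩, h5, h6, h7⟩ := h
  obtain ⟨c, hc1, hc2⟩ := mkF (fun x y => f x = f y ∧ g x = g y)
    (fun x y => y = x ∨ y = m x ∨ y = n x ∨ y = m (n x))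
    ⟨fun _ => ⟨rfl, rfl⟩, fun h => ⟨h.1.symm, h.2.symm⟩, fun h k => ⟨h.1.trans k.1, h.2.trans k.2⟩⟩
    ⟨fun _ => Or.inl rfl, by grind, by grind⟩ (by grind)
    (fun x y => by
      by_cases hf : f x = f y <;> by_cases hg : g x = g y
      · exact ⟨y, by grind⟩
      · have := bne hg; exact ⟨n y, by grind⟩
      · have := bne hf; exact ⟨m y, by grind⟩
      · have := bne hf; have := bne hg; exact ⟨m (n y), by grind⟩)
  exact ⟨c, hh, hc1, hc2⟩

theorem Q_at_le {a c : FactPair X} {f g m n} (hc : IsQ c f g m n) (ha : IsAt a f m) :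
    FactLE a c := by
  rw [ha.le_iff]
  obtain ⟨⟨⟨h1, h2⟩, ⟨h3, h4⟩, h5, h6, h7⟩, h8, h9⟩ := hc
  simp only [h8, h9]
  grind

set_option maxHeartbeats 1000000 in
/-- The key lemma on two-atoms below an element of size four. -/
theorem keyK {a c : FactPair X} {f g m n u k} (hc : IsQ c f g m n) (ha : IsAt a u k)
    (hle : FactLE a c) :
    ((∀ x, k x = m x) ∨ (∀ x, k x = n x) ∨ (∀ x, k x = m (n x))) ∧
    ((∀ x y, u x = u y ↔ f x = f y) ∨ (∀ x y, u x = u y ↔ g x = g y) ∨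
      (∀ x y, u x = u y ↔ (f x ^^ g x) = (f y ^^ g y))) := by
  rw [ha.le_iff] at hle
  obtain ⟨⟨k1, k2⟩, -, -⟩ := ha
  obtain ⟨⟨⟨h1, h2⟩, ⟨h3, h4⟩, h5, h6, h7⟩, h8, h9⟩ := hc
  simp only [h8, h9] at hle
  obtain ⟨l1, l2, l3⟩ := hle
  have knex : ∀ x, k x ≠ x := by grind
  have key : (∀ x, k x = m x) ∨ (∀ x, k x = n x) ∨ (∀ x, k x = m (n x)) := by
    by_cases hX : Nonempty X
    swap
    · exact Or.inl fun x => (hX ⟨x⟩).elim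
    obtain ⟨x⟩ := hX
    have a1 : ∀ x y, f x = f y → g x = g y → k x = m x → k y = m y := by
      intro x y e1 e2 e3
      have := l3 x y ⟨e1, e2⟩
      have := l2 y
      grind
    have a2 : ∀ x y, f x = f y → g x = g y → k x = n x → k y = n y := by
      intro x y e1 e2 e3
      have := l3 x y ⟨e1, e2⟩
      have := l2 y
      grind
    have a3 : ∀ x y, f x = f y → g x = g y → k x = m (n x) → k y = m (n y) := by
      intro x y e1 e2 e3
      have := l3 x y ⟨e1, e2⟩
      have := l2 y
      grind
    rcases l2 x with h | h | h | h
    · exact absurd h (knex x)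
    · left
      have b1 : k (m x) = m (m x) := by grind
      have b2 : k (n x) = m (n x) := by
        have := l2 (n x); have := knex (n x); grind
      have b3 : k (m (n x)) = m (m (n x)) := by grind
      intro y
      by_cases hf : f x = f y <;> by_cases hg : g x = g y
      · exact a1 x y hf hg h
      · have := bne hg; exact a1 (n x) y (by grind) (by grind) b2
      · have := bne hf; exact a1 (m x) y (by grind) (by grind) b1
      · have := bne hf; have := bne hg; exact a1 (m (n x)) y (by grind) (by grind) b3
    · right; left
      have b1 : k (n x) = n (n x) := by grind
      have b2 : k (m x) = n (m x) := by
        have := l2 (m x); have := knex (m x); grind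
      have b3 : k (m (n x)) = n (m (n x)) := by grind
      intro y
      by_cases hf : f x = f y <;> by_cases hg : g x = g y
      · exact a2 x y hf hg h
      · have := bne hg; exact a2 (n x) y (by grind) (by grind) b1
      · have := bne hf; exact a2 (m x) y (by grind) (by grind) b2
      · have := bne hf; have := bne hg; exact a2 (m (n x)) y (by grind) (by grind) b3
    · right; right
      have b1 : k (m (n x)) = x := by grind
      have b2 : k (m x) = n x := by
        have := l2 (m x); have := knex (m x); grind
      have b3 : k (n x) = m x := by grind
      intro y
      by_cases hf : f x = f y <;> by_cases hg : g x = g y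
      · exact a3 x y hf hg h
      · have := bne hg; exact a3 (n x) y (by grind) (by grind) (by grind)
      · have := bne hf; exact a3 (m x) y (by grind) (by grind) (by grind)
      · have := bne hf; have := bne hg; exact a3 (m (n x)) y (by grind) (by grind) (by grind)
  refine ⟨key, ?_⟩
  by_cases hX : Nonempty X
  swap
  · exact Or.inl fun x => (hX ⟨x⟩).elim
  obtain ⟨x⟩ := hX
  have c1 := k2 x
  have c2 := k2 (m x)
  have c3 := k2 (n x)
  have u0 : ∀ y, (f y = f x → g y = g x → u y = u x) ∧
     (f y = (!f x) → g y = g x → u y = u (m x)) ∧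
     (f y = f x → g y = (!g x) → u y = u (n x)) ∧
     (f y = (!f x) → g y = (!g x) → u y = u (m (n x))) := by
    intro y
    refine ⟨fun e1 e2 => l1 _ _ ⟨e1, e2⟩, fun e1 e2 => l1 _ _ ⟨?_, ?_⟩, fun e1 e2 => l1 _ _ ⟨?_, ?_⟩,
      fun e1 e2 => l1 _ _ ⟨?_, ?_⟩⟩ <;> grind
  have key2 : (u (m x) = (!u x) ∧ u (n x) = u x ∧ u (m (n x)) = (!u x)) ∨
     (u (m x) = (u x) ∧ u (n x) = (!u x) ∧ u (m (n x)) = (!u x)) ∨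
     (u (m x) = (!u x) ∧ u (n x) = (!u x) ∧ u (m (n x)) = (u x)) := by
    have d1 := bor (u (m x)) (u x)
    have d2 := bor (u (n x)) (u x)
    rcases key with key | key | key
    · simp only [key] at c1 c2 c3; grind
    · simp only [key] at c1 c2 c3; grind
    · simp only [key] at c1 c2 c3; grind
  have fin : ∀ y, (f y = f x ∨ f y = !f x) ∧ (g y = g x ∨ g y = !g x) := by
    intro y
    cases f y <;> cases f x <;> cases g y <;> cases g x <;> simp
  rcases key2 with hh | hh | hh
  · left
    intro y z
    have := u0 y; have := u0 z; have := fin y; have := fin z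
    grind
  · right; left
    intro y z
    have := u0 y; have := u0 z; have := fin y; have := fin z
    grind
  · right; right
    have A : ∀ y, u y = (u x ^^ (f y ^^ f x) ^^ (g y ^^ g x)) := by
      intro y
      have hy := u0 y
      rcases fin y with ⟨e1 | e1, e2 | e2⟩
      · have uy : u y = u x := hy.1 e1 e2
        rw [uy, e1, e2]; simp
      · have uy : u y = !u x := (hy.2.2.1 e1 e2).trans hh.2.1
        rw [uy, e1, e2]; simp
      · have uy : u y = !u x := (hy.2.1 e1 e2).trans hh.1
        rw [uy, e1, e2]; simp
      · have uy : u y = u x := (hy.2.2.2 e1 e2).trans hh.2.2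
        rw [uy, e1, e2]; simp
    intro y z
    rw [A y, A z]
    generalize f y = p1
    generalize f z = p2
    generalize g y = p3
    generalize g z = p4
    generalize f x = p5
    generalize g x = p6
    generalize u x = p7
    revert p1 p2 p3 p4 p5 p6 p7
    decide

end Atoms

end WF


namespace WF
universe u
section Lift
variable {X : Type u}

/-- Coordinates of a factor pair. -/
noncomputable def coord (c : FactPair X) : X ≃ Quotient c.1.1 × Quotient c.1.2 :=
  Equiv.ofBijective (fun x => (Quotient.mk _ x, Quotient.mk _ x)) (by
    constructor
    · intro x y h
      have h := Prod.mk.inj h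
      exact sep (Quotient.exact h.1) (Quotient.exact h.2)
    · rintro ⟨a, b⟩
      induction a using Quotient.inductionOn with | _ x
      induction b using Quotient.inductionOn with | _ y
      obtain ⟨z, h1, h2⟩ := ex c x y
      exact ⟨z, Prod.ext (Quotient.sound (R_symm h1)) (Quotient.sound h2)⟩)

theorem coord_fst (c : FactPair X) (x y : X) : (coord c x).1 = (coord c y).1 ↔ R c x y :=
  ⟨fun h => Quotient.exact h, fun h => Quotient.sound h⟩
theorem coord_snd (c : FactPair X) (x y : X) : (coord c x).2 = (coord c y).2 ↔ S c x y :=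
  ⟨fun h => Quotient.exact h, fun h => Quotient.sound h⟩

theorem lift_swap {c : FactPair X} {u v : X} (h : S c u v) : ∃ L : Equiv.Perm X,
    (∀ x y, R c (L x) (L y) ↔ R c x y) ∧ (∀ x, S c x (L x)) ∧ (∀ x, L (L x) = x) ∧
    L u = v ∧ ∀ w, ¬ R c w u → ¬ R c w v → L w = w := by
  classical
  let σ : Equiv.Perm (Quotient c.1.1) := Equiv.swap (coord c u).1 (coord c v).1
  let L : Equiv.Perm X := (coord c).trans ((σ.prodCongr (Equiv.refl _)).trans (coord c).symm)
  have hL : ∀ x, coord c (L x) = (σ (coord c x).1, (coord c x).2) := by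
    intro x
    simp [L]
    rfl
  refine ⟨L, fun x y => ?_, fun x => ?_, fun x => ?_, ?_, fun w h1 h2 => ?_⟩
  · rw [← coord_fst, ← coord_fst, hL, hL]; simp
  · rw [← coord_snd, hL]
  · apply (coord c).injective
    rw [hL, hL]
    simp [σ]
  · apply (coord c).injective
    rw [hL]
    apply Prod.ext
    · simp [σ]
    · exact (coord_snd c u v).2 h
  · apply (coord c).injective
    rw [hL]
    rw [← coord_fst] at h1 h2
    apply Prod.ext
    · simp [σ, Equiv.swap_apply_of_ne_of_ne h1 h2]
    · rfl

theorem perm_le_of {a c : FactPair X} {L : Equiv.Perm X} (h : FactLE a c)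
    (h1 : ∀ x y, R c (L x) (L y) ↔ R c x y) (h2 : ∀ x, S c x (L x)) :
    FactLE (permFactPair L a) c := by
  have : permFactPair L c = c := by
    apply ext'
    · intro x y
      rw [R_perm, ← h1]; simp
    · intro x y
      rw [S_perm]
      have e1 := h2 (L.symm x)
      have e2 := h2 (L.symm y)
      rw [Equiv.apply_symm_apply] at e1 e2
      exact ⟨fun h => S_trans (S_symm e1) (S_trans h e2), fun h => S_trans e1 (S_trans h (S_symm e2))⟩
  have h3 := perm_le L h
  rwa [this] at h3

/-- At most eight elements lie below `c`. -/
def Small (c : FactPair X) : Prop := ∃ s : Fin 8 → FactPair X, ∀ x, FactLE x c → ∃ i, s i = x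

theorem nine {a c : FactPair X} (hle : FactLE a c) (hs : Small c) (ρ : X → X → Prop)
    (rs : ∀ x y, ρ x y → ρ y x) (rt : ∀ x y z, ρ x y → ρ y z → ρ x z)
    (hρ : ∀ L L' : Equiv.Perm X, permFactPair L a = permFactPair L' a →
      ∀ x y, ρ (L.symm x) (L.symm y) → ρ (L'.symm x) (L'.symm y))
    (x y : Fin 3 → X) (hx : Function.Injective x) (hy : Function.Injective y)
    (x0 : X) (hx0 : ∀ i, S c x0 (x i)) (hy0 : ∀ i, S c x0 (y i))
    (rx : ∀ i j, ρ (x i) (x j)) (ry : ∀ i j, ρ (y i) (y j)) (rxy : ∀ i j, ¬ ρ (x i) (y j)) :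
    False := by
  obtain ⟨s, hs⟩ := hs
  have xy : ∀ i j, x i ≠ y j := fun i j h => rxy i j (h ▸ rx i i)
  have key : ∀ i j, ∃ L : Equiv.Perm X, FactLE (permFactPair L a) c ∧
      (L.symm (x i) = y j) ∧ (L.symm (y j) = x i) ∧ (∀ k, k ≠ i → L.symm (x k) = x k) ∧
      (∀ k, k ≠ j → L.symm (y k) = y k) := by
    intro i j
    obtain ⟨L, h1, h2, h3, h4, h5⟩ := lift_swap (S_trans (S_symm (hx0 i)) (hy0 j))
    have hsy : ∀ z, L.symm z = L z := fun z => by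
      rw [Equiv.symm_apply_eq, h3]
    have nr : ∀ u v, S c x0 u → S c x0 v → u ≠ v → ¬ R c u v := fun u v k1 k2 k3 k4 =>
      k3 (sep k4 (S_trans (S_symm k1) k2))
    refine ⟨L, perm_le_of hle h1 h2, ?_, ?_, ?_, ?_⟩
    · rw [hsy, h4]
    · rw [hsy, ← h4, h3]
    · intro k hk
      rw [hsy, h5]
      · exact nr _ _ (hx0 _) (hx0 _) fun e => hk (hx e)
      · exact nr _ _ (hx0 _) (hy0 _) (xy _ _)
    · intro k hk
      rw [hsy, h5]
      · exact nr _ _ (hy0 _) (hx0 _) (xy _ _).symm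
      · exact nr _ _ (hy0 _) (hy0 _) fun e => hk (hy e)
  choose L l1 l2 l3 l4 l5 using key
  have third : ∀ i j : Fin 3, ∃ k, k ≠ i ∧ k ≠ j := by decide
  have inj : ∀ i j k l, permFactPair (L i j) a = permFactPair (L k l) a → i = k ∧ j = l := by
    intro i j k l h
    have e1 : i = k := by
      by_contra hik
      obtain ⟨t, t1, t2⟩ := third i k
      have := hρ _ _ h.symm (x i) (x t) (by rw [l4 _ _ _ hik, l4 _ _ _ t2]; exact rx _ _)
      rw [l2, l4 _ _ _ t1] at this
      exact rxy _ _ (rs _ _ this)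
    subst e1
    refine ⟨rfl, ?_⟩
    by_contra hjl
    obtain ⟨t, t1, t2⟩ := third j l
    have := hρ _ _ h.symm (y j) (y t) (by rw [l5 _ _ _ hjl, l5 _ _ _ t2]; exact ry _ _)
    rw [l3, l5 _ _ _ t1] at this
    exact rxy _ _ this
  choose d hd using fun p : Fin 3 × Fin 3 => hs _ (l1 p.1 p.2)
  have : Function.Injective d := by
    intro p q h
    have h1 := hd p
    rw [h, hd q] at h1
    obtain ⟨h2, h3⟩ := inj _ _ _ _ h1
    exact Prod.ext h2.symm h3.symm
  have := Fintype.card_le_of_injective d this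
  simp at this

end Lift
end WF


namespace WF
universe u
section T1
variable {X : Type u}

/-- `a` is a proper nonzero element below the small element `c`. -/
def Tq (a c : FactPair X) : Prop := a ≠ FactZero X ∧ a ≠ c ∧ FactLE a c ∧ Small c

theorem ex2 (c : FactPair X) (x y : X) : ∃ z, S c x z ∧ R c z y := by
  obtain ⟨z, h1, h2⟩ := ex c y x
  exact ⟨z, S_symm h2, R_symm h1⟩

theorem nzero {a : FactPair X} (h : a ≠ FactZero X) (x0 : X) : ∃ y, y ≠ x0 ∧ S a x0 y := by
  by_contra hc
  push Not at hc
  apply h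
  have e : ∀ x y, S a x y → x = y := by
    intro x y hxy
    obtain ⟨z0, h1, h2⟩ := ex2 a x0 x
    obtain ⟨z1, h3, h4⟩ := ex2 a x0 y
    have e0 : z0 = x0 := by by_contra hne; exact hc _ hne h1
    have e1 : z1 = x0 := by by_contra hne; exact hc _ hne h3
    subst e0; subst e1
    exact sep (R_trans (R_symm h2) h4) hxy
  apply ext'
  · intro x y
    rw [R_zero]
    obtain ⟨z, h1, h2⟩ := ex a x y
    have := e _ _ h2
    subst this
    simp [h1]
  · intro x y
    rw [S_zero]
    exact ⟨e x y, fun h => h ▸ S_refl _ _⟩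

theorem nfull {a c : FactPair X} (hle : FactLE a c) (h : a ≠ c) (x0 : X) :
    ∃ y, y ≠ x0 ∧ R a x0 y ∧ S c x0 y := by
  by_contra hc
  push Not at hc
  rw [le_iff0] at hle
  obtain ⟨l1, l2, l3⟩ := hle
  apply h
  have e : ∀ x y, R a x y → S c x y → x = y := by
    intro x y hxy hxy'
    obtain ⟨x', h1, h2⟩ := ex c x x0
    obtain ⟨y', h3, h4⟩ := ex c y x0
    have h5 : R a x' y' := R_trans (R_symm (l1 _ _ h1)) (R_trans hxy (l1 _ _ h3))
    obtain ⟨z, k1, k2⟩ := ex a x0 x'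
    obtain ⟨w, k3, k4⟩ := ex a x0 y'
    have e0 : z = x0 := by
      by_contra hne
      exact hc _ hne k1 (S_trans (S_symm h2) (S_symm (l2 _ _ k2)))
    have e1 : w = x0 := by
      by_contra hne
      exact hc _ hne k3 (S_trans (S_symm h4) (S_symm (l2 _ _ k4)))
    subst e0; subst e1
    have e2 := sep h5 (S_trans (S_symm k2) k4)
    subst e2
    exact sep (R_trans h1 (R_symm h3)) hxy'
  apply ext'
  · intro x y
    refine ⟨fun h => ?_, l1 x y⟩
    obtain ⟨z, h1, h2⟩ := ex c x y
    have := e z y (R_trans (R_symm (l1 _ _ h1)) h) h2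
    subst this
    exact h1
  · intro x y
    refine ⟨l2 x y, fun h => ?_⟩
    obtain ⟨z, h1, h2⟩ := ex a x y
    have := e x z h1 (S_trans h (S_symm (l2 _ _ h2)))
    subst this
    exact h2

theorem T1_S {a c : FactPair X} (h : Tq a c) (x : Fin 3 → X) (hx : Function.Injective x)
    (hS : ∀ i, S a (x 0) (x i)) : False := by
  obtain ⟨-, h2, h3, h4⟩ := h
  obtain ⟨y0, hy1, hy2, hy3⟩ := nfull h3 h2 (x 0)
  have hle := h3
  rw [le_iff0] at h3
  obtain ⟨l1, l2, l3⟩ := h3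
  choose y k1 k2 using fun i => ex2 a y0 (x i)
  refine nine hle h4 (S a) (fun _ _ => S_symm) (fun _ _ _ => S_trans) ?_ x y hx ?_ (x 0)
    (fun i => l2 _ _ (hS i)) (fun i => S_trans hy3 (l2 _ _ (k1 i)))
    (fun i j => S_trans (S_symm (hS i)) (hS j)) (fun i j => S_trans (S_symm (k1 i)) (k1 j)) ?_
  · intro L L' e u v
    rw [← S_perm, ← S_perm, e]; exact id
  · intro i j e
    have e1 := k2 j
    rw [← e] at e1
    exact hx (sep (R_trans (R_symm (k2 i)) e1) (S_trans (S_symm (hS i)) (hS j)))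
  · intro i j e
    exact hy1 (sep hy2 (S_trans (S_trans (hS i) e) (S_symm (k1 j)))).symm

theorem T1_R {a c : FactPair X} (h : Tq a c) (x : Fin 3 → X) (hx : Function.Injective x)
    (hR : ∀ i, R a (x 0) (x i)) (hS : ∀ i, S c (x 0) (x i)) : False := by
  obtain ⟨h1, h2, h3, h4⟩ := h
  obtain ⟨y0, hy1, hy2⟩ := nzero h1 (x 0)
  have hle := h3
  rw [le_iff0] at h3
  obtain ⟨l1, l2, l3⟩ := h3
  choose y k1 k2 using fun i => ex a y0 (x i)
  refine nine hle h4 (R a) (fun _ _ => R_symm) (fun _ _ _ => R_trans) ?_ x y hx ?_ (x 0)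
    hS (fun i => S_trans (hS i) (S_symm (l2 _ _ (k2 i))))
    (fun i j => R_trans (R_symm (hR i)) (hR j)) (fun i j => R_trans (R_symm (k1 i)) (k1 j)) ?_
  · intro L L' e u v
    rw [← R_perm, ← R_perm, e]; exact id
  · intro i j e
    have e1 := k2 j
    rw [← e] at e1
    exact hx (sep (R_trans (R_symm (hR i)) (hR j)) (S_trans (S_symm (k2 i)) e1))
  · intro i j e
    exact hy1 (sep (R_trans (R_trans (hR i) e) (R_symm (k1 j))) hy2).symm

theorem inj3 {p q r : X} (h1 : q ≠ p) (h2 : r ≠ p) (h3 : r ≠ q) :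
    Function.Injective ![p, q, r] := by
  intro i j h
  fin_cases i <;> fin_cases j <;> simp_all

set_option maxHeartbeats 1000000 in
theorem T1 [Nonempty X] {a c : FactPair X} (h : Tq a c) :
    ∃ f m g n, IsAt a f m ∧ IsQ c f g m n := by
  classical
  have h0 := h
  obtain ⟨h1, h2, hle, h4⟩ := h
  obtain ⟨x0⟩ := ‹Nonempty X›
  choose m m1 m2 using nzero h1
  choose n n1 n2 n3 using nfull hle h2
  have Sa : ∀ x y, S a x y ↔ y = x ∨ y = m x := by
    intro x y
    constructor
    · intro hxy
      by_contra hc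
      push Not at hc
      refine T1_S h0 ![x, m x, y] (inj3 (m1 x) hc.1 hc.2) ?_
      intro i; fin_cases i
      · exact S_refl _ _
      · exact m2 x
      · exact hxy
    · rintro (rfl | rfl)
      · exact S_refl _ _
      · exact m2 x
  have Rn : ∀ x y, R a x y → S c x y → y = x ∨ y = n x := by
    intro x y hxy hxy'
    by_contra hc
    push Not at hc
    refine T1_R h0 ![x, n x, y] (inj3 (n1 x) hc.1 hc.2) ?_ ?_
    · intro i; fin_cases i
      · exact R_refl _ _
      · exact n2 x
      · exact hxy
    · intro i; fin_cases i
      · exact S_refl _ _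
      · exact n3 x
      · exact hxy'
  have mm : ∀ x, m (m x) = x := by
    intro x
    rcases (Sa (m x) x).1 (S_symm (m2 x)) with e | e
    · exact absurd e.symm (m1 x)
    · exact e.symm
  have nn : ∀ x, n (n x) = x := by
    intro x
    rcases Rn (n x) x (R_symm (n2 x)) (S_symm (n3 x)) with e | e
    · exact absurd e.symm (n1 x)
    · exact e.symm
  have mR : ∀ x, ¬ R a x (m x) := fun x e => m1 x (sep e (m2 x)).symm
  have two : ∀ x, R a x0 x ∨ R a (m x0) x := by
    intro x
    obtain ⟨z, k1, k2⟩ := ex2 a x0 x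
    rcases (Sa _ _).1 k1 with e | e
    · subst e; exact Or.inl k2
    · subst e; exact Or.inr k2
  have ntwo : ∀ x, R a x0 x → ¬ R a (m x0) x := fun x e1 e2 => mR _ (R_trans e1 (R_symm e2))
  let f : X → Bool := fun x => decide (R a x0 x)
  have Rf : ∀ x y, R a x y ↔ f x = f y := by
    intro x y
    have t1 := two x; have t2 := two y
    have t3 := ntwo x; have t4 := ntwo y
    simp only [f, decide_eq_decide]
    constructor
    · intro e
      exact ⟨fun k => R_trans k e, fun k => R_trans k (R_symm e)⟩
    · intro e
      rcases t1 with t1 | t1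
      · exact R_trans (R_symm t1) (e.1 t1)
      · rcases t2 with t2 | t2
        · exact R_trans (R_symm (e.2 t2)) t2
        · exact R_trans (R_symm t1) t2
  have fm : ∀ x, f (m x) = !f x := fun x => bne fun e => mR x ((Rf _ _).2 e.symm)
  have ha : IsAt a f m := ⟨⟨mm, fm⟩, Rf, Sa⟩
  obtain ⟨l1, l2, l3⟩ := ha.le_iff.1 hle
  have fn : ∀ x, f (n x) = f x := fun x => ((Rf _ _).1 (n2 x)).symm
  have Sc : ∀ x y, S c x y ↔ y = x ∨ y = m x ∨ y = n x ∨ y = m (n x) := by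
    intro x y
    constructor
    · intro e
      obtain ⟨z, k1, k2⟩ := ex a x y
      have k3 : S c z y := by
        rcases (Sa _ _).1 k2 with e | e
        · rw [e]; exact S_refl _ _
        · rw [e]; exact l2 _
      have k4 := Rn x z k1 (S_trans e (S_symm k3))
      have k5 := (Sa _ _).1 k2
      rcases k4 with rfl | rfl <;> rcases k5 with rfl | rfl <;> simp
    · rintro (rfl | rfl | rfl | rfl)
      · exact S_refl _ _
      · exact l2 _
      · exact n3 _
      · exact S_trans (n3 _) (l2 _)
  have mn : ∀ x, m (n x) = n (m x) := by
    intro x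
    rcases Rn (m x) (m (n x)) ((Rf _ _).2 (by rw [fm, fm, fn]))
      (S_trans (S_symm (l2 x)) (S_trans (n3 x) (l2 _))) with e | e
    · have := congrArg m e
      rw [mm, mm] at this
      exact absurd this (n1 x)
    · exact e
  have nRc : ∀ x, ¬ R c x (n x) := fun x e => n1 x (sep e (n3 x)).symm
  have nres : ∀ x z, R c x z → R c (n x) (n z) := by
    intro x z hxz
    obtain ⟨w, k1, k2⟩ := ex c (n x) z
    have fw := l1 _ _ k1
    have fz := l1 _ _ hxz
    rw [fn] at fw
    rcases (Sc _ _).1 (S_symm k2) with e | e | e | e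
    · rw [e] at k1
      exact absurd (R_symm (R_trans k1 (R_symm hxz))) (nRc x)
    · rw [e, fm, ← fz] at fw
      simp at fw
    · rw [e] at k1; exact k1
    · rw [e, fm, fn, ← fz] at fw
      simp at fw
  have four : ∀ x, R c x x0 ∨ R c x (m x0) ∨ R c x (n x0) ∨ R c x (m (n x0)) := by
    intro x
    obtain ⟨z, k1, k2⟩ := ex c x x0
    rcases (Sc _ _).1 (S_symm k2) with e | e | e | e <;> rw [e] at k1 <;> simp [k1]
  let g : X → Bool := fun x => decide (R c x x0 ∨ R c x (m x0))
  have gR : ∀ x y, R c x y → g x = g y := by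
    intro x y hxy
    simp only [g, decide_eq_decide]
    exact ⟨fun h => h.imp (R_trans (R_symm hxy)) (R_trans (R_symm hxy)),
      fun h => h.imp (R_trans hxy) (R_trans hxy)⟩
  have g0 : g x0 = true := by simp [g, R_refl]
  have g1 : g (m x0) = true := by simp [g, R_refl]
  have g2 : g (n x0) = false := by
    simp only [g, decide_eq_false_iff_not, not_or]
    refine ⟨fun e => nRc _ (R_symm e), fun e => ?_⟩
    have := l1 _ _ e
    rw [fn, fm] at this
    simp at this
  have g3 : g (m (n x0)) = false := by
    simp only [g, decide_eq_false_iff_not, not_or]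
    refine ⟨fun e => ?_, fun e => ?_⟩
    · have := l1 _ _ e
      rw [fm, fn] at this
      simp at this
    · rw [mn] at e
      exact nRc _ (R_symm e)
  have gm : ∀ x, g (m x) = g x := by
    intro x
    rcases four x with e | e | e | e
    · rw [gR _ _ e, gR _ _ (l3 _ _ e), g0, g1]
    · rw [gR _ _ e, gR _ _ (l3 _ _ e), mm, g0, g1]
    · rw [gR _ _ e, gR _ _ (l3 _ _ e), g2, g3]
    · rw [gR _ _ e, gR _ _ (l3 _ _ e), mm, g2, g3]
  have gn : ∀ x, g (n x) = !g x := by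
    intro x
    rcases four x with e | e | e | e
    · rw [gR _ _ e, gR _ _ (nres _ _ e), g0, g2]; rfl
    · rw [gR _ _ e, gR _ _ (nres _ _ e), ← mn, g1, g3]; rfl
    · rw [gR _ _ e, gR _ _ (nres _ _ e), nn, g0, g2]; rfl
    · rw [gR _ _ e, gR _ _ (nres _ _ e), ← mn, nn, g1, g3]; rfl
  have Rc : ∀ x y, R c x y ↔ f x = f y ∧ g x = g y := by
    intro x y
    refine ⟨fun h => ⟨l1 _ _ h, gR _ _ h⟩, fun h => ?_⟩
    rcases four x with e | e | e | e <;> rcases four y with e' | e' | e' | e' <;>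
      first
      | exact R_trans e (R_symm e')
      | (exfalso
         rw [l1 _ _ e, l1 _ _ e', gR _ _ e, gR _ _ e'] at h
         simp [g0, g1, g2, g3, fm, fn] at h)
  exact ⟨f, m, g, n, ha, ⟨⟨mm, fm⟩, ⟨nn, gn⟩, gm, fn, mn⟩, Rc, Sc⟩

end T1
end WF


namespace WF
universe u

/-- The eight codes. -/
def tab : Fin 8 → List Bool :=
  (![[true, true, true, true, true, true, false, false, false, false, false, false],
      [true, false, false, false, false, true, false, true, false, false, true, false],
      [true, false, false, false, false, true, false, false, true, true, false, false],
      [false, true, false, false, true, false, true, false, false, false, false, true],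
      [false, true, false, false, true, false, false, false, true, true, false, false],
      [false, false, true, true, false, false, true, false, false, false, false, true],
      [false, false, true, true, false, false, false, true, false, false, true, false],
      [false, false, false, false, false, false, true, true, true, true, true, true]]
       : Fin 8 → List Bool)

set_option synthInstance.maxHeartbeats 400000 in
set_option synthInstance.maxSize 2000 in
set_option maxRecDepth 10000 in
theorem enum4 : ∀ a1 a2 a3 a4 a5 a6 b1 b2 b3 b4 b5 b6 : Bool,
    -- transitivity
    ((a1 && a4) → a2) → ((a1 && a2) → a4) → ((a2 && a4) → a1) →
    ((a1 && a5) → a3) → ((a1 && a3) → a5) → ((a3 && a5) → a1) →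
    ((a2 && a6) → a3) → ((a2 && a3) → a6) → ((a3 && a6) → a2) →
    ((a4 && a6) → a5) → ((a4 && a5) → a6) → ((a5 && a6) → a4) →
    ((b1 && b4) → b2) → ((b1 && b2) → b4) → ((b2 && b4) → b1) →
    ((b1 && b5) → b3) → ((b1 && b3) → b5) → ((b3 && b5) → b1) →
    ((b2 && b6) → b3) → ((b2 && b3) → b6) → ((b3 && b6) → b2) →
    ((b4 && b6) → b5) → ((b4 && b5) → b6) → ((b5 && b6) → b4) →
    (!(a1 && b1)) → (!(a2 && b2)) → (!(a3 && b3)) → (!(a4 && b4)) → (!(a5 && b5)) →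
    (!(a6 && b6)) →
    (b1 || a1 || (a2 && b4) || (a3 && b5)) → (b2 || a2 || (a1 && b4) || (a3 && b6)) →
    (b3 || a3 || (a1 && b5) || (a2 && b6)) → (b4 || a4 || (a1 && b2) || (a5 && b6)) →
    (b5 || a5 || (a1 && b3) || (a4 && b6)) → (b6 || a6 || (a2 && b3) || (a4 && b5)) →
    (b1 || a1 || (a4 && b2) || (a5 && b3)) → (b2 || a2 || (a4 && b1) || (a6 && b3)) →
    (b3 || a3 || (a5 && b1) || (a6 && b2)) → (b4 || a4 || (a2 && b1) || (a6 && b5)) →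
    (b5 || a5 || (a3 && b1) || (a6 && b4)) → (b6 || a6 || (a3 && b2) || (a5 && b4)) →
    ∃ i : Fin 8, [a1, a2, a3, a4, a5, a6, b1, b2, b3, b4, b5, b6] = tab i := by
  decide +kernel

section T2
variable {X : Type u}

open Classical in
/-- Code of a factor pair on four points. -/
noncomputable def code (q : Fin 4 → X) (x : FactPair X) : List Bool :=
  [decide (R x (q 0) (q 1)), decide (R x (q 0) (q 2)), decide (R x (q 0) (q 3)),
   decide (R x (q 1) (q 2)), decide (R x (q 1) (q 3)), decide (R x (q 2) (q 3)),
   decide (S x (q 0) (q 1)), decide (S x (q 0) (q 2)), decide (S x (q 0) (q 3)),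
   decide (S x (q 1) (q 2)), decide (S x (q 1) (q 3)), decide (S x (q 2) (q 3))]

theorem code_R {q : Fin 4 → X} {x y : FactPair X} (h : code q x = code q y) (i j : Fin 4) :
    (R x (q i) (q j) ↔ R y (q i) (q j)) ∧ (S x (q i) (q j) ↔ S y (q i) (q j)) := by
  have sR : ∀ (c : FactPair X) u v, R c u v ↔ R c v u := fun c u v => ⟨R_symm, R_symm⟩
  have sS : ∀ (c : FactPair X) u v, S c u v ↔ S c v u := fun c u v => ⟨S_symm, S_symm⟩
  simp only [code, List.cons.injEq, decide_eq_decide, and_true] at h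
  obtain ⟨h1, h2, h3, h4, h5, h6, h7, h8, h9, h10, h11, h12⟩ := h
  fin_cases i <;> fin_cases j <;> first
    | exact ⟨⟨fun _ => R_refl _ _, fun _ => R_refl _ _⟩, ⟨fun _ => S_refl _ _, fun _ => S_refl _ _⟩⟩
    | exact ⟨by assumption, by assumption⟩
    | (rw [sR x, sR y, sS x, sS y]; exact ⟨by assumption, by assumption⟩)

theorem T2_det {c : FactPair X} {q : Fin 4 → X} (hq : ∀ i y, S c (q i) y → ∃ j, y = q j)
    (hqq : ∀ i j, S c (q i) (q j)) {x y : FactPair X} (hx : FactLE x c) (hy : FactLE y c) (h : code q x = code q y) : x = y := by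
  have hc := code_R h
  have near : ∀ u, ∃ i, R c u (q i) := by
    intro u
    obtain ⟨z, h1, h2⟩ := ex c u (q 0)
    obtain ⟨j, rfl⟩ := hq 0 z (S_symm h2)
    exact ⟨j, h1⟩
  have key : ∀ x, FactLE x c → (∀ u v i j, R c u (q i) → R c v (q j) →
      (R x u v ↔ R x (q i) (q j)) ∧ (S x u v ↔ S c u v ∧ S x (q i) (q j))) := by
    intro x hx u v i j hu hv
    rw [le_iff0] at hx
    obtain ⟨l1, l2, l3⟩ := hx
    refine ⟨⟨fun h => R_trans (R_symm (l1 _ _ hu)) (R_trans h (l1 _ _ hv)),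
      fun h => R_trans (l1 _ _ hu) (R_trans h (R_symm (l1 _ _ hv)))⟩, fun h => ⟨l2 _ _ h, ?_⟩, ?_⟩
    · obtain ⟨w, k1, k2⟩ := l3 _ _ _ h hu
      obtain ⟨j', rfl⟩ := hq i w (l2 _ _ k1)
      rw [← sep (R_trans (R_symm k2) hv) (S_trans (S_symm (l2 _ _ k1)) (hqq i j))]
      exact k1
    · rintro ⟨h1, h2⟩
      obtain ⟨w, k1, k2⟩ := l3 _ _ _ h2 (R_symm hu)
      have e := sep (R_trans hv k2) (S_trans (S_symm h1) (l2 _ _ k1))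
      rw [e]; exact k1
  apply ext' <;> intro u v <;> obtain ⟨i, hi⟩ := near u <;> obtain ⟨j, hj⟩ := near v
  · rw [(key x hx _ _ _ _ hi hj).1, (key y hy _ _ _ _ hi hj).1, (hc i j).1]
  · rw [(key x hx _ _ _ _ hi hj).2, (key y hy _ _ _ _ hi hj).2, (hc i j).2]

theorem T2_small {c : FactPair X} {q : Fin 4 → X} (hq : ∀ i y, S c (q i) y → ∃ j, y = q j)
    (hqq : ∀ i j, S c (q i) (q j)) (hinj : Function.Injective q) : Small c := by
  classical
  have H : ∀ x : FactPair X, FactLE x c → ∃ i : Fin 8, code q x = tab i := by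
    intro x hx
    rw [le_iff0] at hx
    have rt : ∀ i j k, R x (q i) (q j) → R x (q j) (q k) → R x (q i) (q k) :=
      fun i j k => R_trans
    have st : ∀ i j k, S x (q i) (q j) → S x (q j) (q k) → S x (q i) (q k) :=
      fun i j k => S_trans
    have rs : ∀ i j, R x (q i) (q j) → R x (q j) (q i) := fun i j => R_symm
    have ss : ∀ i j, S x (q i) (q j) → S x (q j) (q i) := fun i j => S_symm
    have sp : ∀ i j, i ≠ j → ¬ R x (q i) (q j) ∨ ¬ S x (q i) (q j) := by
      intro i j h
      by_contra hc
      push Not at hc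
      exact h (hinj (sep hc.1 hc.2))
    have exx : ∀ i j, (R x (q i) (q 0) ∧ S x (q 0) (q j)) ∨ (R x (q i) (q 1) ∧ S x (q 1) (q j)) ∨
        (R x (q i) (q 2) ∧ S x (q 2) (q j)) ∨ (R x (q i) (q 3) ∧ S x (q 3) (q j)) := by
      intro i j
      obtain ⟨z, h1, h2⟩ := ex x (q i) (q j)
      obtain ⟨k, rfl⟩ := hq j z (hx.2.1 _ _ (S_symm h2))
      fin_cases k <;> simp_all
    have e1 := exx 0 1
    have e2 := exx 0 2
    have e3 := exx 0 3
    have e4 := exx 1 2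
    have e5 := exx 1 3
    have e6 := exx 2 3
    have e7 := exx 1 0
    have e8 := exx 2 0
    have e9 := exx 3 0
    have e10 := exx 2 1
    have e11 := exx 3 1
    have e12 := exx 3 2
    clear exx
    have E : ∃ i : Fin 8, [_, _, _, _, _, _, _, _, _, _, _, _] = tab i :=
      enum4 (decide (R x (q 0) (q 1))) (decide (R x (q 0) (q 2))) (decide (R x (q 0) (q 3)))
      (decide (R x (q 1) (q 2))) (decide (R x (q 1) (q 3))) (decide (R x (q 2) (q 3)))
      (decide (S x (q 0) (q 1))) (decide (S x (q 0) (q 2))) (decide (S x (q 0) (q 3)))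
      (decide (S x (q 1) (q 2))) (decide (S x (q 1) (q 3))) (decide (S x (q 2) (q 3)))
      (by simpa using fun h1 h2 => rt 0 1 2 h1 h2)
      (by simpa using fun h1 h2 => rt 1 0 2 (rs 0 1 h1) h2)
      (by simpa using fun h1 h2 => rt 0 2 1 h1 (rs 1 2 h2))
      (by simpa using fun h1 h2 => rt 0 1 3 h1 h2)
      (by simpa using fun h1 h2 => rt 1 0 3 (rs 0 1 h1) h2)
      (by simpa using fun h1 h2 => rt 0 3 1 h1 (rs 1 3 h2))
      (by simpa using fun h1 h2 => rt 0 2 3 h1 h2)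
      (by simpa using fun h1 h2 => rt 2 0 3 (rs 0 2 h1) h2)
      (by simpa using fun h1 h2 => rt 0 3 2 h1 (rs 2 3 h2))
      (by simpa using fun h1 h2 => rt 1 2 3 h1 h2)
      (by simpa using fun h1 h2 => rt 2 1 3 (rs 1 2 h1) h2)
      (by simpa using fun h1 h2 => rt 1 3 2 h1 (rs 2 3 h2))
      (by simpa using fun h1 h2 => st 0 1 2 h1 h2)
      (by simpa using fun h1 h2 => st 1 0 2 (ss 0 1 h1) h2)
      (by simpa using fun h1 h2 => st 0 2 1 h1 (ss 1 2 h2))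
      (by simpa using fun h1 h2 => st 0 1 3 h1 h2)
      (by simpa using fun h1 h2 => st 1 0 3 (ss 0 1 h1) h2)
      (by simpa using fun h1 h2 => st 0 3 1 h1 (ss 1 3 h2))
      (by simpa using fun h1 h2 => st 0 2 3 h1 h2)
      (by simpa using fun h1 h2 => st 2 0 3 (ss 0 2 h1) h2)
      (by simpa using fun h1 h2 => st 0 3 2 h1 (ss 2 3 h2))
      (by simpa using fun h1 h2 => st 1 2 3 h1 h2)
      (by simpa using fun h1 h2 => st 2 1 3 (ss 1 2 h1) h2)
      (by simpa using fun h1 h2 => st 1 3 2 h1 (ss 2 3 h2))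
      (by simpa [imp_iff_not_or] using sp 0 1 (by decide))
      (by simpa [imp_iff_not_or] using sp 0 2 (by decide))
      (by simpa [imp_iff_not_or] using sp 0 3 (by decide))
      (by simpa [imp_iff_not_or] using sp 1 2 (by decide))
      (by simpa [imp_iff_not_or] using sp 1 3 (by decide))
      (by simpa [imp_iff_not_or] using sp 2 3 (by decide))
      (by simp only [Bool.or_eq_true, Bool.and_eq_true, decide_eq_true_eq]; clear rt st sp; grind)
      (by simp only [Bool.or_eq_true, Bool.and_eq_true, decide_eq_true_eq]; clear rt st sp; grind)
      (by simp only [Bool.or_eq_true, Bool.and_eq_true, decide_eq_true_eq]; clear rt st sp; grind)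
      (by simp only [Bool.or_eq_true, Bool.and_eq_true, decide_eq_true_eq]; clear rt st sp; grind)
      (by simp only [Bool.or_eq_true, Bool.and_eq_true, decide_eq_true_eq]; clear rt st sp; grind)
      (by simp only [Bool.or_eq_true, Bool.and_eq_true, decide_eq_true_eq]; clear rt st sp; grind)
      (by simp only [Bool.or_eq_true, Bool.and_eq_true, decide_eq_true_eq]; clear rt st sp; grind)
      (by simp only [Bool.or_eq_true, Bool.and_eq_true, decide_eq_true_eq]; clear rt st sp; grind)
      (by simp only [Bool.or_eq_true, Bool.and_eq_true, decide_eq_true_eq]; clear rt st sp; grind)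
      (by simp only [Bool.or_eq_true, Bool.and_eq_true, decide_eq_true_eq]; clear rt st sp; grind)
      (by simp only [Bool.or_eq_true, Bool.and_eq_true, decide_eq_true_eq]; clear rt st sp; grind)
      (by simp only [Bool.or_eq_true, Bool.and_eq_true, decide_eq_true_eq]; clear rt st sp; grind)
    exact E
  choose d hd using H
  have hd' : ∀ i : Fin 8, ∃ y : FactPair X, ∀ x, FactLE x c → code q x = tab i → y = x := by
    intro i
    by_cases hi : ∃ x, FactLE x c ∧ code q x = tab i
    · obtain ⟨y, h1, h2⟩ := hi
      exact ⟨y, fun x h3 h4 => T2_det hq hqq h1 h3 (h2.trans h4.symm)⟩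
    · exact ⟨FactZero X, fun x h3 h4 => (hi ⟨x, h3, h4⟩).elim⟩
  choose s hs using hd'
  exact ⟨s, fun x hx => ⟨d x hx, hs _ _ hx (hd x hx)⟩⟩

theorem T2 [Nonempty X] {a c : FactPair X} {f g m n} (ha : IsAt a f m) (hc : IsQ c f g m n) :
    Tq a c := by
  have hle := Q_at_le hc ha
  obtain ⟨⟨⟨h1, h2⟩, ⟨h3, h4⟩, h5, h6, h7⟩, h8, h9⟩ := hc
  obtain ⟨x0⟩ := ‹Nonempty X›
  refine ⟨(haveI : Nonempty X := ⟨x0⟩; ha.ne_zero), ?_, hle, ?_⟩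
  · rintro rfl
    have k1 := (h9 x0 (n x0)).2 (by simp)
    rw [ha.2.2] at k1
    rcases k1 with k1 | k1
    · have := h4 x0; rw [k1] at this; simp at this
    · have := h4 x0; rw [k1, h5] at this; simp at this
  · refine T2_small (q := ![x0, m x0, n x0, m (n x0)]) ?_ ?_ ?_
    · intro i y hy
      rw [h9] at hy
      have : y = x0 ∨ y = m x0 ∨ y = n x0 ∨ y = m (n x0) := by
        fin_cases i <;> simp at hy <;> grind
      rcases this with e | e | e | e
      · exact ⟨0, e⟩
      · exact ⟨1, e⟩
      · exact ⟨2, e⟩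
      · exact ⟨3, e⟩
    · have : ∀ i : Fin 4, S c x0 (![x0, m x0, n x0, m (n x0)] i) := by
        intro i
        rw [h9]
        fin_cases i <;> simp
      intro i j
      exact S_trans (S_symm (this i)) (this j)
    · have n1 : ∀ x, m x ≠ x := fun x e => by have := h2 x; rw [e] at this; simp at this
      have n2 : ∀ x, n x ≠ x := fun x e => by have := h4 x; rw [e] at this; simp at this
      have n3 : ∀ x, m x ≠ n x := fun x e => by
        have := h4 x; rw [← e, h5] at this; simp at this
      have n4 : ∀ x, m (n x) ≠ x := fun x e => n3 x (by rw [← h1 (n x), e])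
      have n5 : ∀ x, m (n x) ≠ m x := fun x e => n2 x (by rw [← h1 (n x), e, h1])
      intro i j h
      have a1 := n1 x0; have a2 := n2 x0; have a3 := n3 x0; have a4 := n4 x0; have a5 := n5 x0
      have a6 := n1 (n x0)
      fin_cases i <;> fin_cases j <;> simp at h ⊢ <;> first
        | exact absurd h (by assumption)
        | exact absurd h.symm (by assumption)

theorem equiv_prod_bool (U : Type u) [Infinite U] : Nonempty (U ≃ U × Bool) := by
  apply Cardinal.eq.1
  rw [Cardinal.mk_prod]
  simp only [Cardinal.lift_id', Cardinal.mk_bool, Cardinal.lift_ofNat]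
  symm
  have h1 := Cardinal.aleph0_le_mk U
  have h2 : (2 : Cardinal.{u}) ≤ Cardinal.mk U := (Cardinal.nat_lt_aleph0 2).le.trans h1
  have := Cardinal.mul_eq_left h1 h2 (by norm_num)
  simpa using this

/-- Coordinates of an atom. -/
theorem Ok.coords {f : X → Bool} {m : X → X} (h : Ok f m) :
    ∃ φ : X ≃ {x // f x = true} × Bool, (∀ x, (φ x).2 = f x) ∧
      (∀ x, φ (m x) = ((φ x).1, !(φ x).2)) ∧ ∀ u, φ u.1 = (u, true) := by
  let F : X → {x // f x = true} × Bool := fun x =>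
    if hx : f x = true then (⟨x, hx⟩, true) else (⟨m x, by rw [h.2]; simpa using hx⟩, false)
  have e1 : ∀ x (hx : f x = true), F x = (⟨x, hx⟩, true) := fun x hx => by simp [F, hx]
  have e2 : ∀ x (hx : f x = false), F x = (⟨m x, by rw [h.2, hx]; rfl⟩, false) :=
    fun x hx => by simp [F, hx]
  have hb : Function.Bijective F := by
    constructor
    · intro x y hxy
      cases hx : f x <;> cases hy : f y
      · rw [e2 x hx, e2 y hy] at hxy
        simp only [Prod.mk.injEq, Subtype.mk.injEq, and_true] at hxy
        rw [← h.1 x, hxy, h.1]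
      · rw [e2 x hx, e1 y hy] at hxy
        simp at hxy
      · rw [e1 x hx, e2 y hy] at hxy
        simp at hxy
      · rw [e1 x hx, e1 y hy] at hxy
        simpa using hxy
    · rintro ⟨⟨x, hx⟩, b⟩
      cases b
      · refine ⟨m x, ?_⟩
        rw [e2 (m x) (by rw [h.2, hx]; rfl)]
        simp [h.1]
      · exact ⟨x, e1 x hx⟩
  refine ⟨Equiv.ofBijective F hb, fun x => ?_, fun x => ?_, fun x => e1 x.1 x.2⟩
  · show (F x).2 = f x
    cases hx : f x
    · rw [e2 x hx]
    · rw [e1 x hx]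
  · show F (m x) = ((F x).1, !(F x).2)
    cases hx : f x
    · rw [e2 x hx, e1 (m x) (by rw [h.2, hx]; rfl)]; simp
    · rw [e1 x hx, e2 (m x) (by rw [h.2, hx]; rfl)]; simp [h.1]

theorem Ok.infinite [Infinite X] {f : X → Bool} {m : X → X} (h : Ok f m) :
    Infinite {x // f x = true} := by
  obtain ⟨φ, -⟩ := h.coords
  by_contra hc
  rw [not_infinite_iff_finite] at hc
  have : Finite X := Finite.of_equiv _ φ.symm
  exact not_finite X

theorem T3 [Infinite X] {f : X → Bool} {m : X → X} (h : Ok f m) : ∃ g n, QD f g m n := by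
  obtain ⟨φ, p1, p2, -⟩ := h.coords
  haveI := h.infinite
  obtain ⟨ψ⟩ := equiv_prod_bool {x // f x = true}
  refine ⟨fun x => (ψ (φ x).1).2,
    fun x => φ.symm (ψ.symm ((ψ (φ x).1).1, !(ψ (φ x).1).2), (φ x).2), h, ⟨?_, ?_⟩, ?_, ?_, ?_⟩
  · intro x; simp
  · intro x; simp
  · intro x; simp [p2]
  · intro x; rw [← p1, ← p1]; simp
  · intro x
    apply φ.injective
    rw [p2]
    simp [p2]

end T2
end WF


namespace WF
universe u
section P3a
variable {X : Type u}

/-- Definable version of being a two-atom. -/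
def P (a : FactPair X) : Prop := ∃ c, Tq a c
/-- Definable version of having size four. -/
def T (c : FactPair X) : Prop := ∃ a, Tq a c

theorem P_iff [Infinite X] (a : FactPair X) : P a ↔ ∃ f m, IsAt a f m := by
  constructor
  · rintro ⟨c, h⟩
    obtain ⟨f, m, g, n, h1, h2⟩ := T1 h
    exact ⟨f, m, h1⟩
  · rintro ⟨f, m, h⟩
    obtain ⟨g, n, h1⟩ := T3 h.1
    obtain ⟨c, h2⟩ := exists_Q h1
    exact ⟨c, T2 h h2⟩

theorem T_imp [Nonempty X] {c : FactPair X} (h : T c) : ∃ f g m n, IsQ c f g m n := by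
  obtain ⟨a, h⟩ := h
  obtain ⟨f, m, g, n, h1, h2⟩ := T1 h
  exact ⟨f, g, m, n, h2⟩

theorem T_of [Nonempty X] {c : FactPair X} {f g m n} (h : IsQ c f g m n) : T c := by
  obtain ⟨a, ha⟩ := exists_at h.1.1
  exact ⟨a, T2 ha h⟩

/-- Two distinct two-atoms with several common upper bounds of size four. -/
def L (a b : FactPair X) : Prop := P a ∧ P b ∧ a ≠ b ∧ ∃ c c', c ≠ c' ∧ T c ∧ T c' ∧
  FactLE a c ∧ FactLE b c ∧ FactLE a c' ∧ FactLE b c'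

theorem bool_ker {p q r s : Bool} : (p = q ∧ (p ^^ r) = (q ^^ s)) ↔ (p = q ∧ r = s) := by
  revert p q r s; decide
theorem bool_ker2 {p q r s : Bool} : (r = s ∧ (p ^^ r) = (q ^^ s)) ↔ (p = q ∧ r = s) := by
  revert p q r s; decide

theorem Qdet_R {a b c : FactPair X} {F G M N f m g n} (hc : IsQ c F G M N) (ha : IsAt a f m)
    (hb : IsAt b g n) (hac : FactLE a c) (hbc : FactLE b c)
    (hne : ¬ ∀ x y, f x = f y ↔ g x = g y) (x y : X) : R c x y ↔ f x = f y ∧ g x = g y := by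
  rw [hc.2.1]
  rcases (keyK hc ha hac).2 with h1 | h1 | h1 <;> rcases (keyK hc hb hbc).2 with h2 | h2 | h2
  · exact (hne fun x y => by rw [h1, h2]).elim
  · rw [h1, h2]
  · rw [h1, h2, bool_ker]
  · rw [h1, h2, and_comm]
  · exact (hne fun x y => by rw [h1, h2]).elim
  · rw [h1, h2, bool_ker2]
  · rw [h1, h2, ← bool_ker, and_comm]
  · rw [h1, h2, ← bool_ker2, and_comm]
  · exact (hne fun x y => by rw [h1, h2]).elim

theorem Qdet_S {a b c : FactPair X} {F G M N f m g n} (hc : IsQ c F G M N) (ha : IsAt a f m)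
    (hb : IsAt b g n) (hac : FactLE a c) (hbc : FactLE b c)
    (hne : m ≠ n) : (∀ x y : X, S c x y ↔ y = x ∨ y = m x ∨ y = n x ∨ y = m (n x)) ∧
    (∀ x, m (n x) = n (m x)) ∧ ∀ x, m x ≠ n x := by
  have K1 := (keyK hc ha hac).1
  have K2 := (keyK hc hb hbc).1
  obtain ⟨⟨⟨h1, h2⟩, ⟨h3, h4⟩, h5, h6, h7⟩, -, h9⟩ := hc
  have n1 : ∀ x, M x ≠ x := fun x e => by have := h2 x; rw [e] at this; simp at this
  have n2 : ∀ x, N x ≠ x := fun x e => by have := h4 x; rw [e] at this; simp at this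
  have n3 : ∀ x, M x ≠ N x := fun x e => by
    have := h4 x; rw [← e, h5] at this; simp at this
  have hne' : ¬ ∀ x, m x = n x := fun h => hne (funext h)
  simp only [h9]
  rcases K1 with k1 | k1 | k1 <;> rcases K2 with k2 | k2 | k2 <;> simp only [k1, k2] at hne' ⊢
  · exact (hne' fun _ => trivial).elim
  · grind
  · grind
  · grind
  · exact (hne' fun _ => trivial).elim
  · grind
  · grind
  · grind
  · exact (hne' fun _ => trivial).elim

theorem L_A1 [Infinite X] {a b : FactPair X} {f m g n} (h : L a b) (ha : IsAt a f m)
    (hb : IsAt b g n) : (∀ x y, f x = f y ↔ g x = g y) ∨ m = n := by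
  by_contra hc
  push Not at hc
  obtain ⟨hk, hmn⟩ := hc
  have hk : ¬ ∀ x y, f x = f y ↔ g x = g y := by
    intro h
    obtain ⟨x, y, h'⟩ := hk
    have := h x y
    tauto
  obtain ⟨-, -, -, c, c', hne, t, t', l1, l2, l3, l4⟩ := h
  obtain ⟨F, G, M, N, hQ⟩ := T_imp t
  obtain ⟨F', G', M', N', hQ'⟩ := T_imp t'
  apply hne
  apply ext'
  · intro x y
    rw [Qdet_R hQ ha hb l1 l2 hk, Qdet_R hQ' ha hb l3 l4 hk]
  · intro x y
    rw [(Qdet_S hQ ha hb l1 l2 hmn).1, (Qdet_S hQ' ha hb l3 l4 hmn).1]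

theorem L_comm [Infinite X] {a b : FactPair X} {f m g n} (h : L a b) (ha : IsAt a f m)
    (hb : IsAt b g n) (hmn : m ≠ n) : (∀ x, m (n x) = n (m x)) ∧ ∀ x, m x ≠ n x := by
  obtain ⟨-, -, -, c, c', hne, t, t', l1, l2, l3, l4⟩ := h
  obtain ⟨F, G, M, N, hQ⟩ := T_imp t
  exact (Qdet_S hQ ha hb l1 l2 hmn).2

/-- Changing the colouring to one with the same kernel. -/
theorem IsAt.change {a : FactPair X} {f g m} (ha : IsAt a f m)
    (h : ∀ x y, f x = f y ↔ g x = g y) : IsAt a g m := by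
  refine ⟨⟨ha.1.1, fun x => bne fun e => ?_⟩, fun x y => by rw [ha.2.1, h], ha.2.2⟩
  rw [← h, ha.1.2] at e
  simp at e

theorem flip_lemma (O : Setoid X) (k : X → X) (kk : ∀ x, k (k x) = x)
    (hk : ∀ x y, O x y → O (k x) (k y)) (hn : ∀ x, ¬ O x (k x)) :
    ∃ e : X → Bool, (∀ x, e (k x) = !e x) ∧ ∀ x y, O x y → e x = e y := by
  classical
  let O2 : Setoid X := ⟨fun x y => O x y ∨ O x (k y), by
    refine ⟨fun x => Or.inl (O.refl' x), ?_, ?_⟩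
    · rintro x y (h | h)
      · exact Or.inl (O.symm' h)
      · right
        have := hk _ _ h
        rw [kk] at this
        exact O.symm' this
    · rintro x y z (h | h) (h' | h')
      · exact Or.inl (O.trans' h h')
      · exact Or.inr (O.trans' h h')
      · exact Or.inr (O.trans' h (hk _ _ h'))
      · have := hk _ _ h'
        rw [kk] at this
        exact Or.inl (O.trans' h this)⟩
  let r : X → X := fun x => (Quotient.mk O2 x).out
  have hr : ∀ x, O x (r x) ∨ O x (k (r x)) := by
    intro x
    have : O2 (r x) x := Quotient.exact (Quotient.out_eq (Quotient.mk O2 x))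
    exact O2.symm' this
  have re : ∀ x y, (O x y ∨ O x (k y)) → r x = r y := by
    intro x y h
    have : Quotient.mk O2 x = Quotient.mk O2 y := Quotient.sound h
    simp only [r, this]
  refine ⟨fun x => decide (O x (r x)), fun x => ?_, fun x y h => ?_⟩
  · have e1 : r (k x) = r x := re _ _ (Or.inr (O.refl' _))
    show decide (O (k x) (r (k x))) = !decide (O x (r x))
    rw [e1, ← decide_not, decide_eq_decide]
    rcases hr x with h | h
    · refine ⟨fun h' => ?_, fun h' => (h' h).elim⟩
      exact (hn x (O.trans' h (O.symm' h'))).elim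
    · have h2 := hk _ _ h
      rw [kk] at h2
      exact ⟨fun _ h' => hn x (O.trans' h' (O.symm' h2)), fun _ => h2⟩
  · show decide (O x (r x)) = decide (O y (r y))
    rw [re x y (Or.inl h), decide_eq_decide]
    exact ⟨fun h' => O.trans' (O.symm' h) h', fun h' => O.trans' h h'⟩

def pw (m : X → X) (b : Bool) (x : X) : X := if b then m x else x

theorem pw_pw {m : X → X} (h : ∀ x, m (m x) = x) (b : Bool) (x : X) : pw m b (pw m b x) = x := by
  cases b <;> simp [pw, h]
theorem pw_not {m : X → X} (h : ∀ x, m (m x) = x) (b : Bool) (x : X) :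
    pw m (!b) (m x) = pw m b x := by
  cases b <;> simp [pw, h]
theorem pw_comm {m n : X → X} (h : ∀ x, m (n x) = n (m x)) (b : Bool) (x : X) :
    pw m b (n x) = n (pw m b x) := by
  cases b <;> simp [pw, h]
theorem pw_inv {m : X → X} {f : X → Bool} (h : ∀ x, f (m x) = f x) (b : Bool) (x : X) :
    f (pw m b x) = f x := by
  cases b <;> simp [pw, h]
theorem pw_flip {m : X → X} {f : X → Bool} (h : ∀ x, f (m x) = !f x) (b : Bool) (x : X) :
    f (pw m b x) = (f x ^^ b) := by
  cases b <;> simp [pw, h]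

theorem oct {f e d : X → Bool} {m n k : X → X} (hm : Ok f m) (hn : Ok e n) (hk : Ok d k)
    (mn : ∀ x, m (n x) = n (m x)) (mk : ∀ x, m (k x) = k (m x)) (nk : ∀ x, n (k x) = k (n x))
    (fn : ∀ x, f (n x) = f x) (fk : ∀ x, f (k x) = f x)
    (em : ∀ x, e (m x) = e x) (ek : ∀ x, e (k x) = e x)
    (dm : ∀ x, d (m x) = d x) (dn : ∀ x, d (n x) = d x) :
    ∃ c : FactPair X, (∀ x y, R c x y ↔ f x = f y ∧ e x = e y ∧ d x = d y) ∧
      (∀ x, S c x (m x)) ∧ (∀ x, S c x (n x)) ∧ (∀ x, S c x (k x)) := by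
  let γ : X → X := fun x => pw m (f x) (pw n (e x) (pw k (d x) x))
  have km : ∀ x, k (m x) = m (k x) := fun x => (mk x).symm
  have nm : ∀ x, n (m x) = m (n x) := fun x => (mn x).symm
  have kn : ∀ x, k (n x) = n (k x) := fun x => (nk x).symm
  have γm : ∀ x, γ (m x) = γ x := by
    intro x
    simp only [γ]
    rw [hm.2, em, dm, pw_comm km, pw_comm nm, pw_not hm.1]
  have γn : ∀ x, γ (n x) = γ x := by
    intro x
    simp only [γ]
    rw [hn.2, fn, dn, pw_comm kn, pw_not hn.1]
  have γk : ∀ x, γ (k x) = γ x := by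
    intro x
    simp only [γ]
    rw [hk.2, fk, ek, pw_not hk.1]
  have γp : ∀ (q : X → X), (∀ x, γ (q x) = γ x) → ∀ b x, γ (pw q b x) = γ x := by
    intro q hq b x
    cases b <;> simp [pw, hq]
  obtain ⟨c, h1, h2⟩ := mkFun (fun x => (f x, e x, d x)) γ
    (by
      intro x y h h'
      simp only [Prod.mk.injEq] at h
      simp only [γ, h.1, h.2.1, h.2.2] at h'
      have h' := congrArg (pw m (f y)) h'
      rw [pw_pw hm.1, pw_pw hm.1] at h'
      have h' := congrArg (pw n (e y)) h'
      rw [pw_pw hn.1, pw_pw hn.1] at h'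
      have h' := congrArg (pw k (d y)) h'
      rwa [pw_pw hk.1, pw_pw hk.1] at h')
    (by
      intro x y
      refine ⟨pw m (f x ^^ f y) (pw n (e x ^^ e y) (pw k (d x ^^ d y) y)), ?_, ?_⟩
      · simp only [pw_flip hm.2, pw_inv em, pw_inv dm, pw_flip hn.2, pw_inv fn, pw_inv dn,
          pw_flip hk.2, pw_inv fk, pw_inv ek]
        have hb : ∀ p q : Bool, (p ^^ (q ^^ p)) = q := by decide
        simp only [hb]
      · rw [γp _ γm, γp _ γn, γp _ γk])
  refine ⟨c, fun x y => ?_, fun x => ?_, fun x => ?_, fun x => ?_⟩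
  · rw [h1]; simp
  · rw [h2, γm]
  · rw [h2, γn]
  · rw [h2, γk]

/-- Definable relation implying equal matchings. -/
def SM (a b : FactPair X) : Prop := L a b ∧ ∃ d, L a d ∧ L b d ∧
  ∀ c, FactLE a c → FactLE b c → FactLE d c → c = FactOne X

theorem orb4 {f : X → Bool} {m n : X → X} (hm : Ok f m) (hn : Ok f n)
    (mn : ∀ x, m (n x) = n (m x)) : ∃ O : Setoid X, ∀ x y, O x y ↔
    y = x ∨ y = m x ∨ y = n x ∨ y = m (n x) := by
  obtain ⟨h1, h2⟩ := hm
  obtain ⟨h3, h4⟩ := hn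
  exact ⟨⟨fun x y => y = x ∨ y = m x ∨ y = n x ∨ y = m (n x),
    ⟨fun _ => Or.inl rfl, by grind, by grind⟩⟩, fun _ _ => Iff.rfl⟩

theorem flip3 {f : X → Bool} {m n k : X → X} (hm : Ok f m) (hn : Ok f n) (hk : Ok f k)
    (mn : ∀ x, m (n x) = n (m x)) (mk : ∀ x, m (k x) = k (m x)) (nk : ∀ x, n (k x) = k (n x))
    (h1 : ∀ x, m x ≠ k x) (h2 : ∀ x, n x ≠ k x) : ∃ e : X → Bool,
    (∀ x, e (k x) = !e x) ∧ (∀ x, e (m x) = e x) ∧ (∀ x, e (n x) = e x) := by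
  obtain ⟨O, hO⟩ := orb4 hm hn mn
  obtain ⟨e, e1, e2⟩ := flip_lemma O k hk.1
    (by
      intro x y h
      rw [hO] at h ⊢
      rcases h with rfl | rfl | rfl | rfl
      · simp
      · simp [← mk]
      · simp [← nk]
      · simp [← nk, ← mk])
    (by
      intro x h
      rw [hO] at h
      rcases h with h | h | h | h
      · exact hk.ne x h
      · exact h1 x h.symm
      · exact h2 x h.symm
      · have := hk.2 x
        rw [h, hm.2, hn.2] at this
        simp at this)
  exact ⟨e, e1, fun x => (e2 _ _ ((hO _ _).2 (by simp))).symm,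
    fun x => (e2 _ _ ((hO _ _).2 (by simp))).symm⟩

theorem SM_S [Infinite X] {a b : FactPair X} {f m g n} (h : SM a b) (ha : IsAt a f m)
    (hb : IsAt b g n) : m = n := by
  by_contra hmn
  obtain ⟨hab, d, had, hbd, hub⟩ := h
  obtain ⟨h0, k, hd⟩ := (P_iff d).1 had.2.1
  have r1 := (L_A1 hab ha hb).resolve_right hmn
  have hb := hb.change (g := f) fun x y => (r1 x y).symm
  have r2 : ∀ x y, f x = f y ↔ h0 x = h0 y := by
    rcases L_A1 had ha hd with h | h
    · exact h
    · rcases L_A1 hbd hb hd with h' | h'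
      · exact h'
      · exact (hmn (h.trans h'.symm)).elim
  have hd := hd.change (g := f) fun x y => (r2 x y).symm
  have hmk : m ≠ k := by
    rintro rfl
    exact had.2.2.1 (ha.uniq hd)
  have hnk : n ≠ k := by
    rintro rfl
    exact hbd.2.2.1 (hb.uniq hd)
  obtain ⟨c1, c1'⟩ := L_comm hab ha hb hmn
  obtain ⟨c2, c2'⟩ := L_comm had ha hd hmk
  obtain ⟨c3, c3'⟩ := L_comm hbd hb hd hnk
  have om := ha.1
  have on := hb.1
  have ok := hd.1
  obtain ⟨e3, p1, p2, p3⟩ := flip3 om on ok c1 c2 c3 c2' c3'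
  obtain ⟨e2, q1, q2, q3⟩ := flip3 om ok on c2 c1 (fun x => (c3 x).symm) c1' (fun x => (c3' x).symm)
  obtain ⟨c, r, s1, s2, s3⟩ := oct (f := f) (e := e2) (d := e3) (m := m) (n := fun x => m (n x))
    (k := fun x => m (k x)) om
    ⟨fun x => by show m (n (m (n x))) = x; rw [← c1, om.1, on.1], fun x => by rw [q2, q1]⟩
    ⟨fun x => by show m (k (m (k x))) = x; rw [← c2, om.1, ok.1], fun x => by rw [p2, p1]⟩
    (fun x => by rw [← c1]) (fun x => by rw [← c2])
    (fun x => by rw [← c1, om.1, ← c2, om.1, c3])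
    (fun x => by rw [om.2, on.2]; simp) (fun x => by rw [om.2, ok.2]; simp)
    q2 (fun x => by rw [q2, q3]) p2 (fun x => by rw [p2, p3])
  have sn : ∀ x, S c x (n x) := fun x => by
    have := S_trans (s2 x) (s1 _)
    rwa [om.1] at this
  have sk : ∀ x, S c x (k x) := fun x => by
    have := S_trans (s3 x) (s1 _)
    rwa [om.1] at this
  have hc : c = FactOne X := by
    apply hub
    · rw [ha.le_iff]
      refine ⟨fun x y h => ((r _ _).1 h).1, s1, fun x y h => ?_⟩
      rw [r] at h ⊢
      simp [om.2, q2, p2, h]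
    · rw [hb.le_iff]
      refine ⟨fun x y h => ((r _ _).1 h).1, sn, fun x y h => ?_⟩
      rw [r] at h ⊢
      simp [on.2, q1, p3, h]
    · rw [hd.le_iff]
      refine ⟨fun x y h => ((r _ _).1 h).1, sk, fun x y h => ?_⟩
      rw [r] at h ⊢
      simp [ok.2, q3, p1, h]
  obtain ⟨x, y, hxy, he⟩ := Finite.exists_ne_map_eq_of_infinite (fun x => (f x, e2 x, e3 x))
  have : R c x y := by rw [r]; simpa using he
  rw [hc, R_one] at this
  exact hxy this

end P3a
end WF


namespace WF
universe u
section Bal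
variable {U : Type u}

/-- Both fibres are as large as `U`. -/
def Bal (h : U → Bool) : Prop := ∀ b, ∃ j : U → U, Function.Injective j ∧ ∀ u, h (j u) = b

theorem Bal.equiv {h : U → Bool} (hb : Bal h) : ∃ e : U ≃ U × Bool, ∀ u, (e u).2 = h u := by
  have : ∀ b, Nonempty ({u // h u = b} ≃ U) := by
    intro b
    obtain ⟨j, hj, hj'⟩ := hb b
    obtain ⟨e⟩ := Function.Embedding.antisymm (⟨Subtype.val, Subtype.val_injective⟩ : {u // h u = b} ↪ U)
      ⟨fun u => ⟨j u, hj' u⟩, fun u v huv => hj (Subtype.mk.inj huv)⟩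
    exact ⟨e⟩
  have e : ∀ b, {u // h u = b} ≃ U := fun b => (this b).some
  refine ⟨(Equiv.sigmaFiberEquiv h).symm.trans ((Equiv.sigmaCongrRight e).trans
    ((Equiv.sigmaEquivProd Bool U).trans (Equiv.prodComm _ _))), fun u => rfl⟩

theorem exists_bal [Infinite U] : ∃ h : U → Bool, Bal h := by
  obtain ⟨ψ⟩ := equiv_prod_bool U
  exact ⟨fun u => (ψ u).2, fun b => ⟨fun u => ψ.symm (u, b), fun u v h => by simpa using h,
    fun u => by simp⟩⟩

theorem equiv_prod_self (U : Type u) [Infinite U] : Nonempty (U ≃ U × U) := by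
  apply Cardinal.eq.1
  simp [Cardinal.mul_eq_self (Cardinal.aleph0_le_mk U)]

theorem pig [Infinite U] (h : U → Bool) : ∃ b, ∃ j : U → U, Function.Injective j ∧ ∀ u, h (j u) = b := by
  obtain ⟨ψ⟩ := equiv_prod_self U
  by_cases hr : ∃ u, ∀ v, h (ψ.symm (u, v)) = false
  · obtain ⟨u, hu⟩ := hr
    exact ⟨false, fun v => ψ.symm (u, v), fun v w e => by simpa using e, hu⟩
  · push Not at hr
    choose r hr using hr
    exact ⟨true, fun u => ψ.symm (u, r u), fun v w e => by
      have := ψ.symm.injective e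
      exact (Prod.mk.inj this).1, fun u => by simpa using hr u⟩

theorem bal3 [Infinite U] (g : U → Bool) : ∃ d : U → Bool, Bal d ∧ Bal fun u => d u ^^ g u := by
  obtain ⟨b, j, hj, hj'⟩ := pig g
  obtain ⟨β, hβ⟩ := exists_bal (U := U)
  let d : U → Bool := fun u => Function.extend j β (fun _ => false) u
  have hd : ∀ u, d (j u) = β u := fun u => hj.extend_apply _ _ _
  refine ⟨d, fun c => ?_, fun c => ?_⟩
  · obtain ⟨i, hi, hi'⟩ := hβ c
    exact ⟨j ∘ i, hj.comp hi, fun u => by simp [hd, hi']⟩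
  · obtain ⟨i, hi, hi'⟩ := hβ (c ^^ b)
    exact ⟨j ∘ i, hj.comp hi, fun u => by simp [hd, hi', hj']⟩

theorem Bal.invol [Infinite U] {h : U → Bool} (hb : Bal h) : ∃ ν ν' : U → U,
    Ok h ν ∧ Ok h ν' ∧ ∃ u, ν u ≠ ν' u := by
  classical
  obtain ⟨e, he⟩ := hb.equiv
  obtain ⟨v0, v1, hne⟩ := exists_pair_ne U
  refine ⟨fun u => e.symm ((e u).1, !(e u).2),
    fun u => e.symm (Equiv.swap v0 v1 (e u).1, !(e u).2), ⟨?_, ?_⟩, ⟨?_, ?_⟩, e.symm (v0, true), ?_⟩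
  · intro u; simp
  · intro u; rw [← he, ← he]; simp
  · intro u; simp
  · intro u; rw [← he, ← he]; simp
  · simp [hne]

end Bal

section Crd
variable {X : Type u} {U : Type u}

/-- `π` and `f` are coordinates for the atom `(f, m)`. -/
def Crd (π : X → U) (f : X → Bool) (m : X → X) : Prop :=
  Ok f m ∧ (∀ x, π (m x) = π x) ∧ (∀ x y, π x = π y → f x = f y → x = y) ∧
  ∀ u b, ∃ x, π x = u ∧ f x = b

theorem Ok.crd [Infinite X] {f : X → Bool} {m : X → X} (h : Ok f m) :
    ∃ (U : Type u) (_ : Infinite U) (π : X → U), Crd π f m := by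
  obtain ⟨φ, h1, h2, -⟩ := h.coords
  refine ⟨_, h.infinite, fun x => (φ x).1, h, fun x => by simp [h2], fun x y e1 e2 => ?_, fun u b => ?_⟩
  · apply φ.injective
    apply Prod.ext e1
    rw [h1, h1, e2]
  · refine ⟨φ.symm (u, b), by simp, ?_⟩
    rw [← h1]; simp

theorem Crd.shift {π : X → U} {f : X → Bool} {m : X → X} (h : Crd π f m) (g : U → Bool) :
    Crd π (fun x => f x ^^ g (π x)) m := by
  obtain ⟨⟨h1, h2⟩, h3, h4, h5⟩ := h
  refine ⟨⟨h1, fun x => by simp [h2, h3]⟩, h3, fun x y e1 e2 => ?_, fun u b => ?_⟩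
  · apply h4 x y e1
    simp only [e1] at e2
    simpa using e2
  · obtain ⟨x, e1, e2⟩ := h5 u (b ^^ g u)
    exact ⟨x, e1, by simp [e1, e2]⟩

theorem Crd.QD {π : X → U} {f : X → Bool} {m : X → X} (h : Crd π f m) {k : U → Bool} {ν : U → U}
    (hν : Ok k ν) : ∃ n : X → X, QD f (fun x => k (π x)) m n ∧ ∀ x, π (n x) = ν (π x) := by
  obtain ⟨hok, h3, h4, h5⟩ := h
  choose i i1 i2 using h5
  refine ⟨fun x => i (ν (π x)) (f x), ⟨hok, ⟨fun x => ?_, fun x => ?_⟩, fun x => ?_, fun x => ?_,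
    fun x => ?_⟩, fun x => ?_⟩
  · apply h4
    · rw [i1, i1, hν.1]
    · rw [i2, i2]
  · simp [i1, hν.2]
  · simp [h3]
  · simp [i2]
  · apply h4
    · simp [i1, h3]
    · simp [i2, hok.2]
  · simp [i1]

theorem Q_at_le2 {b c : FactPair X} {f g m n} (hc : IsQ c f g m n)
    (hb : IsAt b (fun x => f x ^^ g x) m) : FactLE b c := by
  rw [hb.le_iff]
  obtain ⟨⟨⟨h1, h2⟩, ⟨h3, h4⟩, h5, h6, h7⟩, h8, h9⟩ := hc
  simp only [h8, h9]
  refine ⟨?_, ?_, ?_⟩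
  · rintro x y ⟨e1, e2⟩; rw [e1, e2]
  · intro x; simp
  · rintro x y ⟨e1, e2⟩; simp [h2, h5, e1, e2]

theorem Crd.L [Infinite X] [Infinite U] {π : X → U} {f : X → Bool} {m : X → X} (h : Crd π f m)
    {k : U → Bool} (hk : Bal k) {a b : FactPair X} (ha : IsAt a f m)
    (hb : IsAt b (fun x => f x ^^ k (π x)) m) : L a b := by
  obtain ⟨ν, ν', o, o', u0, hu0⟩ := hk.invol
  obtain ⟨n, q, hn⟩ := h.QD o
  obtain ⟨n', q', hn'⟩ := h.QD o'
  obtain ⟨c, hc⟩ := exists_Q q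
  obtain ⟨c', hc'⟩ := exists_Q q'
  refine ⟨(P_iff _).2 ⟨_, _, ha⟩, (P_iff _).2 ⟨_, _, hb⟩, ?_, c, c', ?_, T_of hc, T_of hc',
    Q_at_le hc ha, Q_at_le2 hc hb, Q_at_le hc' ha, Q_at_le2 hc' hb⟩
  · rintro rfl
    obtain ⟨j, -, hj⟩ := hk true
    obtain ⟨j', -, hj'⟩ := hk false
    obtain ⟨x, x1, x2⟩ := h.2.2.2 (j u0) true
    obtain ⟨y, y1, y2⟩ := h.2.2.2 (j' u0) true
    have := (hb.2.1 x y).1 ((ha.2.1 x y).2 (by rw [x2, y2]))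
    simp [x1, x2, y1, y2, hj, hj'] at this
  · rintro rfl
    obtain ⟨x, x1, x2⟩ := h.2.2.2 u0 true
    have := (hc'.2.2 x (n x)).1 ((hc.2.2 _ _).2 (by simp))
    have hne : ν u0 ≠ u0 := o.ne u0
    rcases this with e | e | e | e
    · have e := congrArg π e
      rw [hn, x1] at e; exact hne e
    · have e := congrArg π e
      rw [hn, h.2.1, x1] at e; exact hne e
    · have e := congrArg π e
      rw [hn, hn', x1] at e; exact hu0 e
    · have e := congrArg π e
      rw [hn, h.2.1, hn', x1] at e; exact hu0 e

theorem sing {c : FactPair X} (x : X) (h : ∀ z, R c x z → z = x) : c = FactOne X := by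
  have hS : ∀ y, S c x y := by
    intro y
    obtain ⟨z, h1, h2⟩ := ex c x y
    rw [h z h1] at h2
    exact h2
  apply ext'
  · intro y z
    rw [R_one]
    refine ⟨fun e => sep e (S_trans (S_symm (hS y)) (hS z)), ?_⟩
    rintro rfl
    exact R_refl _ _
  · intro y z
    rw [S_one]
    exact ⟨fun _ => trivial, fun _ => S_trans (S_symm (hS y)) (hS z)⟩

theorem Crd.SM [Infinite X] [Infinite U] {π : X → U} {f : X → Bool} {m : X → X} (h : Crd π f m)
    {k : U → Bool} (hk : Bal k) {a b : FactPair X} (ha : IsAt a f m)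
    (hb : IsAt b (fun x => f x ^^ k (π x)) m) : SM a b := by
  classical
  obtain ⟨e, he⟩ := hk.equiv
  obtain ⟨β, hβ⟩ := exists_bal (U := U)
  obtain ⟨v⟩ := (inferInstance : Nonempty U)
  let l : U → Bool := fun u => if k u then β (e u).1 else decide ((e u).1 ≠ v)
  have l1 : ∀ w, l (e.symm (w, true)) = β w := by
    intro w
    have : k (e.symm (w, true)) = true := by rw [← he]; simp
    simp [l, this]
  have k1 : ∀ w, k (e.symm (w, true)) = true := by
    intro w; rw [← he]; simp
  have bl : Bal l := by
    intro b
    obtain ⟨j, hj, hj'⟩ := hβ b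
    exact ⟨fun u => e.symm (j u, true), fun u v huv => hj (by simpa using huv), fun u => by
      rw [l1, hj']⟩
  have bkl : Bal fun u => k u ^^ l u := by
    intro b
    obtain ⟨j, hj, hj'⟩ := hβ (!b)
    exact ⟨fun u => e.symm (j u, true), fun u v huv => hj (by simpa using huv), fun u => by
      simp [l1, hj', k1]⟩
  obtain ⟨d, hd⟩ := exists_at (h.shift l).1
  refine ⟨h.L hk ha hb, d, h.L bl ha hd, (h.shift k).L bkl hb (by simpa using hd), ?_⟩
  intro c hac hbc hdc
  rw [ha.le_iff] at hac
  rw [hb.le_iff] at hbc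
  rw [hd.le_iff] at hdc
  obtain ⟨x, x1, x2⟩ := h.2.2.2 (e.symm (v, false)) true
  have kx : k (π x) = false := by rw [x1, ← he]; simp
  have lx : l (π x) = false := by
    simp only [l, kx]
    rw [x1]; simp
  apply sing x
  intro z hz
  have e1 := hac.1 _ _ hz
  have e2 := hbc.1 _ _ hz
  have e3 := hdc.1 _ _ hz
  rw [e1, kx] at e2
  rw [e1, lx] at e3
  have kz : k (π z) = false := by revert e2; generalize f z = p; generalize k (π z) = q; revert p q; decide
  have lz : l (π z) = false := by revert e3; generalize f z = p; generalize l (π z) = q; revert p q; decide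
  simp only [l, kz] at lz
  have lz : (e (π z)).1 = v := by simpa using lz
  apply h.2.2.1
  · rw [x1]
    apply e.injective
    rw [Equiv.apply_symm_apply]
    apply Prod.ext
    · exact lz
    · rw [he, kz]
  · exact e1.symm

theorem SM_complete [Infinite X] {a b : FactPair X} {f g m} (ha : IsAt a f m) (hb : IsAt b g m) :
    ∃ d, SM a d ∧ SM d b := by
  obtain ⟨U, _, π, h⟩ := ha.1.crd
  have hi := h.2.2.2
  choose i i1 i2 using hi
  let h0 : U → Bool := fun u => g (i u true) ^^ true
  have hg : ∀ x, g x = (f x ^^ h0 (π x)) := by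
    intro x
    simp only [h0]
    cases hx : f x
    · have : i (π x) true = m x := by
        apply h.2.2.1
        · rw [i1, h.2.1]
        · rw [i2, h.1.2, hx]; rfl
      rw [this, hb.1.2]; simp
    · have : i (π x) true = x := by
        apply h.2.2.1
        · rw [i1]
        · rw [i2, hx]
      rw [this]; simp
  obtain ⟨d0, b1, b2⟩ := bal3 h0
  obtain ⟨d, hd⟩ := exists_at (h.shift d0).1
  refine ⟨d, h.SM b1 ha hd, (h.shift d0).SM b2 hd ?_⟩
  have : g = fun x => (f x ^^ d0 (π x)) ^^ (d0 (π x) ^^ h0 (π x)) := by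
    funext x
    rw [hg]
    generalize f x = p; generalize d0 (π x) = q; generalize h0 (π x) = r
    revert p q r; decide
  rw [← this]
  exact hb

end Crd
end WF


namespace WF
universe u
section split
variable {U : Type u}

theorem inf_split (A C : Type u) [Infinite A] [Finite C] [Nonempty C] :
    ∃ D : Type u, Nonempty (A ≃ D × C) := by
  refine ⟨A, Cardinal.eq.1 ?_⟩
  rw [Cardinal.mk_prod, Cardinal.lift_id, Cardinal.lift_id, Cardinal.mul_eq_left]
  · exact Cardinal.aleph0_le_mk A
  · exact (Cardinal.lt_aleph0_of_finite C).le.trans (Cardinal.aleph0_le_mk A)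
  · exact Cardinal.mk_ne_zero C

theorem fib_split [Infinite U] (k : U → Bool) (hk : ∀ b, Nontrivial {u // k u = b}) :
    ∃ (C : Type u) (_ : Nontrivial C), ∀ b, ∃ D : Type u, Nonempty ({u // k u = b} ≃ D × C) := by
  by_cases h : ∀ b, Infinite {u // k u = b}
  · refine ⟨ULift Bool, inferInstance, fun b => ?_⟩
    have := h b
    exact inf_split _ _
  · push Not at h
    obtain ⟨b, hb⟩ := h
    refine ⟨{u // k u = b}, hk b, fun b' => ?_⟩
    by_cases e : b' = b
    · subst e
      exact ⟨PUnit, ⟨(Equiv.punitProd _).symm⟩⟩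
    · have : Infinite {u // k u = b'} := by
        by_contra hc
        rw [not_infinite_iff_finite] at hc
        have : Finite (Σ b, {u // k u = b}) := by
          have : ∀ c, Finite {u // k u = c} := by
            intro c
            rcases bor c b with rfl | rfl
            · exact hb
            · rcases bor b' b with rfl | rfl
              · exact absurd rfl e
              · exact hc
          infer_instance
        have := Finite.of_equiv _ (Equiv.sigmaFiberEquiv k)
        exact not_finite U
      exact inf_split _ _

theorem split [Infinite U] (k : U → Bool) (hk : ∀ b, Nontrivial {u // k u = b}) :
    ∃ (D C : Type u) (δ : U → D) (γ : U → C), Nontrivial C ∧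
      (∀ u v, k u = k v → δ u = δ v → γ u = γ v → u = v) ∧
      ∀ u c, ∃ v, k v = k u ∧ δ v = δ u ∧ γ v = c := by
  obtain ⟨C, hC, h⟩ := fib_split k hk
  choose D e using h
  have e : ∀ b, {u // k u = b} ≃ D b × C := fun b => (e b).some
  let F : (b : Bool) → {u // k u = b} → (Σ b, D b) := fun b u => ⟨b, (e b u).1⟩
  let G : (b : Bool) → {u // k u = b} → C := fun b u => (e b u).2
  refine ⟨Σ b, D b, C, fun u => F (k u) ⟨u, rfl⟩, fun u => G (k u) ⟨u, rfl⟩, hC, ?_, ?_⟩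
  · have : ∀ (b b' : Bool) (u : {u // k u = b}) (v : {u // k u = b'}), F b u = F b' v → G b u = G b' v →
        u.1 = v.1 := by
      intro b b' u v h1 h2
      simp only [F, Sigma.mk.injEq] at h1
      obtain ⟨rfl, h1⟩ := h1
      have : e b u = e b v := Prod.ext (eq_of_heq h1) h2
      rw [(e b).injective this]
    intro u v _ h1 h2
    exact this _ _ _ _ h1 h2
  · have : ∀ (b : Bool) (v : {u // k u = b}), F (k v.1) ⟨v.1, rfl⟩ = F b v ∧ G (k v.1) ⟨v.1, rfl⟩ = G b v := by
      rintro b ⟨v, rfl⟩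
      exact ⟨rfl, rfl⟩
    intro u c
    let w := (e (k u)).symm ((e (k u) ⟨u, rfl⟩).1, c)
    refine ⟨w.1, w.2, ?_, ?_⟩
    · refine (this _ w).1.trans ?_
      simp [F, w]
    · refine (this _ w).2.trans ?_
      simp [G, w]
end split

section E
variable {X : Type u}

/-- Flip the colouring on the edge of `x`. -/
def fl [DecidableEq X] (f : X → Bool) (m : X → X) (x z : X) : Bool := f z ^^ decide (z = x ∨ z = m x)

theorem fl_ok [DecidableEq X] {f : X → Bool} {m : X → X} (h : Ok f m) (x : X) : Ok (fl f m x) m := by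
  refine ⟨h.1, fun z => ?_⟩
  have : (m z = x ∨ m z = m x) ↔ (z = x ∨ z = m x) := by
    have := h.1
    constructor
    · rintro (e | e)
      · right; rw [← e, this]
      · left; rw [← this z, e, this]
    · rintro (e | e)
      · right; rw [e]
      · left; rw [e, this]
  simp [fl, this, h.2]

/-- Definable adjacency of atoms with the same matching. -/
def E (a b : FactPair X) : Prop := P a ∧ P b ∧ a ≠ b ∧ (∃ d, SM a d ∧ SM d b) ∧
  ∀ c, FactLE a c → FactLE b c → c = FactOne X

theorem E_of [Infinite X] [DecidableEq X] {a b : FactPair X} {f m x} (ha : IsAt a f m)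
    (hb : IsAt b (fl f m x) m) : E a b := by
  refine ⟨(P_iff _).2 ⟨_, _, ha⟩, (P_iff _).2 ⟨_, _, hb⟩, ?_, SM_complete ha hb, ?_⟩
  · rintro rfl
    obtain ⟨y, hy⟩ := Infinite.exists_notMem_finset ({x, m x} : Finset X)
    simp only [Finset.mem_insert, Finset.mem_singleton, not_or] at hy
    have h1 := (hb.2.1 x y).symm.trans (ha.2.1 x y)
    have h2 := (hb.2.1 x (m y)).symm.trans (ha.2.1 x (m y))
    have h3 : m y ≠ x := by
      rintro rfl
      exact hy.2 (ha.1.1 _).symm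
    have h4 : m y ≠ m x := by
      intro e
      exact hy.1 (by rw [← ha.1.1 y, e, ha.1.1])
    simp [fl, hy.1, hy.2] at h1
    revert h1; generalize f x = p; generalize f y = q; revert p q; decide
  · intro c hac hbc
    rw [ha.le_iff] at hac
    rw [hb.le_iff] at hbc
    apply sing x
    intro z hz
    have e1 := hac.1 _ _ hz
    have e2 := hbc.1 _ _ hz
    have e3 := ha.1.2 x
    by_contra hne
    by_cases hm : z = m x
    · rw [hm, e3] at e1
      simp at e1
    · simp [fl, hne, hm, e1] at e2

theorem E_imp [Infinite X] [DecidableEq X] {a b : FactPair X} {f g m} (h : E a b) (ha : IsAt a f m)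
    (hb : IsAt b g m) : ∃ x, IsAt b (fl f m x) m := by
  obtain ⟨-, -, hne, -, hE⟩ := h
  obtain ⟨U, _, π, hc⟩ := ha.1.crd
  have hi := hc.2.2.2
  choose i i1 i2 using hi
  let k : U → Bool := fun u => g (i u true) ^^ true
  have hg : ∀ x, g x = (f x ^^ k (π x)) := by
    intro x
    simp only [k]
    cases hx : f x
    · have : i (π x) true = m x := by
        apply hc.2.2.1
        · rw [i1, hc.2.1]
        · rw [i2, hc.1.2, hx]; rfl
      rw [this, hb.1.2]; simp
    · have : i (π x) true = x := by
        apply hc.2.2.1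
        · rw [i1]
        · rw [i2, hx]
      rw [this]; simp
  have key : ∃ b, ¬ Nontrivial {u // k u = b} := by
    by_contra hcon
    push Not at hcon
    obtain ⟨D, C, δ, γ, hC, d1, d2⟩ := split k hcon
    obtain ⟨c, c1, c2⟩ := mkFun (X := X) (fun x => (f x, k (π x), δ (π x))) (fun x => γ (π x)) (by
      intro x y e1 e2
      simp only [Prod.mk.injEq] at e1
      exact hc.2.2.1 _ _ (d1 _ _ e1.2.1 e1.2.2 e2) e1.1) (by
      intro x y
      obtain ⟨v, v1, v2, v3⟩ := d2 (π x) (γ (π y))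
      refine ⟨i v (f x), ?_, ?_⟩ <;> simp [i1, i2, v1, v2, v3])
    simp only [Prod.mk.injEq] at c1
    have := hE c (by
      rw [ha.le_iff]
      simp only [c1, c2, hc.2.1, ha.1.2]
      grind) (by
      rw [hb.le_iff]
      simp only [c1, c2, hc.2.1, ha.1.2, hg]
      grind)
    obtain ⟨p, q, hpq⟩ := exists_pair_ne C
    obtain ⟨u⟩ := (inferInstance : Nonempty U)
    obtain ⟨v, v1, v2, v3⟩ := d2 u p
    obtain ⟨w, w1, w2, w3⟩ := d2 u q
    have e : R c (i v true) (i w true) := by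
      rw [c1]; simp [i1, i2, v1, v2, w1, w2]
    rw [this, R_one] at e
    apply hpq
    rw [← v3, ← w3, ← i1 v true, ← i1 w true, e]
  obtain ⟨b, hb'⟩ := key
  rw [not_nontrivial_iff_subsingleton] at hb'
  have hex : ∃ u, k u = b := by
    by_contra hcon
    push Not at hcon
    apply hne
    have : IsAt a g m := ha.change (by
      intro x y
      rw [hg, hg, bne (hcon (π x)), bne (hcon (π y))]
      simp)
    exact this.uniq hb
  obtain ⟨u, hu⟩ := hex
  have hu' : ∀ v, k v = b ↔ v = u := by
    intro v
    constructor
    · intro hv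
      have := hb'.elim ⟨v, hv⟩ ⟨u, hu⟩
      exact congrArg Subtype.val this
    · rintro rfl; exact hu
  refine ⟨i u true, hb.change ?_⟩
  have hz : ∀ z, (z = i u true ∨ z = m (i u true)) ↔ k (π z) = b := by
    intro z
    rw [hu']
    constructor
    · rintro (rfl | rfl)
      · rw [i1]
      · rw [hc.2.1, i1]
    · intro e
      cases hf : f z
      · right
        apply hc.2.2.1
        · rw [hc.2.1, i1, e]
        · rw [hf, hc.1.2, i2]; rfl
      · left
        apply hc.2.2.1
        · rw [i1, e]
        · rw [hf, i2]
  intro x y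
  simp only [fl, hz, hg]
  generalize f x = p; generalize f y = q; generalize k (π x) = r; generalize k (π y) = s
  clear hz hu hu' hb'
  revert p q r s b; decide
end E
end WF


namespace WF
universe u
section fpf
variable {U : Type u}

theorem compl_card (F a : U → U) (s : Set U) (ha : Function.Injective a) (h : ∀ u, a u ∉ s) :
    Nonempty ({x // ¬ x ∈ s} ≃ U) := by
  obtain ⟨e⟩ := Function.Embedding.antisymm (⟨Subtype.val, Subtype.val_injective⟩ : {u // ¬ u ∈ s} ↪ U)
      ⟨fun u => ⟨a u, h u⟩, fun u v huv => ha (Subtype.mk.inj huv)⟩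
  exact ⟨e⟩

theorem ext_inj {V : Type u} (F G : V → U) (hF : Function.Injective F) (hG : Function.Injective G)
    (a : U → U) (ha : Function.Injective a) (h1 : ∀ u, a u ∉ Set.range F) (h2 : ∀ u, a u ∉ Set.range G) :
    ∃ w : Equiv.Perm U, ∀ v, w (F v) = G v := by
  classical
  obtain ⟨e1⟩ := compl_card id a _ ha h1
  obtain ⟨e2⟩ := compl_card id a _ ha h2
  let d : {x // x ∈ Set.range F} ≃ {x // x ∈ Set.range G} :=
    (Equiv.ofInjective F hF).symm.trans (Equiv.ofInjective G hG)
  refine ⟨(Equiv.sumCompl (· ∈ Set.range F)).symm.trans ((Equiv.sumCongr d (e1.trans e2.symm)).trans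
    (Equiv.sumCompl (· ∈ Set.range G))), fun v => ?_⟩
  have : (Equiv.sumCompl (· ∈ Set.range F)).symm (F v) = Sum.inl ⟨F v, v, rfl⟩ :=
    Equiv.sumCompl_symm_apply_of_pos _
  have h3 : (Equiv.ofInjective F hF).symm ⟨F v, v, rfl⟩ = v := Equiv.ofInjective_symm_apply hF v
  simp only [Equiv.trans_apply, this, Equiv.sumCongr_apply, Sum.map_inl, Equiv.sumCompl_apply_inl, d, h3]
  rfl

theorem idx [Infinite U] (k : U → Bool) (hk : Bal k) : ∃ e : U ≃ (ℤ × Bool) × U,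
    ∀ u, (e u).1 ≠ (0, false) → k u = true := by
  classical
  have hZ : Nonempty ((ℤ × Bool) × U ≃ U) := by
    rw [← Cardinal.lift_mk_eq']
    simp [Cardinal.mul_eq_right, Cardinal.aleph0_le_mk U, Cardinal.aleph0_ne_zero]
  obtain ⟨ψ⟩ := hZ
  obtain ⟨e, he⟩ := hk.equiv
  have e1 : Nonempty ({u // k u = false} ≃ {p : (ℤ × Bool) × U // p.1 = (0, false)}) := by
    obtain ⟨j, hj, hj'⟩ := hk false
    exact Function.Embedding.antisymm
      ⟨fun u => ⟨((0, false), u.1), rfl⟩, fun u v h => by simpa [Subtype.ext_iff] using h⟩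
      ⟨fun p => ⟨j p.1.2, hj' _⟩, fun p q h => by
        have := hj (Subtype.mk.inj h)
        exact Subtype.ext (Prod.ext (p.2.trans q.2.symm) this)⟩
  have e2 : Nonempty ({u // ¬ k u = false} ≃ {p : (ℤ × Bool) × U // ¬ p.1 = (0, false)}) := by
    obtain ⟨j, hj, hj'⟩ := hk true
    exact Function.Embedding.antisymm
      ⟨fun u => ⟨((0, true), u.1), by simp⟩, fun u v h => by simpa [Subtype.ext_iff] using h⟩
      ⟨fun p => ⟨j (ψ p.1), by simp [hj']⟩, fun p q h => by
        have := ψ.injective (hj (Subtype.mk.inj h))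
        exact Subtype.ext this⟩
  obtain ⟨e1⟩ := e1
  obtain ⟨e2⟩ := e2
  refine ⟨(Equiv.sumCompl (fun u => k u = false)).symm.trans ((Equiv.sumCongr e1 e2).trans
    (Equiv.sumCompl (fun p : (ℤ × Bool) × U => p.1 = (0, false)))), fun u hu => ?_⟩
  by_contra hc
  have hc : k u = false := by simpa using hc
  have : (Equiv.sumCompl (fun u => k u = false)).symm u = Sum.inl ⟨u, hc⟩ :=
    Equiv.sumCompl_symm_apply_of_pos _
  simp only [Equiv.trans_apply, this, Equiv.sumCongr_apply, Sum.map_inl, Equiv.sumCompl_apply_inl] at hu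
  exact hu (e1 ⟨u, hc⟩).2

/-- `u0` acting on some of the columns. -/
def col {J : Type*} (c : J → Bool) (u0 : Equiv.Perm U) : Equiv.Perm (J × U) where
  toFun p := (p.1, if c p.1 then u0 p.2 else p.2)
  invFun p := (p.1, if c p.1 then u0.symm p.2 else p.2)
  left_inv p := by rcases p with ⟨i, a⟩; cases h : c i <;> simp [h]
  right_inv p := by rcases p with ⟨i, a⟩; cases h : c i <;> simp [h]

/-- Reflection of the columns. -/
def rfl' (t : ℤ) : Equiv.Perm ((ℤ × Bool) × U) where
  toFun p := ((t - p.1.1, !p.1.2), p.2)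
  invFun p := ((t - p.1.1, !p.1.2), p.2)
  left_inv p := by simp
  right_inv p := by simp

theorem swindle (u0 : Equiv.Perm U) :
    col (fun p : ℤ × Bool => decide (p = (0, false))) u0 =
      (col (fun p : ℤ × Bool => decide (0 ≤ p.1 ∧ p.2 = false)) u0 * rfl' 1 *
        (col (fun p : ℤ × Bool => decide (0 ≤ p.1 ∧ p.2 = false)) u0)⁻¹) *
      (col (fun p : ℤ × Bool => decide (0 ≤ p.1 ∧ p.2 = false)) u0 * rfl' 0 *
        (col (fun p : ℤ × Bool => decide (0 ≤ p.1 ∧ p.2 = false)) u0)⁻¹) * (rfl' 0 * rfl' 1) := by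
  ext1 ⟨⟨i, b⟩, a⟩
  simp only [Equiv.Perm.mul_apply]
  simp only [Equiv.Perm.inv_def]
  simp only [col, rfl', Equiv.coe_fn_mk, Equiv.coe_fn_symm_mk]
  rcases lt_trichotomy i 0 with h | h | h <;> cases b <;> simp [h]
  all_goals first | rfl | grind

theorem fpf_gen [Infinite U] (p : Equiv.Perm U → Prop) (hm : ∀ v w, p v → p w → p (v * w))
    (hi : ∀ i : Equiv.Perm U, (∀ u, i (i u) = u) → (∀ u, i u ≠ u) → p i) (τ : Equiv.Perm U) : p τ := by
  classical
  have A : ∀ (w : Equiv.Perm U) (j : U → U), Function.Injective j → (∀ u, w (j u) = j u) → p w := by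
    intro w j hj hw
    obtain ⟨β, hβ⟩ := exists_bal (U := U)
    obtain ⟨ψ⟩ := equiv_prod_bool U
    let k : U → Bool := fun u => decide (∃ v, u = j (ψ.symm (v, true)))
    have hk : Bal k := by
      intro b
      refine ⟨fun u => j (ψ.symm (u, b)), fun u v h => by simpa using hj h, fun u => ?_⟩
      simp [k, hj.eq_iff]
    obtain ⟨e, he⟩ := idx k hk
    have hfix : ∀ u, (e u).1 ≠ (0, false) → w u = u := by
      intro u hu
      have := he u hu
      simp only [k, decide_eq_true_eq] at this
      obtain ⟨v, rfl⟩ := this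
      exact hw _
    have hfix' : ∀ u, (e u).1 ≠ (0, false) → w.symm u = u := by
      intro u hu
      rw [Equiv.symm_apply_eq, hfix u hu]
    have hc : ∀ u, (e u).1 = (0, false) → (e (w u)).1 = (0, false) := by
      intro u hu
      by_contra h
      have := w.injective (hfix _ h)
      exact h (by rw [this, hu])
    have hc' : ∀ u, (e u).1 = (0, false) → (e (w.symm u)).1 = (0, false) := by
      intro u hu
      by_contra h
      have := w.symm.injective (hfix' _ h)
      exact h (by rw [this, hu])
    let u0 : Equiv.Perm U :=
      { toFun := fun a => (e (w (e.symm ((0, false), a)))).2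
        invFun := fun a => (e (w.symm (e.symm ((0, false), a)))).2
        left_inv := fun a => by
          have h := hc (e.symm ((0, false), a)) (by simp)
          have : ((0, false), (e (w (e.symm ((0, false), a)))).2) = e (w (e.symm ((0, false), a))) :=
            Prod.ext h.symm rfl
          simp only [this]
          simp
        right_inv := fun a => by
          have h := hc' (e.symm ((0, false), a)) (by simp)
          have : ((0, false), (e (w.symm (e.symm ((0, false), a)))).2) = e (w.symm (e.symm ((0, false), a))) :=
            Prod.ext h.symm rfl
          simp only [this]
          simp }
    let J : Equiv.Perm ((ℤ × Bool) × U) → Equiv.Perm U := fun s => (e.trans s).trans e.symm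
    have J1 : ∀ s t, J (s * t) = J s * J t := by
      intro s t; ext u; simp [J]
    have hwJ : w = J (col (fun p : ℤ × Bool => decide (p = (0, false))) u0) := by
      ext u
      by_cases hu : (e u).1 = (0, false)
      · have : ((0, false), (e u).2) = e u := Prod.ext hu.symm rfl
        simp [J, col, hu, u0, this]
        rw [Equiv.eq_symm_apply]
        exact Prod.ext (hc u hu) rfl
      · simp [J, col, hu, hfix u hu]
    have Ji : ∀ s : Equiv.Perm ((ℤ × Bool) × U), (∀ z, s (s z) = z) → (∀ z, s z ≠ z) → p (J s) := by
      intro s h1 h2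
      apply hi
      · intro u; simp [J, h1]
      · intro u h
        apply h2 (e u)
        simpa [J, Equiv.symm_apply_eq] using h
    have hr : ∀ t (z : (ℤ × Bool) × U), rfl' t (rfl' t z) = z := by
      intro t z; simp [rfl']
    have hr' : ∀ t (z : (ℤ × Bool) × U), rfl' t z ≠ z := by
      rintro t ⟨⟨i, b⟩, a⟩ h; simp [rfl'] at h
    have hconj : ∀ (v : Equiv.Perm ((ℤ × Bool) × U)) t, p (J (v * rfl' t * v⁻¹)) := by
      intro v t
      apply Ji
      · intro z; simp [hr]
      · intro z h
        simp only [Equiv.Perm.mul_apply] at h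
        have h := (Equiv.Perm.eq_inv_iff_eq).2 h
        exact hr' _ _ h
    rw [hwJ, swindle, J1, J1, J1 (rfl' 0)]
    exact hm _ _ (hm _ _ (hconj _ _) (hconj _ _)) (hm _ _ (Ji _ (hr _) (hr' _)) (Ji _ (hr _) (hr' _)))
  have B : ∃ a1 a2 a3 : U → U, Function.Injective a1 ∧ Function.Injective a2 ∧ Function.Injective a3 ∧
      (∀ u v, a1 u ≠ a2 v) ∧ (∀ u v, a1 u ≠ a3 v) ∧ (∀ u v, a2 u ≠ a3 v) ∧ (∀ u v, τ (a1 u) ≠ a2 v) ∧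
      (∀ u v, τ (a1 u) ≠ a3 v) := by
    obtain ⟨h, hb⟩ := exists_bal (U := U)
    obtain ⟨ψ⟩ := equiv_prod_bool U
    obtain ⟨j, hj, hj'⟩ := hb true
    obtain ⟨j0, hj0, hj0'⟩ := hb false
    obtain ⟨b, i, hi, hi'⟩ := pig fun u => h (τ (j u))
    cases b
    · refine ⟨fun u => j (i (ψ.symm (u, true))), fun u => j (i (ψ.symm (ψ.symm (u, true), false))),
        fun u => j (i (ψ.symm (ψ.symm (u, false), false))), ?_, ?_, ?_, ?_, ?_, ?_, ?_, ?_⟩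
      · intro u v e; simpa using hi (hj e)
      · intro u v e; simpa using hi (hj e)
      · intro u v e; simpa using hi (hj e)
      · intro u v e; simpa using hi (hj e)
      · intro u v e; simpa using hi (hj e)
      · intro u v e; simpa using hi (hj e)
      · intro u v e; have := congrArg h e; simp [hi', hj'] at this
      · intro u v e; have := congrArg h e; simp [hi', hj'] at this
    · refine ⟨fun u => j (i u), fun u => j0 (ψ.symm (u, true)), fun u => j0 (ψ.symm (u, false)), 
        hj.comp hi, ?_, ?_, ?_, ?_, ?_, ?_, ?_⟩
      · intro u v e; simpa using hj0 e
      · intro u v e; simpa using hj0 e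
      · intro u v e; have := congrArg h e; simp [hj0', hj'] at this
      · intro u v e; have := congrArg h e; simp [hj0', hj'] at this
      · intro u v e; simpa using hj0 e
      · intro u v e; have := congrArg h e; simp [hi', hj0'] at this
      · intro u v e; have := congrArg h e; simp [hi', hj0'] at this
  obtain ⟨a1, a2, a3, i1, i2, i3, h1, h2, h3, h4, h5⟩ := B
  obtain ⟨w, hw⟩ := ext_inj (V := U ⊕ U) (Sum.elim (fun u => τ (a1 u)) a2) (Sum.elim a1 a2)
    ((τ.injective.comp i1).sumElim i2 h4) (i1.sumElim i2 h1) a3 i3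
    (by rintro u ⟨v | v, e⟩; exacts [h5 _ _ e, h3 _ _ e]) (by rintro u ⟨v | v, e⟩; exacts [h2 _ _ e, h3 _ _ e])
  have e1 : p w⁻¹ := A _ a2 i2 fun u => by
    rw [Equiv.Perm.inv_eq_iff_eq]; exact (hw (Sum.inr u)).symm
  have e2 : p (w * τ) := A _ a1 i1 fun u => hw (Sum.inl u)
  have := hm _ _ e1 e2
  simpa using this

end fpf
end WF


namespace WF
universe u
section SF
variable {X : Type u}

/-- One step between matchings. -/
def Stp (f : X → Bool) (m n : X → X) : Prop :=
  Ok f m ∧ Ok f n ∧ (∀ x, m (n x) = n (m x)) ∧ ∀ x, m x ≠ n x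

theorem Stp.L [Infinite X] {f : X → Bool} {m n} (h : Stp f m n) {a b} (ha : IsAt a f m)
    (hb : IsAt b f n) : L a b := by
  classical
  obtain ⟨hm, hn, hc, hne⟩ := h
  obtain ⟨⟨m1, m2⟩, ⟨n1, n2⟩⟩ := And.intro hm hn
  obtain ⟨O, hO⟩ : ∃ O : Setoid X, ∀ x y, O x y ↔ y = x ∨ y = m x :=
    ⟨⟨fun x y => y = x ∨ y = m x, ⟨fun x => Or.inl rfl, by grind, by grind⟩⟩, fun x y => Iff.rfl⟩
  obtain ⟨e, e1, e2⟩ := flip_lemma O (fun x => m (n x)) (by grind) (by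
      intro x y; rw [hO, hO]; grind) (by
      intro x; rw [hO]; have := hn.ne x; have := hm.ne x; grind)
  have em : ∀ x, e (m x) = e x := fun x => (e2 x (m x) ((hO _ _).2 (Or.inr rfl))).symm
  have en : ∀ x, e (n x) = !e x := by
    intro x; rw [← em, e1]
  obtain ⟨O4, hO4⟩ := orb4 hm hn hc
  obtain ⟨x0⟩ := (inferInstance : Nonempty X)
  let e' : X → Bool := fun x => e x ^^ decide (O4 x0 x)
  have o1 : ∀ x, O4 x0 (m x) ↔ O4 x0 x := by
    intro x; simp only [hO4]; grind
  have o2 : ∀ x, O4 x0 (n x) ↔ O4 x0 x := by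
    intro x; simp only [hO4]; grind
  have em' : ∀ x, e' (m x) = e' x := by
    intro x; simp [e', o1, em]
  have en' : ∀ x, e' (n x) = !e' x := by
    intro x; simp [e', o2, en]
  have key : ∀ d : X → Bool, (∀ x, d (m x) = d x) → (∀ x, d (n x) = !d x) → ∃ c,
      IsQ c f d m (fun x => m (n x)) ∧ FactLE a c ∧ FactLE b c := by
    intro d d1 d2
    have q : QD f d m (fun x => m (n x)) := by
      refine ⟨hm, ⟨by grind, by grind⟩, d1, ?_, by grind⟩
      intro x; rw [m2, n2]; simp
    obtain ⟨c, hc'⟩ := exists_Q q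
    refine ⟨c, hc', Q_at_le hc' ha, ?_⟩
    rw [hb.le_iff]
    simp only [hc'.2.1, hc'.2.2, d2, n2]
    refine ⟨fun x y h => h.1, fun x => ?_, fun x y h => by rw [h.1, h.2]; simp⟩
    rw [m1]; simp
  obtain ⟨c, c1, c2, c3⟩ := key e em en
  obtain ⟨c', d1, d2, d3⟩ := key e' em' en'
  refine ⟨(P_iff _).2 ⟨_, _, ha⟩, (P_iff _).2 ⟨_, _, hb⟩, ?_, c, c', ?_, T_of c1, T_of d1, c2, c3, d2, d3⟩
  · rintro rfl
    exact hne x0 (congrFun (ha.m_uniq hb fun _ _ => Iff.rfl) x0)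
  · rintro rfl
    obtain ⟨y, hy⟩ := Infinite.exists_notMem_finset ({x0, m x0, n x0, m (n x0)} : Finset X)
    simp only [Finset.mem_insert, Finset.mem_singleton] at hy
    rw [← hO4] at hy
    have : ∀ z, ¬ O4 x0 z → f z = f x0 → False := by
      intro z hz hf
      have h1 := (c1.2.1 x0 z).symm.trans (d1.2.1 x0 z)
      simp only [hf, true_and, e', hz, O4.refl' x0] at h1
      revert h1; generalize e x0 = p; generalize e z = q; revert p q; decide
    rcases bor (f y) (f x0) with h | h
    · exact this y hy h
    · exact this (m y) (by rwa [o1]) (by rw [m2, h]; simp)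

theorem chain [Infinite X] {f : X → Bool} {m n : X → X} (hm : Ok f m) (hn : Ok f n) :
    Relation.ReflTransGen (Stp f) m n := by
  obtain ⟨U, _, π, hc⟩ := hm.crd
  obtain ⟨-, c1, c2, c3⟩ := hc
  choose i i1 i2 using c3
  have ii : ∀ x, i (π x) (f x) = x := fun x => c2 _ _ (i1 _ _) (i2 _ _)
  let M : Equiv.Perm U → X → X := fun τ x => if f x then i (τ (π x)) false else i (τ.symm (π x)) true
  have M1 : ∀ τ u, M τ (i u true) = i (τ u) false := by intro τ u; simp [M, i1, i2]
  have M2 : ∀ τ u, M τ (i u false) = i (τ.symm u) true := by intro τ u; simp [M, i1, i2]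
  have cs : ∀ x, ∃ u b, x = i u b := fun x => ⟨_, _, (ii x).symm⟩
  have ij : ∀ u v b, i u b = i v b ↔ u = v := by
    intro u v b
    refine ⟨fun h => ?_, fun h => by rw [h]⟩
    rw [← i1 u b, h, i1]
  have Mok : ∀ τ, Ok f (M τ) := by
    intro τ
    constructor
    · intro x
      obtain ⟨u, b, rfl⟩ := cs x
      cases b <;> simp [M1, M2]
    · intro x
      obtain ⟨u, b, rfl⟩ := cs x
      cases b <;> simp [M1, M2, i2]
  have M0 : M 1 = m := by
    funext x
    apply c2
    · simp only [M]
      split <;> simp [i1, c1]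
      rfl
    · rw [(Mok 1).2, hm.2]
  have hall : ∀ τ ρ : Equiv.Perm U, Relation.ReflTransGen (Stp f) (M ρ) (M (ρ * τ)) := by
    intro τ
    apply fpf_gen (fun τ => ∀ ρ : Equiv.Perm U, Relation.ReflTransGen (Stp f) (M ρ) (M (ρ * τ)))
    · intro v w hv hw ρ
      rw [← mul_assoc]
      exact (hv ρ).trans (hw _)
    · intro j j1 j2 ρ
      apply Relation.ReflTransGen.single
      have hs : ∀ u, j.symm u = j u := by
        intro u; rw [Equiv.symm_apply_eq, j1]
      have hps : ∀ u, (ρ * j).symm u = j (ρ.symm u) := by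
        intro u; rw [Equiv.symm_apply_eq]; simp [j1]
      refine ⟨Mok _, Mok _, ?_, ?_⟩
      · intro x
        obtain ⟨u, b, rfl⟩ := cs x
        cases b <;> simp [M1, M2, hps]
      · intro x
        obtain ⟨u, b, rfl⟩ := cs x
        cases b
        · rw [M2, M2, hps, Ne, ij]; exact fun h => j2 _ h.symm
        · rw [M1, M1, Ne, ij]; simpa using fun h => j2 _ h.symm
  have hτ : ∃ τ, M τ = n := by
    have hn' : ∀ u b, i (π (n (i u b))) (!b) = n (i u b) := by
      intro u b
      have := ii (n (i u b))
      rwa [hn.2, i2] at this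
    let τ : Equiv.Perm U := 
      { toFun := fun u => π (n (i u true))
        invFun := fun u => π (n (i u false))
        left_inv := fun u => by have := hn' u true; simp only [Bool.not_true] at this; beta_reduce; rw [this, hn.1, i1]
        right_inv := fun u => by have := hn' u false; simp only [Bool.not_false] at this; beta_reduce; rw [this, hn.1, i1] }
    refine ⟨τ, ?_⟩
    funext x
    obtain ⟨u, b, rfl⟩ := cs x
    cases b
    · rw [M2]; exact hn' u false
    · rw [M1]; exact hn' u true
  obtain ⟨τ, hτ⟩ := hτ
  have := hall τ 1
  rwa [one_mul, M0, hτ] at this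

end SF

section Aut
variable {X : Type u}

theorem aut_inv {α : FactPair X → FactPair X} (h : IsFactAut α) : ∃ α' : FactPair X → FactPair X,
    IsFactAut α' ∧ (∀ x, α (α' x) = x) ∧ ∀ x, α' (α x) = x := by
  obtain ⟨α', h1, h2⟩ := Function.bijective_iff_has_inverse.1 h.1
  refine ⟨α', ⟨Function.bijective_iff_has_inverse.2 ⟨α, h2, h1⟩, fun p q => ?_, fun p => ?_⟩, h2, h1⟩
  · rw [h.2.1 (α' p), h2, h2]
  · apply h.1.1
    rw [h2, h.2.2, h2]

theorem aut_comp {α β : FactPair X → FactPair X} (h : IsFactAut α) (k : IsFactAut β) :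
    IsFactAut (α ∘ β) :=
  ⟨h.1.comp k.1, fun p q => (k.2.1 p q).trans (h.2.1 _ _), fun p => by simp [h.2.2, k.2.2]⟩

variable {α : FactPair X → FactPair X}

theorem aut_zero (h : IsFactAut α) : α (FactZero X) = FactZero X := by
  obtain ⟨α', h', h1, h2⟩ := aut_inv h
  apply le_antisymm' _ (zero_le' _)
  rw [h'.2.1, h2]
  exact zero_le' _

theorem aut_one (h : IsFactAut α) : α (FactOne X) = FactOne X := by
  obtain ⟨α', h', h1, h2⟩ := aut_inv h
  apply le_antisymm' (le_one' _)
  rw [h'.2.1, h2]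
  exact le_one' _

theorem aut_Tq (h : IsFactAut α) {a c} (k : Tq a c) : Tq (α a) (α c) := by
  obtain ⟨α', h', h1, h2⟩ := aut_inv h
  obtain ⟨k1, k2, k3, s, hs⟩ := k
  refine ⟨fun e => k1 (h.1.1 (by rw [e, aut_zero h])), fun e => k2 (h.1.1 e), (h.2.1 _ _).1 k3, fun i => α (s i), fun x hx => ?_⟩
  rw [h'.2.1, h2] at hx
  obtain ⟨i, hi⟩ := hs _ hx
  exact ⟨i, by simp only [hi, h1]⟩

theorem aut_P (h : IsFactAut α) {a} (k : P a) : P (α a) := by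
  obtain ⟨c, hc⟩ := k
  exact ⟨_, aut_Tq h hc⟩

theorem aut_T (h : IsFactAut α) {a} (k : T a) : T (α a) := by
  obtain ⟨c, hc⟩ := k
  exact ⟨_, aut_Tq h hc⟩

theorem aut_L (h : IsFactAut α) {a b} (k : L a b) : L (α a) (α b) := by
  obtain ⟨k1, k2, k3, c, c', k4, k5, k6, k7, k8, k9, k10⟩ := k
  exact ⟨aut_P h k1, aut_P h k2, fun e => k3 (h.1.1 e), α c, α c', fun e => k4 (h.1.1 e), aut_T h k5, aut_T h k6,
    (h.2.1 _ _).1 k7, (h.2.1 _ _).1 k8, (h.2.1 _ _).1 k9, (h.2.1 _ _).1 k10⟩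

theorem aut_SM (h : IsFactAut α) {a b} (k : SM a b) : SM (α a) (α b) := by
  obtain ⟨α', h', h1, h2⟩ := aut_inv h
  obtain ⟨k1, d, k2, k3, k4⟩ := k
  refine ⟨aut_L h k1, α d, aut_L h k2, aut_L h k3, fun c c1 c2 c3 => ?_⟩
  rw [h'.2.1, h2] at c1 c2 c3
  have := k4 _ c1 c2 c3
  rw [← h1 c, this, aut_one h]

theorem aut_E (h : IsFactAut α) {a b} (k : E a b) : E (α a) (α b) := by
  obtain ⟨α', h', h1, h2⟩ := aut_inv h
  obtain ⟨k1, k2, k3, ⟨d, k4, k5⟩, k6⟩ := k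
  refine ⟨aut_P h k1, aut_P h k2, fun e => k3 (h.1.1 e), ⟨α d, aut_SM h k4, aut_SM h k5⟩, fun c c1 c2 => ?_⟩
  rw [h'.2.1, h2] at c1 c2
  have := k6 _ c1 c2
  rw [← h1 c, this, aut_one h]

theorem aut_at [Infinite X] (h : IsFactAut α) {a f m} (ha : IsAt a f m) : ∃ f' m', IsAt (α a) f' m' :=
  (P_iff _).1 (aut_P h ((P_iff _).2 ⟨_, _, ha⟩))

theorem aut_S [Infinite X] (h : IsFactAut α) {a b f g m f' g' m' n'} (ha : IsAt a f m) (hb : IsAt b g m)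
    (ha' : IsAt (α a) f' m') (hb' : IsAt (α b) g' n') : m' = n' := by
  obtain ⟨d, h1, h2⟩ := SM_complete ha hb
  obtain ⟨u, k, hd⟩ := (P_iff d).1 h1.1.2.1
  obtain ⟨u', k', hd'⟩ := aut_at h hd
  exact (SM_S (aut_SM h h1) ha' hd').trans (SM_S (aut_SM h h2) hd' hb')

theorem aut_R [Infinite X] (h : IsFactAut α) {a b f m n f' g' m' n'} (ha : IsAt a f m) (hb : IsAt b f n)
    (ha' : IsAt (α a) f' m') (hb' : IsAt (α b) g' n') : ∀ x y, f' x = f' y ↔ g' x = g' y := by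
  have := chain ha.1 hb.1
  induction this generalizing b g' n' with
  | refl =>
    have := ha.uniq hb
    subst this
    intro x y
    rw [← ha'.2.1, hb'.2.1]
  | tail _ hs ih =>
    obtain ⟨d, hd⟩ := exists_at hs.1
    obtain ⟨u', k', hd'⟩ := aut_at h hd
    have h1 := ih hd hd'
    intro x y
    rw [h1]
    rcases L_A1 (aut_L h (hs.L hd hb)) hd' hb' with h2 | h2
    · exact h2 x y
    · exfalso
      subst h2
      obtain ⟨α', g', g1, g2⟩ := aut_inv h
      have := aut_S g' hd' hb' (by rwa [g2]) (by rwa [g2])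
      obtain ⟨x0⟩ := (inferInstance : Nonempty X)
      exact hs.2.2.2 x0 (congrFun this x0)

end Aut
end WF


namespace WF
universe u
section match_
variable {X : Type u}

theorem Ok.conj {f : X → Bool} {m : X → X} (h : Ok f m) (s : X → X) (s1 : ∀ x, s (s x) = x)
    (s2 : ∀ x, f (s x) = f x) : Ok f (fun x => s (m (s x))) := by
  obtain ⟨h1, h2⟩ := h
  exact ⟨by grind, by grind⟩

theorem swap_inv [DecidableEq X] {f : X → Bool} {x y : X} (h : f x = f y) (z : X) :
    f (Equiv.swap x y z) = f z := by
  rw [Equiv.swap_apply_def]; grind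

theorem Ok.conj_swap [DecidableEq X] {f : X → Bool} {m : X → X} (h : Ok f m) {x y : X} (hxy : f x = f y) :
    Ok f (fun z => Equiv.swap x y (m (Equiv.swap x y z))) :=
  h.conj _ (fun z => by simp) (swap_inv hxy)

theorem Ok.through [DecidableEq X] {f : X → Bool} {m : X → X} (h : Ok f m) {x y : X} (hxy : f y = !f x) :
    ∃ n, Ok f n ∧ n x = y := by
  refine ⟨_, h.conj_swap (x := y) (y := m x) (by rw [h.2, hxy]), ?_⟩
  have h1 : x ≠ y := by rintro rfl; simp at hxy
  rw [Equiv.swap_apply_of_ne_of_ne h1 (h.ne x).symm]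
  simp

theorem Ok.through2 [DecidableEq X] {f : X → Bool} {m : X → X} (h : Ok f m) {x y z w : X}
    (hxy : f y = !f x) (hzw : f w = !f z) (e : f x = f z) (hxz : x ≠ z) (hyw : y ≠ w) :
    ∃ n, Ok f n ∧ n x = y ∧ n z = w := by
  obtain ⟨n, hn, hx⟩ := h.through hxy
  have h1 := hn.1
  have h2 := hn.2
  refine ⟨_, hn.conj_swap (x := w) (y := n z) (by rw [h2, hzw]), ?_, ?_⟩
  · have : x ≠ w := by grind
    have : x ≠ n z := by grind
    have : y ≠ n z := by grind
    rw [Equiv.swap_apply_of_ne_of_ne ‹x ≠ w› ‹x ≠ n z›, hx, Equiv.swap_apply_of_ne_of_ne hyw ‹y ≠ n z›]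
  · have : z ≠ w := by grind
    rw [Equiv.swap_apply_of_ne_of_ne this (hn.ne z).symm]
    simp

theorem exists_Ok (X : Type u) [Infinite X] : ∃ (f : X → Bool) (m : X → X), Ok f m := by
  obtain ⟨e⟩ := equiv_prod_bool X
  exact ⟨fun x => (e x).2, fun x => e.symm ((e x).1, !(e x).2), fun x => by simp, fun x => by simp⟩

end match_

section Bt
variable {X : Type u} [DecidableEq X]

/-- Flip the colouring at two points. -/
def flip2 (f : X → Bool) (x y z : X) : Bool := f z ^^ decide (z = x ∨ z = y)

theorem flip2_uniq [Infinite X] {f : X → Bool} {x y z w : X} (h1 : f x = true) (h2 : f y = false)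
    (h3 : f z = true) (h4 : f w = false)
    (h : ∀ p q, flip2 f x y p = flip2 f x y q ↔ flip2 f z w p = flip2 f z w q) : x = z ∧ y = w := by
  obtain ⟨p, hp⟩ := Infinite.exists_notMem_finset ({x, y, z, w} : Finset X)
  simp only [Finset.mem_insert, Finset.mem_singleton, not_or] at hp
  have hx := h p x
  have hy := h p y
  simp only [flip2, hp, h1, h2, or_self, decide_false] at hx hy
  constructor
  · by_contra hne
    have : x ≠ w := by rintro rfl; simp [h1] at h4
    simp [hne, this] at hx
  · by_contra hne
    have : y ≠ z := by rintro rfl; simp [h2] at h3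
    simp [hne, this] at hy

def Cmp (α : FactPair X → FactPair X) (f f' : X → Bool) : Prop :=
  ∀ a m, IsAt a f m → ∃ m', IsAt (α a) f' m'

theorem exists_Cmp [Infinite X] {α : FactPair X → FactPair X} (h : IsFactAut α) {f m} (hm : Ok f m) :
    ∃ f', Cmp α f f' := by
  obtain ⟨a, ha⟩ := exists_at hm
  obtain ⟨f', m', ha'⟩ := aut_at h ha
  refine ⟨f', fun b n hb => ?_⟩
  obtain ⟨g', n', hb'⟩ := aut_at h hb
  exact ⟨n', hb'.change (aut_R h hb ha hb' ha')⟩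

theorem Cmp.of_one [Infinite X] {α : FactPair X → FactPair X} (h : IsFactAut α) {f f' m m' a}
    (ha : IsAt a f m) (ha' : IsAt (α a) f' m') : Cmp α f f' := by
  intro b n hb
  obtain ⟨g', n', hb'⟩ := aut_at h hb
  exact ⟨n', hb'.change (aut_R h hb ha hb' ha')⟩

def Bt (α : FactPair X → FactPair X) (f f' : X → Bool) (x y x' y' : X) : Prop :=
  f x = true ∧ f y = false ∧ f' x' = true ∧ f' y' = false ∧ Cmp α (flip2 f x y) (flip2 f' x' y')

variable [Infinite X] {α α' : FactPair X → FactPair X} {f f' : X → Bool}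

theorem flip2_comm (f : X → Bool) (x y : X) : flip2 f x y = flip2 f y x := by
  funext z; simp [flip2, or_comm]

theorem flip2_ok {m : X → X} (h : Ok f m) {x y : X} (e : m x = y) : Ok (flip2 f x y) m := by
  subst e; exact fl_ok h x

/-- Uniqueness. -/
theorem Bt.uniq {x y x' y' x'' y'' : X} {m : X → X} (hm : Ok f m) (h1 : Bt α f f' x y x' y') (h2 : Bt α f f' x y x'' y'') :
    x' = x'' ∧ y' = y'' := by
  obtain ⟨n, hn, e⟩ := hm.through (x := x) (y := y) (by rw [h1.1, h1.2.1]; rfl)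
  obtain ⟨b, hb⟩ := exists_at (flip2_ok hn e)
  obtain ⟨k1, hk1⟩ := h1.2.2.2.2 _ _ hb
  obtain ⟨k2, hk2⟩ := h2.2.2.2.2 _ _ hb
  apply flip2_uniq h1.2.2.1 h1.2.2.2.1 h2.2.2.1 h2.2.2.2.1
  intro p q
  rw [← hk1.2.1, hk2.2.1]

theorem Bt_core (h : IsFactAut α) (hc : Cmp α f f') {x y : X} (hx : f x = true) (hy : f y = false)
    {a m m'} (ha : IsAt a f m) (ha' : IsAt (α a) f' m') (e : m x = y) :
    ∃ x' y', Bt α f f' x y x' y' ∧ m' x' = y' := by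
  obtain ⟨b, hb⟩ := exists_at (flip2_ok ha.1 e)
  have hE : E a b := E_of (x := x) ha (by subst e; exact hb)
  obtain ⟨g, n, hb'⟩ := aut_at h hb
  have := aut_S h ha hb ha' hb'
  subst this
  obtain ⟨z, hz⟩ := E_imp (aut_E h hE) ha' hb'
  have hz : IsAt (α b) (flip2 f' z (m' z)) m' := hz
  cases hf : f' z
  · refine ⟨m' z, z, ⟨hx, hy, by rw [ha'.1.2, hf]; rfl, hf, ?_⟩, ha'.1.1 z⟩
    rw [flip2_comm f' (m' z)]
    exact Cmp.of_one h hb hz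
  · refine ⟨z, m' z, ⟨hx, hy, hf, by rw [ha'.1.2, hf]; rfl, ?_⟩, rfl⟩
    exact Cmp.of_one h hb hz

theorem Bt_edge (h : IsFactAut α) (hc : Cmp α f f') {x y x' y' : X} (hB : Bt α f f' x y x' y')
    {a m m'} (ha : IsAt a f m) (ha' : IsAt (α a) f' m') (e : m x = y) : m' x' = y' := by
  obtain ⟨x'', y'', h1, h2⟩ := Bt_core h hc hB.1 hB.2.1 ha ha' e
  obtain ⟨rfl, rfl⟩ := hB.uniq ha.1 h1
  exact h2

theorem Bt_ex (h : IsFactAut α) (hc : Cmp α f f') {m : X → X} (hm : Ok f m) {x y : X} (hx : f x = true)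
    (hy : f y = false) : ∃ x' y', Bt α f f' x y x' y' := by
  obtain ⟨n, hn, e⟩ := hm.through (x := x) (y := y) (by rw [hx, hy]; rfl)
  obtain ⟨a, ha⟩ := exists_at hn
  obtain ⟨m', ha'⟩ := hc _ _ ha
  obtain ⟨x', y', h1, -⟩ := Bt_core h hc hx hy ha ha' e
  exact ⟨x', y', h1⟩

theorem Cmp.inv (h : IsFactAut α') (h2 : ∀ x, α' (α x) = x) (hc : Cmp α f f') {m : X → X} (hm : Ok f m) :
    Cmp α' f' f := by
  obtain ⟨a, ha⟩ := exists_at hm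
  obtain ⟨m', ha'⟩ := hc _ _ ha
  exact Cmp.of_one h ha' (by rwa [h2])

theorem Bt.inv (h : IsFactAut α') (h2 : ∀ x, α' (α x) = x) {m : X → X} (hm : Ok f m)
    {x y x' y' : X} (hB : Bt α f f' x y x' y') : Bt α' f' f x' y' x y := by
  obtain ⟨n, hn, e⟩ := hm.through (x := x) (y := y) (by rw [hB.1, hB.2.1]; rfl)
  exact ⟨hB.2.2.1, hB.2.2.2.1, hB.1, hB.2.1, Cmp.inv h h2 hB.2.2.2.2 (flip2_ok hn e)⟩

theorem Bt_far (h : IsFactAut α) (h' : IsFactAut α') (h2 : ∀ x, α' (α x) = x) (hc : Cmp α f f') {m : X → X} (hm : Ok f m)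
    {x y x' y' z w z' w' : X} (hB : Bt α f f' x y x' y') (hC : Bt α f f' z w z' w') (hxz : x ≠ z) (hyw : y ≠ w) :
    x' ≠ z' ∧ y' ≠ w' := by
  obtain ⟨n, hn, e1, e2⟩ := hm.through2 (x := x) (y := y) (z := z) (w := w) (by rw [hB.1, hB.2.1]; rfl)
    (by rw [hC.1, hC.2.1]; rfl) (by rw [hB.1, hC.1]) hxz hyw
  obtain ⟨a, ha⟩ := exists_at hn
  obtain ⟨m', ha'⟩ := hc _ _ ha
  have k1 := Bt_edge h hc hB ha ha' e1
  have k2 := Bt_edge h hc hC ha ha' e2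
  have := ha'.1.1
  have key : ¬ (x' = z' ∧ y' = w') := by
    rintro ⟨rfl, rfl⟩
    exact hxz ((hB.inv h' h2 hm).uniq ha'.1 (hC.inv h' h2 hm)).1
  grind

end Bt
end WF


namespace WF
universe u
section rook

theorem three (V : Type u) [Infinite V] : ∃ y1 y2 y3 : V, y1 ≠ y2 ∧ y1 ≠ y3 ∧ y2 ≠ y3 := by
  let e := Infinite.natEmbedding V
  exact ⟨e 0, e 1, e 2, by simp, by simp, by simp⟩

theorem rook {U V A B : Type u} [Infinite U] [Infinite V] (p : U → V → A) (q : U → V → B)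
    (hc : ∀ x y z w, (x = z ∨ y = w) ↔ (p x y = p z w ∨ q x y = q z w))
    (hi : ∀ x y z w, p x y = p z w → q x y = q z w → x = z ∧ y = w) :
    (∃ (s : U → A) (t : V → B), ∀ x y, p x y = s x ∧ q x y = t y) ∨
    (∃ (s : U → B) (t : V → A), ∀ x y, p x y = t y ∧ q x y = s x) := by
  classical
  obtain ⟨u1, u2, -, hu, -, -⟩ := three U
  obtain ⟨y1, y2, y3, h12, h13, h23⟩ := three V
  have row : ∀ x, (∀ y w, p x y = p x w) ∨ (∀ y w, q x y = q x w) := by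
    intro x
    have h1 : ∀ y w, p x y = p x w ∨ q x y = q x w := fun y w => (hc x y x w).1 (Or.inl rfl)
    have h2 : ∀ y w, p x y = p x w → q x y = q x w → y = w := fun y w e1 e2 => (hi _ _ _ _ e1 e2).2
    by_contra hcon
    push Not at hcon
    obtain ⟨⟨y, w, n1⟩, y', w', n2⟩ := hcon
    grind
  have mix : ∀ x x', (∀ y w, p x y = p x w) → (∀ y w, q x' y = q x' w) → False := by
    intro x x' h1 h2
    have c1 := (hc x y1 x' y1).1 (Or.inr rfl)
    have c2 := (hc x y2 x' y2).1 (Or.inr rfl)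
    have c3 := (hc x y3 x' y3).1 (Or.inr rfl)
    have a1 := h1 y1 y2
    have a2 := h1 y1 y3
    have b1 := h2 y1 y2
    have b2 := h2 y1 y3
    have := hi x y1 x y2
    have := hi x y1 x y3
    have := hi x y2 x y3
    have := hi x' y1 x' y2
    have := hi x' y1 x' y3
    have := hi x' y2 x' y3
    grind
  by_cases hall : ∀ x y w, p x y = p x w
  · left
    refine ⟨fun x => p x y1, fun y => q u1 y, fun x y => ⟨hall x _ _, ?_⟩⟩
    by_cases e : x = u1
    · rw [e]
    · rcases (hc x y u1 y).1 (Or.inr rfl) with h | h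
      · exfalso
        obtain ⟨w, hw⟩ : ∃ w, w ≠ y := exists_ne y
        have := (hc x y u1 w).2 (Or.inl (h.trans (hall u1 _ _)))
        grind
      · exact h
  · right
    push Not at hall
    obtain ⟨x0, y0, w0, hne⟩ := hall
    have hx0 : ∀ y w, q x0 y = q x0 w := by
      rcases row x0 with h | h
      · exact absurd (h _ _) hne
      · exact h
    have hall : ∀ x y w, q x y = q x w := by
      intro x
      rcases row x with h | h
      · exact (mix x x0 h hx0).elim
      · exact h
    refine ⟨fun x => q x y1, fun y => p u1 y, fun x y => ⟨?_, hall x _ _⟩⟩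
    by_cases e : x = u1
    · rw [e]
    · rcases (hc x y u1 y).1 (Or.inr rfl) with h | h
      · exact h
      · exfalso
        obtain ⟨w, hw⟩ : ∃ w, w ≠ y := exists_ne y
        have := (hc x y u1 w).2 (Or.inr (h.trans (hall u1 _ _)))
        grind
end rook

section sigma
variable {X : Type u} [DecidableEq X] [Infinite X] {α : FactPair X → FactPair X} {f : X → Bool}

theorem Ok.not {m : X → X} (h : Ok f m) : Ok (fun x => !f x) m := ⟨h.1, fun x => by simp [h.2]⟩

theorem exists_sigma0 (h : IsFactAut α) {m0 : X → X} (hm : Ok f m0) : ∃ (σ : X → X) (f' : X → Bool),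
    Cmp α f f' ∧ ((∀ x y, f x = true → f y = false → Bt α f f' x y (σ x) (σ y)) ∨
      (∀ x y, f x = true → f y = false → Bt α f f' x y (σ y) (σ x))) := by
  obtain ⟨α', h', k1, k2⟩ := aut_inv h
  obtain ⟨f', hc⟩ := exists_Cmp h hm
  obtain ⟨a0, ha0⟩ := exists_at hm
  obtain ⟨m1, ha1⟩ := hc _ _ ha0
  have hc' := hc.inv h' k2 hm
  have : ∀ (x : {x // f x = true}) (y : {x // f x = false}), ∃ x' y', Bt α f f' x.1 y.1 x' y' :=
    fun x y => Bt_ex h hc hm x.2 y.2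
  choose p q hB using this
  have i1 : Infinite {x // f x = true} := hm.infinite
  have i2 : Infinite {x // f x = false} := by
    have := hm.not.infinite
    simpa using this
  have key := rook p q (by
    intro x y z w
    constructor
    · intro hh
      by_contra hcon
      push Not at hcon
      have := Bt_far h' h k1 hc' ha1.1 ((hB x y).inv h' k2 hm) ((hB z w).inv h' k2 hm) hcon.1 hcon.2
      rcases hh with rfl | rfl
      · exact this.1 rfl
      · exact this.2 rfl
    · intro hh
      by_contra hcon
      push Not at hcon
      have := Bt_far h h' k2 hc hm (hB x y) (hB z w) (fun e => hcon.1 (Subtype.ext e)) (fun e => hcon.2 (Subtype.ext e))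
      exact hh.elim this.1 this.2) (by
    intro x y z w e1 e2
    have a := (hB x y).inv h' k2 hm
    have b := (hB z w).inv h' k2 hm
    rw [← e1, ← e2] at b
    have := a.uniq ha1.1 b
    exact ⟨Subtype.ext this.1, Subtype.ext this.2⟩)
  rcases key with ⟨s, t, hst⟩ | ⟨s, t, hst⟩
  · refine ⟨fun x => if hx : f x = true then s ⟨x, hx⟩ else t ⟨x, by simpa using hx⟩, f', hc, Or.inl ?_⟩
    intro x y hx hy
    have := hB ⟨x, hx⟩ ⟨y, hy⟩
    rw [(hst _ _).1, (hst _ _).2] at this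
    simpa [hx, hy] using this
  · refine ⟨fun x => if hx : f x = true then s ⟨x, hx⟩ else t ⟨x, by simpa using hx⟩, f', hc, Or.inr ?_⟩
    intro x y hx hy
    have := hB ⟨x, hx⟩ ⟨y, hy⟩
    rw [(hst _ _).1, (hst _ _).2] at this
    simpa [hx, hy] using this

theorem exists_sigma (h : IsFactAut α) {m0 : X → X} (hm : Ok f m0) : ∃ σ : Equiv.Perm X,
    ∀ a m, IsAt a f m → α a = permFactPair σ a := by
  obtain ⟨α', h', k1, k2⟩ := aut_inv h
  obtain ⟨σ, f', hc, hB⟩ := exists_sigma0 h hm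
  obtain ⟨a0, ha0⟩ := exists_at hm
  obtain ⟨m1, ha1⟩ := hc _ _ ha0
  have hc' := hc.inv h' k2 hm
  -- points of both colours
  have col : ∀ b, ∃ x, f x = b := by
    intro b
    obtain ⟨x⟩ := (inferInstance : Nonempty X)
    rcases bor b (f x) with rfl | rfl
    · exact ⟨x, rfl⟩
    · exact ⟨m0 x, hm.2 x⟩
  obtain ⟨xt, hxt⟩ := col true
  obtain ⟨xf, hxf⟩ := col false
  have fσ : ∃ b, ∀ x, f' (σ x) = (f x ^^ b) := by
    rcases hB with hB | hB
    · refine ⟨false, fun x => ?_⟩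
      cases hx : f x
      · exact (hB xt x hxt hx).2.2.2.1
      · exact (hB x xf hx hxf).2.2.1
    · refine ⟨true, fun x => ?_⟩
      cases hx : f x
      · exact (hB xt x hxt hx).2.2.1
      · exact (hB x xf hx hxf).2.2.2.1
  obtain ⟨b, fσ⟩ := fσ
  have inj : Function.Injective σ := by
    intro x y e
    have hf : f x = f y := by
      have := fσ x
      rw [e, fσ] at this
      simpa using this.symm
    cases hx : f x
    · rw [hx] at hf
      rcases hB with hB | hB
      · have h1 := (hB xt x hxt hx).inv h' k2 hm
        have h2 := (hB xt y hxt hf.symm).inv h' k2 hm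
        rw [← e] at h2
        exact (h1.uniq ha1.1 h2).2
      · have h1 := (hB xt x hxt hx).inv h' k2 hm
        have h2 := (hB xt y hxt hf.symm).inv h' k2 hm
        rw [← e] at h2
        exact (h1.uniq ha1.1 h2).2
    · rw [hx] at hf
      rcases hB with hB | hB
      · have h1 := (hB x xf hx hxf).inv h' k2 hm
        have h2 := (hB y xf hf.symm hxf).inv h' k2 hm
        rw [← e] at h2
        exact (h1.uniq ha1.1 h2).1
      · have h1 := (hB x xf hx hxf).inv h' k2 hm
        have h2 := (hB y xf hf.symm hxf).inv h' k2 hm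
        rw [← e] at h2
        exact (h1.uniq ha1.1 h2).1
  have surj : ∀ x' y', f' x' = true → f' y' = false → (∃ x, σ x = x') ∧ ∃ y, σ y = y' := by
    intro x' y' hx hy
    obtain ⟨x, y, hb⟩ := Bt_ex h' hc' ha1.1 hx hy
    have hb' := hb.inv h k1 ha1.1
    rcases hB with hB | hB
    · obtain ⟨e1, e2⟩ := hb'.uniq hm (hB x y hb'.1 hb'.2.1)
      exact ⟨⟨x, e1.symm⟩, y, e2.symm⟩
    · obtain ⟨e1, e2⟩ := hb'.uniq hm (hB x y hb'.1 hb'.2.1)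
      exact ⟨⟨y, e1.symm⟩, x, e2.symm⟩
  have surj : Function.Surjective σ := by
    intro x
    have := ha1.1.2 x
    cases hx : f' x
    · exact (surj (m1 x) x (by rw [this, hx]; rfl) hx).2
    · exact (surj x (m1 x) hx (by rw [this, hx]; rfl)).1
  have bij : Function.Bijective σ := ⟨inj, surj⟩
  refine ⟨Equiv.ofBijective σ bij, fun a m ha => ?_⟩
  obtain ⟨m', ha'⟩ := hc _ _ ha
  have comm : ∀ x, m' (σ x) = σ (m x) := by
    have key : ∀ x, f x = true → m' (σ x) = σ (m x) := by
      intro x hx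
      have hy : f (m x) = false := by rw [ha.1.2, hx]; rfl
      rcases hB with hB | hB
      · exact Bt_edge h hc (hB x (m x) hx hy) ha ha' rfl
      · have := Bt_edge h hc (hB x (m x) hx hy) ha ha' rfl
        rw [← this, ha'.1.1]
    intro x
    cases hx : f x
    · have := key (m x) (by rw [ha.1.2, hx]; rfl)
      rw [ha.1.1] at this
      rw [← this, ha'.1.1]
    · exact key x hx
  apply ext'
  · intro x y
    obtain ⟨x, rfl⟩ := surj x
    obtain ⟨y, rfl⟩ := surj y
    rw [R_perm, ha'.2.1, fσ, fσ, Equiv.ofBijective_symm_apply_apply, Equiv.ofBijective_symm_apply_apply, ha.2.1]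
    simp
  · intro x y
    obtain ⟨x, rfl⟩ := surj x
    obtain ⟨y, rfl⟩ := surj y
    rw [S_perm, ha'.2.2, comm, inj.eq_iff, inj.eq_iff, Equiv.ofBijective_symm_apply_apply, Equiv.ofBijective_symm_apply_apply, ha.2.2]

end sigma
end WF


namespace WF
universe u
section Det
variable {X : Type u}

theorem det_bool : ∀ a b c a' b' c' a'' b'' c'' : Bool,
    (a = a' → b = b' → c = c') → (a = a'' → b = b'' → c = c'') → (a'' = a' → b'' = b' → c'' = c') →
    (a = !a' → b = !b' → c = !c') → (a = !a'' → b = !b'' → c = !c'') → (a'' = !a' → b'' = !b' → c'' = !c') →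
    (c ^^ c') ≠ (a ^^ a') → (c ^^ c'') ≠ (b ^^ b'') → False := by
  intro a b c a' b' c' a'' b'' c''
  cases a <;> cases b <;> cases c <;> cases a' <;> cases b' <;> cases c' <;> simp <;>
    cases a'' <;> cases b'' <;> cases c'' <;> simp

theorem ker_of {f h : X → Bool} (x0 : X) (H : ∀ y, (h x0 ^^ h y) = (f x0 ^^ f y)) (x y : X) :
    h x = h y ↔ f x = f y := by
  have h1 := H x
  have h2 := H y
  revert h1 h2
  generalize h x = a; generalize h y = b; generalize f x = c; generalize f y = d
  generalize h x0 = a0; generalize f x0 = c0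
  revert a b c d a0 c0; decide

theorem Det {f0 f h : X → Bool} {m : X → X} (h0 : Ok f0 m) (h1 : Ok f m)
    (H : ∀ m', Ok f0 m' → Ok f m' → Ok h m') :
    (∀ x y, h x = h y ↔ f0 x = f0 y) ∨ (∀ x y, h x = h y ↔ f x = f y) := by
  classical
  have h2 := H m h0 h1
  have A : ∀ z w, f0 z = f0 w → f z = f w → h z = h w := by
    intro z w e0 e1
    by_cases hzw : z = w
    · rw [hzw]
    have k := H _ (h0.conj_swap e0) (h1.conj_swap e1)
    have k2 := k.2 w
    beta_reduce at k2
    have n1 : m z ≠ z := h0.ne z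
    have n2 : m z ≠ w := by
      intro e
      have := h0.2 z
      rw [e, e0] at this
      simp at this
    rw [Equiv.swap_apply_right, Equiv.swap_apply_of_ne_of_ne n1 n2, h2.2] at k2
    simpa using k2
  have B : ∀ z w, f0 z = (!f0 w) → f z = (!f w) → h z = !h w := by
    intro z w e0 e1
    rw [← h2.2]
    apply A
    · rw [h0.2, e0]
    · rw [h1.2, e1]
  by_cases hX : Nonempty X
  · obtain ⟨x0⟩ := hX
    by_contra hcon
    have n1 : ∃ y, (h x0 ^^ h y) ≠ (f0 x0 ^^ f0 y) := by
      by_contra hc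
      push Not at hc
      exact hcon (Or.inl (ker_of x0 hc))
    have n2 : ∃ y, (h x0 ^^ h y) ≠ (f x0 ^^ f y) := by
      by_contra hc
      push Not at hc
      exact hcon (Or.inr (ker_of x0 hc))
    obtain ⟨y, hy⟩ := n1
    obtain ⟨z, hz⟩ := n2
    exact det_bool _ _ _ _ _ _ _ _ _ (A x0 y) (A x0 z) (A z y) (B x0 y) (B x0 z) (B z y) hy hz
  · left
    intro x
    exact (hX ⟨x⟩).elim

variable [Infinite X]

/-- A large subset. -/
def Lg (p : X → Prop) : Prop := ∃ j : X → X, Function.Injective j ∧ ∀ u, p (j u)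

theorem Lg.mono {p q : X → Prop} (h : Lg p) (s : X → X) (hs : Function.Injective s) (H : ∀ x, p x → q (s x)) :
    Lg q := by
  obtain ⟨j, hj, hp⟩ := h
  exact ⟨fun u => s (j u), hs.comp hj, fun u => H _ (hp u)⟩

theorem Lg.pig {p : X → Prop} (q r : X → Prop) (h : Lg p) (H : ∀ x, p x → q x ∨ r x) : Lg q ∨ Lg r := by
  classical
  obtain ⟨j, hj, hp⟩ := h
  obtain ⟨b, i, hi, hb⟩ := WF.pig fun u => decide (q (j u))
  cases b
  · right
    refine ⟨fun u => j (i u), hj.comp hi, fun u => ?_⟩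
    have := hb u
    simp only [decide_eq_false_iff_not] at this
    exact (H _ (hp _)).resolve_left this
  · left
    exact ⟨fun u => j (i u), hj.comp hi, fun u => by simpa using hb u⟩

theorem Ok.inj {f : X → Bool} {m : X → X} (h : Ok f m) : Function.Injective m := by
  intro x y e
  rw [← h.1 x, e, h.1]

theorem Ok.lg_half {f : X → Bool} {m : X → X} (h : Ok f m) {p : X → Prop} (hp : Lg p)
    (hm : ∀ x, p x → p (m x)) (b : Bool) : Lg fun x => p x ∧ f x = b := by
  have : Lg (fun x => p x ∧ f x = b) ∨ Lg (fun x => p x ∧ f x = !b) :=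
    hp.pig _ _ (fun x hx => by rcases bor (f x) b with e | e <;> simp [hx, e])
  rcases this with h1 | h1
  · exact h1
  · exact h1.mono m h.inj fun x hx => ⟨hm x hx.1, by rw [h.2, hx.2]; simp⟩

theorem Lg_top : Lg fun _ : X => True := ⟨id, Function.injective_id, fun _ => trivial⟩

theorem cells {f0 f : X → Bool} {m0 n : X → X} (h0 : Ok f0 m0) (h : Ok f n) :
    ∃ f', Ok f' n ∧ ∀ a b, Lg fun x => f0 x = a ∧ f' x = b := by
  classical
  by_cases hM : Lg fun x => f0 (n x) = !f0 x
  · have hM' : Lg fun x => f0 (n x) = (!f0 x) ∧ f0 x = true := by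
      have : Lg (fun x => f0 (n x) = (!f0 x) ∧ f0 x = true) ∨ Lg (fun x => f0 (n x) = (!f0 x) ∧ f0 x = false) :=
        hM.pig _ _ (fun x hx => by cases e : f0 x <;> simp_all)
      rcases this with h1 | h1
      · exact h1
      · exact h1.mono n h.inj fun x hx => by rw [h.1]; simp [hx.1, hx.2]
    obtain ⟨j, hj, hp⟩ := hM'
    obtain ⟨β, hβ⟩ := exists_bal (U := X)
    let o : X → Bool := fun x => decide (∃ u, β u = true ∧ (x = j u ∨ x = n (j u)))
    have on : ∀ x, o (n x) = o x := by
      intro x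
      have h1 := h.1
      have : ∀ u, (n x = j u ∨ n x = n (j u)) ↔ (x = j u ∨ x = n (j u)) := by grind
      simp only [o, this]
    have oj : ∀ u, o (j u) = β u := by
      intro u
      cases hb : β u
      · simp only [o, decide_eq_false_iff_not]
        rintro ⟨v, hv, e | e⟩
        · have := hj e
          subst this
          simp [hb] at hv
        · have h1 := (hp u).2
          rw [e, (hp v).1, (hp v).2] at h1
          simp at h1
      · simp only [o, decide_eq_true_eq]
        exact ⟨u, hb, Or.inl rfl⟩
    let f' : X → Bool := fun x => if f0 (n x) = !f0 x then f0 x ^^ o x else f x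
    refine ⟨f', ⟨h.1, fun x => ?_⟩, ?_⟩
    · simp only [f', h.1, on, h.2]
      by_cases e : f0 (n x) = !f0 x
      · simp [e]
      · have e' : f0 x ≠ !f0 (n x) := by
          intro k; apply e; rw [k]; simp
        simp only [e, e', if_false]
    · have key : ∀ b, Lg fun x => f0 (n x) = (!f0 x) ∧ f0 x = true ∧ f' x = b := by
        intro b
        obtain ⟨i, hi, hb⟩ := hβ (!b)
        refine ⟨fun u => j (i u), hj.comp hi, fun u => ⟨(hp _).1, (hp _).2, ?_⟩⟩
        simp [f', hp, oj, hb]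
      have fn : ∀ x, f0 (n x) = (!f0 x) → f' (n x) = !f' x := by
        intro x e
        simp [f', h.1, on, e]
      intro a b
      cases a
      · exact (key (!b)).mono n h.inj fun x hx => ⟨by rw [hx.1, hx.2.1]; rfl, by rw [fn x hx.1, hx.2.2]; simp⟩
      · exact (key b).mono id Function.injective_id fun x hx => hx.2
  · refine ⟨f, h, fun a b => ?_⟩
    have h1 : Lg fun x => True ∧ f0 x = a := h0.lg_half Lg_top (fun _ _ => trivial) a
    have h2 := h1.pig _ (fun x => f0 x = a ∧ f0 (n x) = a) (fun x hx => by
      by_cases e : f0 (n x) = !f0 x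
      · exact Or.inl e
      · right
        refine ⟨hx.2, ?_⟩
        have := bne e
        simpa [hx.2] using this)
    have h3 := h2.resolve_left hM
    have h4 := h.lg_half h3 (fun x hx => by rw [h.1]; exact ⟨hx.2, hx.1⟩) b
    exact h4.mono id Function.injective_id fun x hx => ⟨hx.1.1, hx.2⟩

theorem common {f0 f : X → Bool} (H : ∀ a b, Lg fun x => f0 x = a ∧ f x = b) :
    ∃ m, Ok f0 m ∧ Ok f m := by
  have : ∀ p : Bool × Bool, Nonempty ({x // (f0 x, f x) = p} ≃ X) := by
    rintro ⟨a, b⟩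
    obtain ⟨j, hj, hp⟩ := H a b
    exact Function.Embedding.antisymm (⟨Subtype.val, Subtype.val_injective⟩)
      ⟨fun u => ⟨j u, Prod.ext (hp u).1 (hp u).2⟩, fun u v e => hj (Subtype.mk.inj e)⟩
  have e : ∀ p : Bool × Bool, {x // (f0 x, f x) = p} ≃ X := fun p => (this p).some
  let E : X ≃ X × (Bool × Bool) := (Equiv.sigmaFiberEquiv fun x => (f0 x, f x)).symm.trans ((Equiv.sigmaCongrRight e).trans
    ((Equiv.sigmaEquivProd _ X).trans (Equiv.prodComm _ _)))
  have hE : ∀ x, (E x).2 = (f0 x, f x) := fun x => rfl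
  have h0 : ∀ x, f0 x = (E x).2.1 := fun x => rfl
  have h1 : ∀ x, f x = (E x).2.2 := fun x => rfl
  clear_value E
  refine ⟨fun x => E.symm ((E x).1, (!(E x).2.1, !(E x).2.2)), ⟨fun x => ?_, fun x => ?_⟩, ⟨fun x => ?_, fun x => ?_⟩⟩
  · simp
  · rw [h0, h0]; simp
  · simp
  · rw [h1, h1]; simp

end Det

section Fix
variable {X : Type u} [DecidableEq X] [Infinite X] {α : FactPair X → FactPair X} {f0 : X → Bool}

theorem rule1 (h : IsFactAut α) (hfix : ∀ a m, IsAt a f0 m → α a = a) {f : X → Bool} {m : X → X}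
    (h0 : Ok f0 m) (h1 : Ok f m) : Cmp α f f := by
  obtain ⟨a, ha⟩ := exists_at h1
  obtain ⟨g, m', ha'⟩ := aut_at h ha
  have H : ∀ k, Ok f0 k → Ok f k → Ok g k ∧ ∀ c, IsAt c f k → IsAt (α c) g k := by
    intro k k0 k1
    obtain ⟨b, hb⟩ := exists_at k0
    obtain ⟨c, hc⟩ := exists_at k1
    obtain ⟨g', k', hc'⟩ := aut_at h hc
    have hb' : IsAt (α b) f0 k := by rw [hfix b k hb]; exact hb
    have := aut_S h hb hc hb' hc'
    subst this
    have := hc'.change (aut_R h hc ha hc' ha')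
    refine ⟨this.1, fun d hd => ?_⟩
    rw [hd.uniq hc]
    exact this
  have hg := (H m h0 h1).2 a ha
  rcases Det h0 h1 (fun k k0 k1 => (H k k0 k1).1) with e | e
  · obtain ⟨b, hb⟩ := exists_at h0
    have : α a = b := (hg.change e).uniq hb
    have hab : a = b := h.1.1 (by rw [this, hfix b m hb])
    subst hab
    exact Cmp.of_one h ha (by rwa [this])
  · exact Cmp.of_one h ha (hg.change e)

theorem rule2 (h : IsFactAut α) (hfix : ∀ a m, IsAt a f0 m → α a = a) {m0 : X → X} (hm0 : Ok f0 m0)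
    {a f n g n'} (ha : IsAt a f n) (ha' : IsAt (α a) g n') : n' = n := by
  obtain ⟨f', hf', hl⟩ := cells hm0 ha.1
  funext x
  have hf2 : Ok (flip2 f' x (n x)) n := flip2_ok hf' rfl
  have hl2 : ∀ a b, Lg fun z => f0 z = a ∧ flip2 f' x (n x) z = b := by
    intro a b
    have := (hl a b).pig (fun z => z = x ∨ z = n x) (fun z => f0 z = a ∧ flip2 f' x (n x) z = b) (by
      intro z hz
      by_cases e : z = x ∨ z = n x
      · exact Or.inl e
      · right; simp only [flip2, e, hz, decide_false, Bool.xor_false, and_self])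
    refine this.resolve_left ?_
    rintro ⟨j, hj, hp⟩
    have hfin : (Set.range j).Finite := (Set.toFinite ({x, n x} : Set X)).subset (by
      rintro _ ⟨u, rfl⟩; simpa using hp u)
    exact Set.infinite_range_of_injective hj hfin
  obtain ⟨k1, k1a, k1b⟩ := common hl
  obtain ⟨k2, k2a, k2b⟩ := common hl2
  obtain ⟨b, hb⟩ := exists_at hf'
  obtain ⟨c, hc⟩ := exists_at hf2
  obtain ⟨b1, hb'⟩ := rule1 h hfix k1a k1b _ _ hb
  obtain ⟨c1, hc'⟩ := rule1 h hfix k2a k2b _ _ hc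
  have e1 := aut_S h ha hb ha' hb'
  have e2 := aut_S h ha hc ha' hc'
  subst e1
  subst e2
  have q1 := hb'.1.2 x
  have q2 := hc'.1.2 x
  have q3 := hb'.1.ne x
  by_contra hne
  simp [flip2, q1, q3, hne] at q2

theorem rule3 (h : IsFactAut α) (hfix : ∀ a m, IsAt a f0 m → α a = a) {m0 : X → X} (hm0 : Ok f0 m0)
    {a f n} (ha : IsAt a f n) : α a = a := by
  obtain ⟨g, n', ha'⟩ := aut_at h ha
  have := rule2 h hfix hm0 ha ha'
  subst this
  have H : ∀ k, Ok f k → Ok g k := by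
    intro k hk
    obtain ⟨b, hb⟩ := exists_at hk
    obtain ⟨g', k', hb'⟩ := aut_at h hb
    have := rule2 h hfix hm0 hb hb'
    subst this
    exact (hb'.change (aut_R h hb ha hb' ha')).1
  have := Det ha.1 ha.1 (fun k hk _ => H k hk)
  rw [or_self] at this
  exact (ha'.change this).uniq ha

end Fix
end WF

namespace WF
universe u
section Fin
variable {X : Type u}

theorem Ok_conj_perm {f : X → Bool} {m : X → X} (h : Ok f m) (s : Equiv.Perm X)
    (hs : ∀ x, s (s x) = x) : Ok (fun x => f (s x)) (fun x => s (m (s x))) := by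
  refine ⟨fun x => ?_, fun x => ?_⟩
  · simp only [hs, h.1]
  · simp only [hs, h.2]

theorem Ok_thru (X : Type u) [Infinite X] {p q : X} (hpq : p ≠ q) : ∃ f m, Ok f m ∧ m p = q := by
  classical
  obtain ⟨f, m, h⟩ := exists_Ok X
  by_cases hm : m p = q
  · exact ⟨f, m, h, hm⟩
  refine ⟨_, _, Ok_conj_perm h (Equiv.swap (m p) q) (by simp), ?_⟩
  rw [Equiv.swap_apply_of_ne_of_ne (h.ne p).symm hpq]
  simp

theorem lift_at (c : FactPair X) {f : Quotient c.1.1 → Bool} {m : Quotient c.1.1 → Quotient c.1.1}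
    (h : Ok f m) : ∃ a k, IsAt a (fun x => f (coord c x).1) k ∧
      (∀ x, coord c (k x) = (m (coord c x).1, (coord c x).2)) ∧ FactLE a c := by
  have hk : ∀ x, coord c ((coord c).symm (m (coord c x).1, (coord c x).2)) =
      (m (coord c x).1, (coord c x).2) := fun x => by simp
  generalize hkk : (fun x => (coord c).symm (m (coord c x).1, (coord c x).2)) = k
  have hk' : ∀ x, coord c (k x) = (m (coord c x).1, (coord c x).2) := by
    intro x; rw [← hkk]; exact hk x
  have ok : Ok (fun x => f (coord c x).1) k := by
    refine ⟨fun x => ?_, fun x => ?_⟩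
    · apply (coord c).injective
      rw [hk', hk']
      simp [h.1]
    · simp only [hk', h.2]
  obtain ⟨a, ha⟩ := exists_at ok
  refine ⟨a, k, ha, hk', ?_⟩
  rw [ha.le_iff]
  refine ⟨fun x y hxy => ?_, fun x => ?_, fun x y hxy => ?_⟩
  · rw [(coord_fst c x y).2 hxy]
  · rw [← coord_snd, hk']
  · rw [← coord_fst, hk', hk', (coord_fst c x y).2 hxy]

theorem at_S {c : FactPair X} (hi : Infinite (Quotient c.1.1)) {x y : X} (h : S c x y)
    (hne : x ≠ y) : ∃ a f m, IsAt a f m ∧ FactLE a c ∧ S a x y := by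
  have h1 : (coord c x).1 ≠ (coord c y).1 := fun e => hne (sep ((coord_fst _ _ _).1 e) h)
  obtain ⟨f, m, hm, e⟩ := Ok_thru _ h1
  obtain ⟨a, k, ha, hk, hle⟩ := lift_at c hm
  refine ⟨a, _, k, ha, hle, (ha.2.2 _ _).2 (Or.inr ?_)⟩
  apply (coord c).injective
  rw [hk, e, (coord_snd c x y).2 h]

theorem at_R {c : FactPair X} (hi : Infinite (Quotient c.1.1)) {x y : X} (h : ¬ R c x y) :
    ∃ a f m, IsAt a f m ∧ FactLE a c ∧ ¬ R a x y := by
  have h1 : (coord c x).1 ≠ (coord c y).1 := fun e => h ((coord_fst _ _ _).1 e)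
  obtain ⟨f, m, hm, e⟩ := Ok_thru _ h1
  obtain ⟨a, k, ha, hk, hle⟩ := lift_at c hm
  refine ⟨a, _, k, ha, hle, ?_⟩
  rw [ha.2.1]
  dsimp only
  rw [← e, hm.2]
  simp

theorem incl {c d : FactPair X} (hi : Infinite (Quotient c.1.1))
    (H : ∀ a f m, IsAt a f m → FactLE a c → FactLE a d) :
    (∀ x y, S c x y → S d x y) ∧ (∀ x y, R d x y → R c x y) := by
  refine ⟨fun x y h => ?_, fun x y h => ?_⟩
  · by_cases hne : x = y
    · subst hne; exact S_refl _ _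
    obtain ⟨a, f, m, ha, hle, hs⟩ := at_S hi h hne
    exact ((le_iff0 _ _).1 (H _ _ _ ha hle)).2.1 _ _ hs
  · by_contra hn
    obtain ⟨a, f, m, ha, hle, hs⟩ := at_R hi hn
    exact hs (((le_iff0 _ _).1 (H _ _ _ ha hle)).1 _ _ h)

theorem fix_inf {α : FactPair X → FactPair X} (h : IsFactAut α)
    (hat : ∀ a f m, IsAt a f m → α a = a) {c : FactPair X} (hi : Infinite (Quotient c.1.1)) :
    α c = c := by
  have key : ∀ a f m, IsAt a f m → (FactLE a c ↔ FactLE a (α c)) := by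
    intro a f m ha
    rw [h.2.1, hat a f m ha]
  obtain ⟨h1, h2⟩ := incl hi (fun a f m ha => (key a f m ha).1)
  have hi2 : Infinite (Quotient (α c).1.1) :=
    Infinite.of_surjective (Quotient.map' (s₁ := (α c).1.1) (s₂ := c.1.1) id (fun x y hh => h2 x y hh))
      (fun q => by
        induction q using Quotient.inductionOn with | _ x
        exact ⟨Quotient.mk _ x, rfl⟩)
  obtain ⟨h3, h4⟩ := incl hi2 (fun a f m ha => (key a f m ha).2)
  exact ext' (fun x y => ⟨h2 x y, h4 x y⟩) (fun x y => ⟨h3 x y, h1 x y⟩)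

theorem fix_all [Infinite X] {α : FactPair X → FactPair X} (h : IsFactAut α)
    (hat : ∀ a f m, IsAt a f m → α a = a) (c : FactPair X) : α c = c := by
  by_cases h1 : Infinite (Quotient c.1.1)
  · exact fix_inf h hat h1
  by_cases h2 : Infinite (Quotient c.1.2)
  · have e := fix_inf h hat (c := FactPerp c) h2
    rw [h.2.2] at e
    exact congrArg FactPerp e
  rw [not_infinite_iff_finite] at h1 h2
  exact absurd (Finite.of_equiv _ (coord c).symm) (not_finite_iff_infinite.2 inferInstance)

theorem surj [Infinite X] {α : FactPair X → FactPair X} (h : IsFactAut α) :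
    ∃ σ : Equiv.Perm X, α = permFactPair σ := by
  classical
  obtain ⟨f0, m0, hm⟩ := exists_Ok X
  obtain ⟨σ, hσ⟩ := exists_sigma h hm
  refine ⟨σ, ?_⟩
  have hb : IsFactAut (permFactPair σ⁻¹ ∘ α) := aut_comp (perm_aut σ⁻¹) h
  have hfix : ∀ a m, IsAt a f0 m → (permFactPair σ⁻¹ ∘ α) a = a := by
    intro a m ha
    show permFactPair σ⁻¹ (α a) = a
    rw [hσ a m ha, perm_inv_cancel]
  have hall := fix_all hb (fun a f n ha => rule3 hb hfix hm ha)
  funext c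
  have := congrArg (permFactPair σ) (hall c)
  rw [← this]
  exact (perm_cancel_inv σ (α c)).symm

theorem comm_of {τ : Equiv.Perm X} (h : ∀ a, permFactPair τ a = a) {f : X → Bool} {m : X → X}
    (hm : Ok f m) (x : X) : m (τ x) = τ (m x) := by
  obtain ⟨a, ha⟩ := exists_at hm
  have h1 : S (permFactPair τ a) (τ x) (τ (m x)) := by
    rw [S_perm]
    simp only [Equiv.symm_apply_apply]
    exact (ha.2.2 _ _).2 (Or.inr rfl)
  rw [h a, ha.2.2] at h1
  rcases h1 with h1 | h1
  · exact absurd (τ.injective h1) (hm.ne x)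
  · exact h1.symm

theorem triv_of [Infinite X] {τ : Equiv.Perm X} (h : ∀ a, permFactPair τ a = a) : τ = 1 := by
  classical
  ext x
  by_contra hne
  change ¬ τ x = x at hne
  obtain ⟨y, hy⟩ := Infinite.exists_notMem_finset ({x, τ x} : Finset X)
  simp only [Finset.mem_insert, Finset.mem_singleton, not_or] at hy
  obtain ⟨f, m, hm, e⟩ := Ok_thru X (Ne.symm hy.1)
  obtain ⟨z, hz⟩ := Infinite.exists_notMem_finset ({x, y, τ x, m (τ x)} : Finset X)
  simp only [Finset.mem_insert, Finset.mem_singleton, not_or] at hz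
  obtain ⟨z1, z2, z3, z4⟩ := hz
  have c1 := comm_of h hm x
  have c2 := comm_of h (Ok_conj_perm hm (Equiv.swap (m (τ x)) z) (by simp)) x
  have hmx : m (m (τ x)) = τ x := hm.1 _
  have w1 : x ≠ m (τ x) := by
    intro e'
    rw [← e', e] at hmx
    exact hy.2 hmx
  have w2 : y ≠ m (τ x) := by
    intro e'
    rw [← e', ← e, hm.1] at hmx
    exact hne hmx.symm
  have s1 : Equiv.swap (m (τ x)) z x = x := Equiv.swap_apply_of_ne_of_ne w1 (Ne.symm z1)
  have s2 : Equiv.swap (m (τ x)) z y = y := Equiv.swap_apply_of_ne_of_ne w2 (Ne.symm z2)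
  have s3 : Equiv.swap (m (τ x)) z (τ x) = τ x :=
    Equiv.swap_apply_of_ne_of_ne (hm.ne _).symm (Ne.symm z3)
  rw [s1, s3, e, s2, Equiv.swap_apply_left] at c2
  rw [e] at c1
  exact z4 (c2.trans c1.symm)

theorem inj [Infinite X] {σ δ : Equiv.Perm X} (h : permFactPair σ = permFactPair δ) : σ = δ := by
  have : δ⁻¹ * σ = 1 := triv_of (fun a => by rw [perm_mul, h, perm_inv_cancel])
  exact (inv_mul_eq_one.1 this).symm

end Fin
end WF

/-- **Wigner's theorem for an infinite set.** For an infinite set `X`, the map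
`Γ : Perm X → Aut(Fact X)`, `Γ(σ)(θ,θ') = (σ(θ),σ(θ'))`, is a group isomorphism:
each `Γ(σ)` is an automorphism of `Fact X`, `Γ` is multiplicative and injective, and
every automorphism of `Fact X` equals `Γ(σ)` for some permutation `σ`. -/
theorem wigner_infinite_set (X : Type*) [Infinite X] :
    (∀ σ : Equiv.Perm X, IsFactAut (permFactPair σ)) ∧
    (∀ σ δ : Equiv.Perm X,
      permFactPair (X := X) (σ * δ) = permFactPair σ ∘ permFactPair δ) ∧
    Function.Injective (fun σ : Equiv.Perm X => permFactPair σ) ∧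
    (∀ α : FactPair X → FactPair X, IsFactAut α →
      ∃ σ : Equiv.Perm X, α = permFactPair σ) := by
  refine ⟨WF.perm_aut, fun σ δ => funext fun c => WF.perm_mul σ δ c, fun σ δ h => WF.inj h,
    fun α h => WF.surj h⟩
end

section
/- Let X be an infinite set, α an automorphism of Fact(X), and p a prime. Then (θ,θ') is a p-atom of Fact(X) if and only if α(θ,θ') is a p-atom of Fact(X). -/
namespace FactAux

open Function

variable {X A B : Type*}

/-- The factor pair given by a product decomposition. -/
def mkPair (e : X ≃ A × B) : FactPair X :=
  ⟨(Setoid.ker (fun x => (e x).1), Setoid.ker (fun x => (e x).2)), by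
    refine ⟨fun x y => ?_, fun x y => ⟨e.symm ((e x).1, (e y).2), ?_, ?_⟩⟩
    · constructor
      · rintro ⟨h1, h2⟩
        exact e.injective (Prod.ext h1 h2)
      · rintro rfl
        exact ⟨rfl, rfl⟩
    · simp [Setoid.ker_def]
    · simp [Setoid.ker_def]⟩

theorem mkPair_fst (e : X ≃ A × B) (x y : X) :
    (mkPair e).1.1 x y ↔ (e x).1 = (e y).1 := Iff.rfl

theorem mkPair_snd (e : X ≃ A × B) (x y : X) :
    (mkPair e).1.2 x y ↔ (e x).2 = (e y).2 := Iff.rfl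

theorem pair_ext {s t : FactPair X} (h1 : ∀ x y, s.1.1 x y ↔ t.1.1 x y)
    (h2 : ∀ x y, s.1.2 x y ↔ t.1.2 x y) : s = t := by
  apply Subtype.ext
  apply Prod.ext
  · exact Setoid.ext h1
  · exact Setoid.ext h2

/-- Product decomposition of a factor pair. -/
noncomputable def decomp (t : FactPair X) : X ≃ Quotient t.1.1 × Quotient t.1.2 :=
  Equiv.ofBijective (fun x => (Quotient.mk _ x, Quotient.mk _ x)) (by
    obtain ⟨h1, h2⟩ := t.2
    constructor
    · intro x y h
      rw [Prod.ext_iff] at h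
      exact (h1 x y).1 ⟨Quotient.exact h.1, Quotient.exact h.2⟩
    · rintro ⟨a, b⟩
      induction a using Quotient.inductionOn with | _ a => ?_
      induction b using Quotient.inductionOn with | _ b => ?_
      obtain ⟨z, hz1, hz2⟩ := h2 a b
      exact ⟨z, Prod.ext (Quotient.sound (t.1.1.symm' hz1)) (Quotient.sound hz2)⟩)

theorem mkPair_decomp (t : FactPair X) : mkPair (decomp t) = t := by
  apply pair_ext
  · intro x y
    rw [mkPair_fst]
    exact Quotient.eq
  · intro x y
    rw [mkPair_snd]
    exact Quotient.eq

noncomputable def rk (t : FactPair X) : ℕ := Nat.card (Quotient t.1.1)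
noncomputable def cork (t : FactPair X) : ℕ := Nat.card (Quotient t.1.2)

theorem rk_mul_cork (t : FactPair X) : rk t * cork t = Nat.card X := by
  rw [Nat.card_congr (decomp t), Nat.card_prod]; rfl

noncomputable def quotFst [Nonempty B] (e : X ≃ A × B) : Quotient (mkPair e).1.1 ≃ A :=
  Setoid.quotientKerEquivOfSurjective (fun x => (e x).1)
    (Prod.fst_surjective.comp e.surjective)

noncomputable def quotSnd [Nonempty A] (e : X ≃ A × B) : Quotient (mkPair e).1.2 ≃ B :=
  Setoid.quotientKerEquivOfSurjective (fun x => (e x).2)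
    (Prod.snd_surjective.comp e.surjective)

theorem rk_mkPair [Nonempty B] (e : X ≃ A × B) : rk (mkPair e) = Nat.card A :=
  Nat.card_congr (quotFst e)

theorem cork_mkPair [Nonempty A] (e : X ≃ A × B) : cork (mkPair e) = Nat.card B :=
  Nat.card_congr (quotSnd e)

/-- classes of `θ'` are in bijection with `X/θ`. -/
theorem card_class (t : FactPair X) (x : X) : Nat.card {y // t.1.2 x y} = rk t := by
  refine Nat.card_congr (Equiv.ofBijective (fun y => Quotient.mk _ y.1) ⟨?_, ?_⟩)
  · rintro ⟨y, hy⟩ ⟨z, hz⟩ h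
    apply Subtype.ext
    exact (t.2.1 y z).1 ⟨Quotient.exact h, t.1.2.trans' (t.1.2.symm' hy) hz⟩
  · intro a
    induction a using Quotient.inductionOn with | _ a => ?_
    obtain ⟨z, hz1, hz2⟩ := t.2.2 a x
    exact ⟨⟨z, t.1.2.symm' hz2⟩, Quotient.sound (t.1.1.symm' hz1)⟩

theorem isNRel_iff [Nonempty X] (t : FactPair X) (n : ℕ) : IsNRel n t.1.2 ↔ rk t = n := by
  unfold IsNRel
  simp [card_class]

/-- Lifting factor pairs of a factor. -/
def lift (e : X ≃ A × B) (s : FactPair A) : FactPair X :=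
  ⟨(Setoid.comap (fun x => (e x).1) s.1.1,
    Setoid.comap e (Setoid.prod s.1.2 (⊥ : Setoid B))), by
    refine ⟨fun x y => ⟨?_, ?_⟩, fun x y => ?_⟩
    · rintro ⟨h1, h2, h3⟩
      exact e.injective (Prod.ext ((s.2.1 _ _).1 ⟨h1, h2⟩) h3)
    · rintro rfl
      exact ⟨Setoid.refl' _ _, Setoid.refl' _ _⟩
    · obtain ⟨z, hz1, hz2⟩ := s.2.2 (e x).1 (e y).1
      refine ⟨e.symm (z, (e y).2), ?_, ?_, ?_⟩
      · simpa [Setoid.comap_rel] using hz1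
      · simpa using hz2
      · simp only [Equiv.apply_symm_apply]
        rfl⟩

theorem lift_fst (e : X ≃ A × B) (s : FactPair A) (x y : X) :
    (lift e s).1.1 x y ↔ s.1.1 (e x).1 (e y).1 := Iff.rfl

theorem lift_snd (e : X ≃ A × B) (s : FactPair A) (x y : X) :
    (lift e s).1.2 x y ↔ s.1.2 (e x).1 (e y).1 ∧ (e x).2 = (e y).2 := Iff.rfl

theorem lift_injective [Nonempty B] (e : X ≃ A × B) : Injective (lift e) := by
  intro s t h
  obtain ⟨b⟩ := ‹Nonempty B›
  apply pair_ext
  · intro a a'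
    have h1 := lift_fst e s (e.symm (a, b)) (e.symm (a', b))
    have h2 := lift_fst e t (e.symm (a, b)) (e.symm (a', b))
    rw [h] at h1
    simpa using h1.symm.trans h2
  · intro a a'
    have h1 := lift_snd e s (e.symm (a, b)) (e.symm (a', b))
    have h2 := lift_snd e t (e.symm (a, b)) (e.symm (a', b))
    rw [h] at h1
    simpa using h1.symm.trans h2

theorem lift_le (e : X ≃ A × B) (s : FactPair A) : FactLE (lift e s) (mkPair e) := by
  refine ⟨fun x y h => ?_, fun x y h => ?_, ?_⟩
  · rw [lift_fst, (mkPair_fst e x y).1 h]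
  · exact h.2
  · ext x y
    constructor
    · rintro ⟨z, h1, h2⟩
      rw [mkPair_fst] at h1
      rw [lift_snd] at h2
      refine ⟨e.symm ((e y).1, (e x).2), ?_, ?_⟩
      · rw [lift_snd]
        simp [h1, h2.1]
      · rw [mkPair_fst]
        simp
    · rintro ⟨z, h2, h1⟩
      rw [mkPair_fst] at h1
      rw [lift_snd] at h2
      refine ⟨e.symm ((e x).1, (e y).2), ?_, ?_⟩
      · rw [mkPair_fst]
        simp
      · rw [lift_snd]
        simp [← h1, h2.1]

theorem exists_lift [Nonempty B] (e : X ≃ A × B) (t : FactPair X)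
    (h : FactLE t (mkPair e)) : ∃ s, lift e s = t := by
  obtain ⟨b⟩ := ‹Nonempty B›
  obtain ⟨h1, h2, h3⟩ := h
  have k1 : ∀ x y x' y', (e x).1 = (e x').1 → (e y).1 = (e y').1 → t.1.1 x y → t.1.1 x' y' := by
    intro x y x' y' hx hy h
    have hx' : t.1.1 x x' := h1 hx
    have hy' : t.1.1 y y' := h1 hy
    exact t.1.1.trans' (t.1.1.symm' hx') (t.1.1.trans' h hy')
  have k2 : ∀ x y x' y', (e x).1 = (e x').1 → (e y).1 = (e y').1 → (e x').2 = (e y').2 →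
      t.1.2 x y → t.1.2 x' y' := by
    intro x y x' y' hx hy hxy h
    have : Relation.Comp (⇑(mkPair e).1.1) (⇑t.1.2) x' y := ⟨x, hx.symm, h⟩
    rw [h3] at this
    obtain ⟨z, hz1, hz2⟩ := this
    have hz3 : (e x').2 = (e z).2 := h2 hz1
    have hz4 : (e z).1 = (e y).1 := hz2
    have : z = y' := e.injective (Prod.ext (hz4.trans hy) (hz3.symm.trans hxy))
    exact this ▸ hz1
  refine ⟨⟨(Setoid.comap (fun a => e.symm (a, b)) t.1.1,
    Setoid.comap (fun a => e.symm (a, b)) t.1.2), ?_, ?_⟩, ?_⟩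
  · intro a a'
    constructor
    · rintro ⟨ha, hb⟩
      have := e.symm.injective ((t.2.1 _ _).1 ⟨ha, hb⟩)
      exact (Prod.ext_iff.1 this).1
    · rintro rfl
      exact ⟨Setoid.refl' _ _, Setoid.refl' _ _⟩
  · intro a a'
    obtain ⟨z, hz1, hz2⟩ := t.2.2 (e.symm (a, b)) (e.symm (a', b))
    refine ⟨(e z).1, k1 _ _ _ _ ?_ ?_ hz1, k2 _ _ _ _ ?_ ?_ ?_ hz2⟩ <;> simp
  · apply pair_ext
    · intro x y
      refine (lift_fst _ _ _ _).trans ?_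
      constructor
      · exact fun h => k1 _ _ _ _ (by simp) (by simp) h
      · exact fun h => k1 _ _ _ _ (by simp) (by simp) h
    · intro x y
      refine (lift_snd _ _ _ _).trans ?_
      constructor
      · rintro ⟨h, h'⟩
        exact k2 _ _ _ _ (by simp) (by simp) h' h
      · intro h
        exact ⟨k2 _ _ _ _ (by simp) (by simp) (by simp) h, h2 h⟩

theorem card_Iic [Nonempty B] (e : X ≃ A × B) :
    Nat.card {t : FactPair X // FactLE t (mkPair e)} = Nat.card (FactPair A) := by
  symm
  refine Nat.card_congr (Equiv.ofBijective (fun s => ⟨lift e s, lift_le e s⟩) ⟨?_, ?_⟩)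
  · intro s t h
    exact lift_injective e (Subtype.ext_iff.1 h)
  · rintro ⟨t, ht⟩
    obtain ⟨s, hs⟩ := exists_lift e t ht
    exact ⟨s, Subtype.ext hs⟩

theorem rk_lift [Nonempty B] (e : X ≃ A × B) (s : FactPair A) : rk (lift e s) = rk s := by
  obtain ⟨b⟩ := ‹Nonempty B›
  refine Nat.card_congr (Equiv.ofBijective
    (Quotient.map' (fun x => (e x).1) (fun _ _ h => h)) ⟨?_, ?_⟩)
  · intro x y
    induction x using Quotient.inductionOn with | _ x => ?_
    induction y using Quotient.inductionOn with | _ y => ?_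
    intro h
    have h1 : s.1.1 (e x).1 (e y).1 := Quotient.exact (s := s.1.1) h
    exact Quotient.sound (s := (lift e s).1.1) h1
  · intro a
    induction a using Quotient.inductionOn with | _ a => ?_
    refine ⟨Quotient.mk _ (e.symm (a, b)), ?_⟩
    apply Quotient.sound
    change s.1.1 (e (e.symm (a, b))).1 a
    simp only [Equiv.apply_symm_apply]
    exact Setoid.refl' _ _

theorem infinite_factPair [Infinite A] : Infinite (FactPair A) := by
  have h : ∀ n : ℕ, Nonempty (A ≃ A × Fin (n + 1)) := by
    intro n
    rw [← Cardinal.eq]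
    simp only [Cardinal.mk_prod, Cardinal.lift_id, Cardinal.mk_fin]
    simp only [Cardinal.lift_natCast, Cardinal.lift_uzero]
    rw [Cardinal.mul_eq_left (Cardinal.aleph0_le_mk A)
      ((Cardinal.natCast_lt_aleph0).le.trans (Cardinal.aleph0_le_mk A)) (by simp)]
  let e := fun n => (h n).some
  refine Infinite.of_injective (fun n => mkPair (e n)) ?_
  intro m n h
  have := congrArg cork h
  simpa [cork_mkPair] using this

instance finite_factPair [Finite A] : Finite (FactPair A) := by
  have : Finite (Setoid A) := Finite.of_injective (fun s : Setoid A => (fun x y => s x y))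
    (fun s t h => Setoid.ext (fun x y => iff_of_eq (congrFun (congrFun h x) y)))
  unfold FactPair
  infer_instance

/-- Factor pairs of given type. -/
def typ (A : Type*) (m k : ℕ) : Set (FactPair A) := {t | rk t = m ∧ cork t = k}

theorem card_typ [Finite A] {m k : ℕ} (hm : 0 < m) (hk : 0 < k) (hA : Nat.card A = m * k) :
    (typ A m k).ncard * (m.factorial * k.factorial) = (m * k).factorial := by
  have : NeZero m := ⟨hm.ne'⟩
  have : NeZero k := ⟨hk.ne'⟩
  have f0 : ∀ t : typ A m k, Nonempty (Quotient t.1.1.1 ≃ Fin m) := fun t =>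
    ⟨Finite.equivFinOfCardEq t.2.1⟩
  have g0 : ∀ t : typ A m k, Nonempty (Quotient t.1.1.2 ≃ Fin k) := fun t =>
    ⟨Finite.equivFinOfCardEq t.2.2⟩
  let f := fun t => (f0 t).some
  let g := fun t => (g0 t).some
  let Φ : typ A m k × (Equiv.Perm (Fin m) × Equiv.Perm (Fin k)) → (A ≃ Fin m × Fin k) :=
    fun q => (decomp q.1.1).trans
      (Equiv.prodCongr ((f q.1).trans q.2.1) ((g q.1).trans q.2.2))
  have hΦ1 : ∀ q x, (Φ q x).1 = q.2.1 (f q.1 (Quotient.mk _ x)) := fun q x => rfl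
  have hΦ2 : ∀ q x, (Φ q x).2 = q.2.2 (g q.1 (Quotient.mk _ x)) := fun q x => rfl
  have hmk : ∀ q, mkPair (Φ q) = q.1.1 := by
    intro q
    apply pair_ext
    · intro x y
      rw [mkPair_fst, hΦ1, hΦ1, EmbeddingLike.apply_eq_iff_eq, EmbeddingLike.apply_eq_iff_eq]
      exact Quotient.eq
    · intro x y
      rw [mkPair_snd, hΦ2, hΦ2, EmbeddingLike.apply_eq_iff_eq, EmbeddingLike.apply_eq_iff_eq]
      exact Quotient.eq
  have hbij : Bijective Φ := by
    constructor
    · rintro ⟨t, σ, τ⟩ ⟨t', σ', τ'⟩ h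
      have ht : t = t' := by
        apply Subtype.ext
        rw [← hmk (t, σ, τ), ← hmk (t', σ', τ'), h]
      subst ht
      have hσ : σ = σ' := by
        ext i
        obtain ⟨a, rfl⟩ := (f t).surjective i
        induction a using Quotient.inductionOn with | _ a => ?_
        have h1 := hΦ1 (t, σ, τ) a
        rw [h, hΦ1] at h1
        exact congrArg Fin.val h1.symm
      have hτ : τ = τ' := by
        ext i
        obtain ⟨a, rfl⟩ := (g t).surjective i
        induction a using Quotient.inductionOn with | _ a => ?_
        have h1 := hΦ2 (t, σ, τ) a
        rw [h, hΦ2] at h1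
        exact congrArg Fin.val h1.symm
      rw [hσ, hτ]
    · intro e
      let t : typ A m k := ⟨mkPair e, by rw [rk_mkPair]; simp, by rw [cork_mkPair]; simp⟩
      refine ⟨(t, (f t).symm.trans (quotFst e), (g t).symm.trans (quotSnd e)), ?_⟩
      ext x
      · rw [hΦ1]
        simp only [Equiv.trans_apply, Equiv.symm_apply_apply]
        rfl
      · rw [hΦ2]
        simp only [Equiv.trans_apply, Equiv.symm_apply_apply]
        rfl
  have h1 := Nat.card_congr (Equiv.ofBijective Φ hbij)
  have e0 : A ≃ Fin m × Fin k :=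
    (Finite.equivFinOfCardEq hA).trans finProdFinEquiv.symm
  rw [Nat.card_congr (Equiv.equivCongr e0 (Equiv.refl _)), Nat.card_prod, Nat.card_prod,
    Nat.card_perm, Nat.card_perm, Nat.card_coe_set_eq] at h1
  simp only [Nat.card_fin] at h1
  rw [h1]
  change Nat.card (Equiv.Perm (Fin m × Fin k)) = _
  rw [Nat.card_perm]
  simp

/-- The number of factor pairs of given type. -/
def H (m k : ℕ) : ℚ := ((m * k).factorial : ℚ) / (m.factorial * k.factorial)

theorem card_typ' [Finite A] {m k : ℕ} (hm : 0 < m) (hk : 0 < k) (hA : Nat.card A = m * k) :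
    ((typ A m k).ncard : ℚ) = H m k := by
  have := card_typ hm hk hA
  unfold H
  rw [eq_div_iff (by positivity)]
  exact_mod_cast this

theorem H_comm (m k : ℕ) : H m k = H k m := by
  unfold H
  rw [mul_comm m k, mul_comm (m.factorial : ℚ)]

theorem H_succ {m : ℕ} (hm : 0 < m) (k : ℕ) : H m k ≤ H m (k + 1) := by
  unfold H
  rw [div_le_div_iff₀ (by positivity) (by positivity)]
  have h1 : (m * k + 1).factorial ≤ (m * (k + 1)).factorial := by
    apply Nat.factorial_le
    rw [mul_add]; omega
  have h2 : k + 1 ≤ m * k + 1 := by nlinarith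
  have h3 : (k + 1) * (m * k).factorial ≤ (m * (k + 1)).factorial := by
    refine le_trans ?_ h1
    rw [Nat.factorial_succ]
    exact Nat.mul_le_mul_right _ h2
  rw [Nat.factorial_succ k]
  have : (m * k).factorial * (m.factorial * ((k + 1) * k.factorial)) ≤
    (m * (k + 1)).factorial * (m.factorial * k.factorial) := by
    calc _ = ((k + 1) * (m * k).factorial) * (m.factorial * k.factorial) := by ring
      _ ≤ _ := Nat.mul_le_mul_right _ h3
  exact_mod_cast this

theorem H_mono {m k l : ℕ} (hm : 0 < m) (h : k ≤ l) : H m k ≤ H m l :=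
  monotone_nat_of_le_succ (H_succ hm) h

theorem H_two (p : ℕ) : H 2 (p + 1) = 2 * (2 * p + 1) * H 2 p := by
  unfold H
  rw [show 2 * (p + 1) = 2 * p + 1 + 1 by ring, Nat.factorial_succ (2 * p + 1),
    Nat.factorial_succ (2 * p), Nat.factorial_succ p]
  have := Nat.factorial_pos p
  push_cast
  field_simp
  ring

theorem H_one (n : ℕ) : H 1 n = 1 := by
  unfold H
  have := Nat.factorial_pos n
  simp only [one_mul, Nat.factorial_one, Nat.cast_one]
  exact div_self (by positivity)

theorem H_key {p q k : ℕ} (hp : 2 ≤ p) (hpq : p < q) (hk : 2 ≤ k) :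
    2 + 2 * H 2 p < H q k := by
  have h1 : H 2 (p + 1) ≤ H q k := by
    calc H 2 (p + 1) ≤ H 2 q := H_mono (by norm_num) hpq
      _ = H q 2 := H_comm _ _
      _ ≤ H q k := H_mono (by omega) hk
  have h2 : 1 ≤ H 2 p := by
    calc (1 : ℚ) = H 2 1 := by rw [H_comm, H_one]
      _ ≤ H 2 p := H_mono (by norm_num) (by omega)
  rw [H_two] at h1
  have h3 : (2 : ℚ) ≤ p := by exact_mod_cast hp
  nlinarith

theorem divisors_two_mul {p m k : ℕ} (hp : p.Prime) (h : m * k = 2 * p) :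
    (m = 1 ∧ k = 2 * p) ∨ (m = 2 * p ∧ k = 1) ∨ (m = 2 ∧ k = p) ∨ (m = p ∧ k = 2) := by
  have hp0 := hp.pos
  have key : ∀ j l : ℕ, j * l = 2 → (j = 1 ∧ l = 2) ∨ (j = 2 ∧ l = 1) := by
    intro j l hjl
    have : j ∣ 2 := ⟨l, hjl.symm⟩
    rcases (Nat.dvd_prime Nat.prime_two).1 this with rfl | rfl
    · left; omega
    · right; omega
  rcases (hp.dvd_mul.1 (h ▸ Dvd.intro_left 2 rfl : p ∣ m * k)) with ⟨j, rfl⟩ | ⟨j, rfl⟩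
  · have : j * k = 2 := by
      apply Nat.eq_of_mul_eq_mul_left hp0
      rw [← mul_assoc, h, mul_comm]
    rcases key _ _ this with ⟨rfl, rfl⟩ | ⟨rfl, rfl⟩
    · simp
    · right; left; exact ⟨mul_comm _ _, rfl⟩
  · have : m * j = 2 := by
      apply Nat.eq_of_mul_eq_mul_left hp0
      rw [mul_left_comm, h, mul_comm]
    rcases key _ _ this with ⟨rfl, rfl⟩ | ⟨rfl, rfl⟩
    · left; exact ⟨rfl, mul_comm _ _⟩
    · simp

theorem upper [Finite A] {p : ℕ} (hp : p.Prime) (hA : Nat.card A = 2 * p) :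
    (Nat.card (FactPair A) : ℚ) ≤ 2 + 2 * H 2 p := by
  have hp0 := hp.pos
  have hU : (Set.univ : Set (FactPair A)) ⊆
      (typ A 1 (2 * p) ∪ typ A (2 * p) 1) ∪ (typ A 2 p ∪ typ A p 2) := by
    intro t _
    have := rk_mul_cork t
    rw [hA] at this
    rcases divisors_two_mul hp this with h | h | h | h
    · exact Or.inl (Or.inl h)
    · exact Or.inl (Or.inr h)
    · exact Or.inr (Or.inl h)
    · exact Or.inr (Or.inr h)
  have h1 := Set.ncard_le_ncard hU (Set.toFinite _)
  rw [Set.ncard_univ] at h1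
  have h2 := Set.ncard_union_le (typ A 1 (2 * p) ∪ typ A (2 * p) 1) (typ A 2 p ∪ typ A p 2)
  have h3 := Set.ncard_union_le (typ A 1 (2 * p)) (typ A (2 * p) 1)
  have h4 := Set.ncard_union_le (typ A 2 p) (typ A p 2)
  have h5 : Nat.card (FactPair A) ≤ (typ A 1 (2 * p)).ncard + (typ A (2 * p) 1).ncard +
    ((typ A 2 p).ncard + (typ A p 2).ncard) := by omega
  have h6 : (Nat.card (FactPair A) : ℚ) ≤ (typ A 1 (2 * p)).ncard + (typ A (2 * p) 1).ncard +
    ((typ A 2 p).ncard + (typ A p 2).ncard) := by exact_mod_cast h5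
  rw [card_typ' (by omega) (by omega) (by omega), card_typ' (by omega) (by omega) (by omega),
    card_typ' (by omega) (by omega) (by omega), card_typ' (by omega) (by omega) (by omega),
    H_one, H_comm (2 * p) 1, H_one, H_comm p 2] at h6
  linarith

theorem lower [Finite A] {q k : ℕ} (hq : 0 < q) (hk : 0 < k) (hA : Nat.card A = q * k) :
    H q k ≤ Nat.card (FactPair A) := by
  rw [← card_typ' hq hk hA]
  have := Set.ncard_le_ncard (Set.subset_univ (typ A q k)) (Set.toFinite _)
  rw [Set.ncard_univ] at this
  exact_mod_cast this

theorem zero_le (t : FactPair X) : FactLE (FactZero X) t := by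
  refine ⟨le_top, bot_le, ?_⟩
  ext x y
  constructor
  · rintro ⟨z, h1, h2⟩
    have h2 : z = y := h2
    subst h2
    exact ⟨x, rfl, h1⟩
  · rintro ⟨z, h1, h2⟩
    have h1 : x = z := h1
    subst h1
    exact ⟨y, h2, rfl⟩

theorem le_antisymm' {s t : FactPair X} (h : FactLE s t) (h' : FactLE t s) : s = t :=
  Subtype.ext (Prod.ext (le_antisymm h'.1 h.1) (le_antisymm h.2.1 h'.2.1))

/-- Rank one or two-fold existence above a given element. -/
theorem exists_above [Infinite X] (t : FactPair X) {p : ℕ} (hp : p.Prime) (ht : rk t = p) :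
    ∃ c : FactPair X, FactLT t c ∧ rk c = 2 * p ∧ Nat.card {s // FactLE s c} ≠ 0 ∧
      (Nat.card {s // FactLE s c} : ℚ) ≤ 2 + 2 * H 2 p := by
  have hfin : Finite (Quotient t.1.1) := by
    apply Nat.finite_of_card_ne_zero
    unfold rk at ht
    rw [ht]; exact hp.pos.ne'
  have hB : Infinite (Quotient t.1.2) := by
    by_contra hB
    rw [not_infinite_iff_finite] at hB
    have := Finite.of_equiv _ (decomp t).symm
    exact not_finite X
  have hne : Nonempty (Quotient t.1.1) := ⟨Quotient.mk _ (Classical.arbitrary X)⟩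
  obtain ⟨b⟩ : Nonempty (Quotient t.1.2 ≃ Fin 2 × Quotient t.1.2) := by
    rw [← Cardinal.eq]
    simp only [Cardinal.mk_prod, Cardinal.lift_id, Cardinal.mk_fin]
    simp only [Cardinal.lift_natCast, Cardinal.lift_uzero]
    rw [Cardinal.mul_eq_right (Cardinal.aleph0_le_mk _)
      ((Cardinal.natCast_lt_aleph0).le.trans (Cardinal.aleph0_le_mk _)) (by simp)]
  let e : X ≃ (Quotient t.1.1 × Fin 2) × Quotient t.1.2 :=
    ((decomp t).trans (Equiv.prodCongr (Equiv.refl _) b)).trans (Equiv.prodAssoc _ _ _).symm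
  have hlift : lift e (mkPair (Equiv.refl _)) = t := by
    apply pair_ext
    · intro x y
      rw [lift_fst, mkPair_fst]
      exact Quotient.eq
    · intro x y
      rw [lift_snd, mkPair_snd]
      have h1 : ((e x).1.2 = (e y).1.2 ∧ (e x).2 = (e y).2) ↔
          b (Quotient.mk _ x) = b (Quotient.mk _ y) := Prod.ext_iff.symm
      refine h1.trans ?_
      rw [EmbeddingLike.apply_eq_iff_eq]
      exact Quotient.eq
  have hcard : Nat.card (Quotient t.1.1 × Fin 2) = 2 * p := by
    rw [Nat.card_prod, mul_comm, ← ht]; simp [rk]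
  have hrk : rk (mkPair e) = 2 * p := by rw [rk_mkPair, hcard]
  refine ⟨mkPair e, ⟨?_, ?_⟩, hrk, ?_, ?_⟩
  · have := lift_le e (mkPair (Equiv.refl _))
    rwa [hlift] at this
  · intro h
    rw [← h, ht] at hrk
    have := hp.pos
    omega
  · rw [card_Iic]
    have : Nonempty (FactPair (Quotient t.1.1 × Fin 2)) := ⟨FactZero _⟩
    exact Nat.card_pos.ne'
  · rw [card_Iic]
    exact upper hp hcard

theorem above_lower [Infinite X] (t c : FactPair X) {p q : ℕ} (hp : 2 ≤ p) (hpq : p < q)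
    (ht : rk t = q) (hc : FactLT t c) (h0 : Nat.card {s // FactLE s c} ≠ 0) :
    2 + 2 * H 2 p < (Nat.card {s // FactLE s c} : ℚ) := by
  obtain ⟨hle, hne⟩ := hc
  have hB : Nonempty (Quotient c.1.2) := ⟨Quotient.mk _ (Classical.arbitrary X)⟩
  have hA : Nonempty (Quotient c.1.1) := ⟨Quotient.mk _ (Classical.arbitrary X)⟩
  have hI := card_Iic (decomp c)
  rw [mkPair_decomp] at hI
  rw [hI] at h0 ⊢
  have hfin : Finite (Quotient c.1.1) := by
    by_contra h
    rw [not_finite_iff_infinite] at h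
    have := infinite_factPair (A := Quotient c.1.1)
    exact h0 Nat.card_eq_zero_of_infinite
  rw [← mkPair_decomp c] at hle
  obtain ⟨s, hs⟩ := exists_lift _ _ hle
  have hrs : rk s = q := by rw [← rk_lift (decomp c), hs, ht]
  have hmul := rk_mul_cork s
  rw [hrs] at hmul
  have hpos : 0 < cork s := by
    have : 0 < Nat.card (Quotient c.1.1) := Nat.card_pos
    rw [← hmul] at this
    exact Nat.pos_of_mul_pos_left this
  have hne1 : cork s ≠ 1 := by
    intro h1
    apply hne
    have hsub : Subsingleton (Quotient s.1.2) :=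
      (Nat.card_eq_one_iff_unique.1 h1).1
    have h2 : ∀ x y, s.1.2 x y := fun x y => Quotient.exact (Subsingleton.elim _ _)
    have h3 : ∀ x y, s.1.1 x y ↔ x = y := fun x y => by
      rw [← s.2.1 x y]
      exact ⟨fun h => ⟨h, h2 x y⟩, fun h => h.1⟩
    rw [← hs]
    conv_rhs => rw [← mkPair_decomp c]
    apply pair_ext
    · intro x y
      rw [lift_fst, mkPair_fst, h3]
    · intro x y
      rw [lift_snd, mkPair_snd]
      exact ⟨fun h => h.2, fun h => ⟨h2 _ _, h⟩⟩
  exact (H_key hp hpq (by omega)).trans_le (lower (by omega) hpos hmul.symm)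

theorem atom_prime [Infinite X] (t : FactPair X) (h : IsFactAtom t) : (rk t).Prime := by
  have hB : Nonempty (Quotient t.1.2) := ⟨Quotient.mk _ (Classical.arbitrary X)⟩
  have hA : Nonempty (Quotient t.1.1) := ⟨Quotient.mk _ (Classical.arbitrary X)⟩
  have key : ∀ s : FactPair (Quotient t.1.1), cork s = 1 ∨ rk s = 1 := by
    intro s
    by_contra hs
    push Not at hs
    have hle := lift_le (decomp t) s
    rw [mkPair_decomp] at hle
    refine h.2 (lift (decomp t) s) ⟨zero_le _, ?_⟩ ⟨hle, ?_⟩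
    · intro h0
      apply hs.2
      rw [← rk_lift (decomp t), ← h0, rk, Nat.card_eq_one_iff_unique]
      exact ⟨⟨fun a b => by
        induction a using Quotient.inductionOn with | _ a => ?_
        induction b using Quotient.inductionOn with | _ b => ?_
        exact Quotient.sound trivial⟩, ⟨Quotient.mk _ (Classical.arbitrary X)⟩⟩
    · intro h0
      apply hs.1
      rw [cork, Nat.card_eq_one_iff_unique]
      refine ⟨⟨fun a b => ?_⟩, ⟨Quotient.mk _ (Classical.arbitrary _)⟩⟩
      induction a using Quotient.inductionOn with | _ a => ?_
      induction b using Quotient.inductionOn with | _ b => ?_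
      apply Quotient.sound
      obtain ⟨d⟩ := hB
      have h1 := lift_snd (decomp t) s ((decomp t).symm (a, d)) ((decomp t).symm (b, d))
      have h2 := mkPair_snd (decomp t) ((decomp t).symm (a, d)) ((decomp t).symm (b, d))
      have h4 : lift (decomp t) s = mkPair (decomp t) := h0.trans (mkPair_decomp t).symm
      rw [← h4] at h2
      have h3 := (h1.1 (h2.2 (by simp))).1
      simpa using h3
  have hfin : Finite (Quotient t.1.1) := by
    by_contra hf
    rw [not_finite_iff_infinite] at hf
    obtain ⟨b⟩ : Nonempty (Quotient t.1.1 ≃ Quotient t.1.1 × Fin 2) := by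
      rw [← Cardinal.eq]
      simp only [Cardinal.mk_prod, Cardinal.lift_id, Cardinal.mk_fin]
      simp only [Cardinal.lift_natCast, Cardinal.lift_uzero]
      rw [Cardinal.mul_eq_left (Cardinal.aleph0_le_mk _)
        ((Cardinal.natCast_lt_aleph0).le.trans (Cardinal.aleph0_le_mk _)) (by simp)]
    rcases key (mkPair b) with h1 | h1
    · rw [cork_mkPair] at h1
      simp at h1
    · rw [rk_mkPair, Nat.card_eq_zero_of_infinite] at h1
      omega
  have hpos : 0 < rk t := Nat.card_pos
  rw [Nat.prime_iff_not_exists_mul_eq]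
  constructor
  · by_contra h1
    have h1 : rk t = 1 := by omega
    have hsub : Subsingleton (Quotient t.1.1) := (Nat.card_eq_one_iff_unique.1 h1).1
    have h2 : ∀ x y, t.1.1 x y := fun x y => Quotient.exact (Subsingleton.elim _ _)
    apply h.1.2
    apply pair_ext
    · intro x y
      exact ⟨fun _ => h2 x y, fun _ => trivial⟩
    · intro x y
      have : t.1.2 x y ↔ x = y := by
        rw [← t.2.1 x y]
        exact ⟨fun h => ⟨h2 x y, h⟩, fun h => h.2⟩
      rw [this]
      rfl
  · rintro ⟨m, k, hm, hk, hmk⟩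
    have hm0 : 0 < m := Nat.pos_of_ne_zero (by rintro rfl; simp at hmk; omega)
    have hk0 : 0 < k := Nat.pos_of_ne_zero (by rintro rfl; simp at hmk; omega)
    have : NeZero m := ⟨hm0.ne'⟩
    have : NeZero k := ⟨hk0.ne'⟩
    let e : Quotient t.1.1 ≃ Fin m × Fin k :=
      (Finite.equivFinOfCardEq hmk.symm).trans finProdFinEquiv.symm
    rcases key (mkPair e) with h1 | h1
    · rw [cork_mkPair, Nat.card_fin] at h1
      subst h1; omega
    · rw [rk_mkPair, Nat.card_fin] at h1
      subst h1; omega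

section aut

variable {α : FactPair X → FactPair X}

theorem aut_zero (hα : IsFactAut α) : α (FactZero X) = FactZero X := by
  obtain ⟨y, hy⟩ := hα.1.2 (FactZero X)
  apply le_antisymm' _ (zero_le _)
  have := (hα.2.1 _ _).1 (zero_le y)
  rwa [hy] at this

theorem aut_lt (hα : IsFactAut α) (s t : FactPair X) : FactLT s t ↔ FactLT (α s) (α t) := by
  unfold FactLT
  rw [hα.2.1 s t, hα.1.1.ne_iff]

theorem aut_atom (hα : IsFactAut α) (t : FactPair X) : IsFactAtom t ↔ IsFactAtom (α t) := by
  unfold IsFactAtom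
  rw [hα.1.2.forall (p := fun x => FactLT (FactZero X) x → ¬ FactLT x (α t)),
    aut_lt hα (FactZero X) t, aut_zero hα]
  refine and_congr_right fun _ => forall_congr' fun x => ?_
  rw [aut_lt hα (FactZero X) x, aut_lt hα x t, aut_zero hα]

theorem aut_card (hα : IsFactAut α) (c : FactPair X) :
    Nat.card {s // FactLE s c} = Nat.card {s // FactLE s (α c)} :=
  Nat.card_congr ((Equiv.ofBijective α hα.1).subtypeEquiv fun s => hα.2.1 s c)

theorem aut_rk [Infinite X] (hα : IsFactAut α) (t : FactPair X) (ht : IsFactAtom t) :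
    rk t = rk (α t) := by
  have hp := atom_prime t ht
  have hq := atom_prime (α t) ((aut_atom hα t).1 ht)
  rcases lt_trichotomy (rk t) (rk (α t)) with h | h | h
  · exfalso
    obtain ⟨c, hc, -, h0, hle⟩ := exists_above t hp rfl
    rw [aut_card hα] at h0 hle
    exact absurd (above_lower (α t) (α c) hp.two_le h rfl ((aut_lt hα _ _).1 hc) h0)
      (not_lt.2 hle)
  · exact h
  · exfalso
    obtain ⟨c', hc, -, h0, hle⟩ := exists_above (α t) hq rfl
    obtain ⟨c, rfl⟩ := hα.1.2 c'
    rw [← aut_card hα] at h0 hle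
    exact absurd (above_lower t c hq.two_le h rfl ((aut_lt hα _ _).2 hc) h0)
      (not_lt.2 hle)

end aut

end FactAux

/-- Let `X` be infinite, `α` an automorphism of `Fact X` and `p` a prime. Then `(θ,θ')`
is a `p`-atom of `Fact X` iff `α(θ,θ')` is a `p`-atom of `Fact X`. -/
theorem factAut_preserves_p_atoms (X : Type*) [Infinite X]
    (α : FactPair X → FactPair X) (hα : IsFactAut α) (p : ℕ) (hp : p.Prime)
    (t : FactPair X) :
    IsPAtom p t ↔ IsPAtom p (α t) := by
  unfold IsPAtom
  rw [FactAux.isNRel_iff, FactAux.isNRel_iff, ← FactAux.aut_atom hα]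
  refine and_congr_right fun h => ?_
  rw [FactAux.aut_rk hα t h]
end
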